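/- arXiv:2301.04683 — 7 statements merged into one kernel-verified Lean document; each statement's English description precedes it below -/
import Mathlib

section
/- For every real number α ≥ 2, every finite subset X of the exponential lattice L(α) that is in strictly convex position and satisfies conv(X) ∩ L(α) = X has at most 5 elements; that is, h(α) ≤ 5. -/
/-- The exponential lattice `L(α) = {α^n : n ∈ ℕ₀}²`. -/
def expLattice (α : ℝ) : Set (ℝ × ℝ) :=
  {p | ∃ m n : ℕ, p = (α ^ m, α ^ n)}

/-- A set of points in the plane is in strictly convex position if no point of
the set lies in the convex hull of the other points. -/
def StrictConvexPos (X : Set (ℝ × ℝ)) : Prop :=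
  ∀ x ∈ X, x ∉ convexHull ℝ (X \ {x})

/-- `X` is the vertex set of an empty convex polygon in `S`. -/
def IsEmptyPolygonIn (S X : Set (ℝ × ℝ)) : Prop :=
  X ⊆ S ∧ StrictConvexPos X ∧ convexHull ℝ X ∩ S = X

/-- The point of the exponential lattice with the given pair of exponents. -/
def latticePoint (α : ℝ) (p : ℕ × ℕ) : ℝ × ℝ := (α ^ p.1, α ^ p.2)

/-- The triangle spanned by three lattice points contains no lattice points besides its vertices. -/
def EmptyTriangle (α : ℝ) (p q r : ℕ × ℕ) : Prop :=
  ∀ z, latticePoint α z ∈ convexHull ℝ {latticePoint α p, latticePoint α q, latticePoint α r} →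
    z = p ∨ z = q ∨ z = r

section Convex

variable {C : Set (ℝ × ℝ)}

theorem Convex.mem_of_vertical (hC : Convex ℝ C) {x a b y : ℝ} (ha : (x, a) ∈ C)
    (hb : (x, b) ∈ C) (hay : a ≤ y) (hyb : y ≤ b) : (x, y) ∈ C := by
  obtain ⟨s, t, hs, ht, hst, h⟩ : y ∈ segment ℝ a b := by
    rw [segment_eq_Icc (hay.trans hyb)]; exact ⟨hay, hyb⟩
  have := hC ha hb hs ht hst
  convert this using 1
  ext
  · simp [← add_mul, hst]
  · simpa using h.symm

theorem Convex.exists_mem_line (hC : Convex ℝ C) {p r : ℝ × ℝ} (hp : p ∈ C) (hr : r ∈ C) {x : ℝ}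
    (hpr : p.1 < r.1) (hpx : p.1 ≤ x) (hxr : x ≤ r.1) :
    ∃ y, (x, y) ∈ C ∧ (y - p.2) * (r.1 - p.1) = (x - p.1) * (r.2 - p.2) := by
  have h0 : 0 < r.1 - p.1 := sub_pos.2 hpr
  refine ⟨p.2 + (x - p.1) / (r.1 - p.1) * (r.2 - p.2), ?_, by field_simp; ring⟩
  have := hC.add_smul_sub_mem hp hr (t := (x - p.1) / (r.1 - p.1))
    ⟨div_nonneg (by linarith) h0.le, (div_le_one h0).2 (by linarith)⟩
  convert this using 1
  ext
  · simp; field_simp; ring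
  · simp

theorem Convex.mem_of_below_line (hC : Convex ℝ C) {p r : ℝ × ℝ} (hp : p ∈ C) (hr : r ∈ C)
    {x y b : ℝ} (hpr : p.1 < r.1) (hpx : p.1 ≤ x) (hxr : x ≤ r.1) (hb : (x, b) ∈ C)
    (hby : b ≤ y) (h : (y - p.2) * (r.1 - p.1) ≤ (x - p.1) * (r.2 - p.2)) : (x, y) ∈ C := by
  obtain ⟨c, hc, hcl⟩ := hC.exists_mem_line hp hr hpr hpx hxr
  refine hC.mem_of_vertical hb hc hby ?_
  rw [← hcl] at h
  linarith [le_of_mul_le_mul_right h (sub_pos.2 hpr)]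

theorem Convex.mem_of_above_line (hC : Convex ℝ C) {p r : ℝ × ℝ} (hp : p ∈ C) (hr : r ∈ C)
    {x y b : ℝ} (hpr : p.1 < r.1) (hpx : p.1 ≤ x) (hxr : x ≤ r.1) (hb : (x, b) ∈ C)
    (hyb : y ≤ b) (h : (x - p.1) * (r.2 - p.2) ≤ (y - p.2) * (r.1 - p.1)) : (x, y) ∈ C := by
  obtain ⟨c, hc, hcl⟩ := hC.exists_mem_line hp hr hpr hpx hxr
  refine hC.mem_of_vertical hc hb ?_ hyb
  rw [← hcl] at h
  linarith [le_of_mul_le_mul_right h (sub_pos.2 hpr)]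

end Convex

namespace EmptyTriangle

variable {α : ℝ} {p q r : ℕ × ℕ}

theorem swap (h : EmptyTriangle α p q r) : EmptyTriangle α p.swap q.swap r.swap := by
  intro z hz
  have key : latticePoint α z.swap ∈
      convexHull ℝ {latticePoint α p, latticePoint α q, latticePoint α r} := by
    have := Set.mem_image_of_mem (LinearEquiv.prodComm ℝ ℝ ℝ).toLinearMap hz
    rw [LinearMap.image_convexHull] at this
    simpa [Set.image_insert_eq, latticePoint] using this
  rcases h _ key with h | h | h
  · left; rw [← h, Prod.swap_swap]
  · right; left; rw [← h, Prod.swap_swap]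
  · right; right; rw [← h, Prod.swap_swap]

theorem of_convex (h : EmptyTriangle α p q r) (z : ℕ × ℕ)
    (hz : ∀ C : Set (ℝ × ℝ), Convex ℝ C → latticePoint α p ∈ C → latticePoint α q ∈ C →
      latticePoint α r ∈ C → latticePoint α z ∈ C) : z = p ∨ z = q ∨ z = r :=
  h z (hz _ (convex_convexHull ℝ _) (subset_convexHull ℝ _ (by simp))
    (subset_convexHull ℝ _ (by simp)) (subset_convexHull ℝ _ (by simp)))

theorem snd_le_of_fst_eq (h : EmptyTriangle α p q q) (hα : 2 ≤ α) (h1 : p.1 = q.1) : q.2 ≤ p.2 + 1 := by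
  by_contra! hlt
  have := h.of_convex (p.1, p.2 + 1) fun C hC hp hq _ => by
    unfold latticePoint at hp hq ⊢
    rw [← h1] at hq
    exact hC.mem_of_vertical hp hq (pow_le_pow_right₀ (by linarith) (by simp))
      (pow_le_pow_right₀ (by linarith) (by simpa using hlt.le))
  simp only [Prod.ext_iff] at this
  omega

theorem eq_corner (h : EmptyTriangle α p q r) (hα : 2 ≤ α)
    (h1 : r.1 ≤ p.1 ∧ p.1 < q.1 ∨ q.1 < p.1 ∧ p.1 ≤ r.1)
    (h2 : r.2 ≤ q.2 ∧ q.2 < p.2 ∨ p.2 < q.2 ∧ q.2 ≤ r.2) : r = (p.1, q.2) := by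
  have hmono {m n : ℕ} (h : m ≤ n) : α ^ m ≤ α ^ n := pow_le_pow_right₀ (by linarith) h
  have := h.of_convex (p.1, q.2) fun C hC hp hq hr => by
    obtain ⟨s, t, hs, ht, hst, hx⟩ : α ^ p.1 ∈ segment ℝ (α ^ r.1) (α ^ q.1) := by
      rw [segment_eq_uIcc, Set.mem_uIcc]
      rcases h1 with ⟨h, h'⟩ | ⟨h', h⟩
      · exact .inl ⟨hmono h, hmono h'.le⟩
      · exact .inr ⟨hmono h'.le, hmono h⟩
    have hu : (α ^ p.1, s * α ^ r.2 + t * α ^ q.2) ∈ C := by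
      convert hC hr hq hs ht hst using 1
      ext
      · simpa [latticePoint] using hx.symm
      · simp [latticePoint]
    have hq2 : α ^ q.2 = s * α ^ q.2 + t * α ^ q.2 := by rw [← add_mul, hst, one_mul]
    rcases h2 with ⟨h, h'⟩ | ⟨h', h⟩
    · refine hC.mem_of_vertical hu hp ?_ (hmono h'.le)
      nlinarith [mul_le_mul_of_nonneg_left (hmono h) hs]
    · refine hC.mem_of_vertical hp hu (hmono h'.le) ?_
      nlinarith [mul_le_mul_of_nonneg_left (hmono h) hs]
  simp only [Prod.ext_iff] at this ⊢
  omega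

theorem snd_le_of_antitone (h : EmptyTriangle α p q r) (hα : 2 ≤ α) (h1 : p.1 ≤ q.1)
    (h1' : q.1 < r.1) (h2 : r.2 ≤ q.2) : p.2 ≤ q.2 + 1 := by
  by_contra! hlt
  have hmono {m n : ℕ} (h : m ≤ n) : α ^ m ≤ α ^ n := pow_le_pow_right₀ (by linarith) h
  have hdouble {m n : ℕ} (h : m < n) : 2 * α ^ m ≤ α ^ n := by
    have := hmono (show m + 1 ≤ n from h)
    rw [pow_succ] at this
    nlinarith [pow_pos (show 0 < α by linarith) m]
  have := h.of_convex (q.1, q.2 + 1) fun C hC hp hq hr => by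
    have e1 := hdouble h1'
    have e2 := hdouble hlt
    have e3 := pow_pos (show 0 < α by linarith) p.1
    have e4 := pow_pos (show 0 < α by linarith) r.2
    have e5 := hmono h1
    have e6 := hmono (show r.2 ≤ q.2 + 1 by omega)
    refine hC.mem_of_below_line hp hr ?_ (hmono h1) (hmono h1'.le) hq (hmono (by simp)) ?_
    · simp only [latticePoint]; linarith
    · simp only [latticePoint]
      nlinarith [mul_nonneg (show 0 ≤ α ^ r.1 - α ^ p.1 by linarith)
          (show 0 ≤ α ^ p.2 - 2 * α ^ (q.2 + 1) + α ^ r.2 by linarith),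
        mul_nonneg (show 0 ≤ α ^ p.2 - α ^ r.2 by linarith)
          (show 0 ≤ α ^ r.1 - 2 * α ^ q.1 + α ^ p.1 by linarith)]
  simp only [Prod.ext_iff] at this
  omega

theorem add_le_add_of_horizontal (h : EmptyTriangle α p q r) (hα : 2 ≤ α) (h1 : p.1 < q.1)
    (h2 : p.2 < q.2) (hr1 : r.1 = q.1 + 1) (hr2 : r.2 = q.2) : q.2 + p.1 ≤ q.1 + p.2 := by
  by_contra! hlt
  have hmono {m n : ℕ} (h : m ≤ n) : α ^ m ≤ α ^ n := pow_le_pow_right₀ (by linarith) h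
  have := h.of_convex (q.1, q.2 - 1) fun C hC hp hq hr => by
    refine hC.mem_of_above_line hp hr (pow_lt_pow_right₀ (by linarith) (by omega)) (hmono h1.le)
      (hmono (by omega)) hq (hmono (by simp)) ?_
    obtain ⟨k, hk⟩ := Nat.exists_eq_add_of_le h1.le
    obtain ⟨l, hl⟩ : ∃ l, q.2 = p.2 + (l + 1) := ⟨q.2 - p.2 - 1, by omega⟩
    have hl' : q.2 - 1 = p.2 + l := by omega
    simp only [latticePoint, hr1, hr2, hl']
    rw [hl, hk]
    have e := mul_nonneg (mul_nonneg (mul_nonneg (pow_nonneg (show 0 ≤ α by linarith) p.1)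
      (pow_nonneg (show 0 ≤ α by linarith) p.2)) (show 0 ≤ α - 1 by linarith))
      (sub_nonneg.2 (hmono (show k ≤ l by omega)))
    simp only [pow_succ, pow_add]
    linear_combination e
  simp only [Prod.ext_iff] at this
  omega

theorem of_chain_of_below (h : EmptyTriangle α p q r) (hα : 2 ≤ α) (h1 : p.1 < q.1)
    (h1' : q.1 < r.1) (h2 : p.2 < q.2) (h2' : q.2 < r.2)
    (hle : (α ^ q.2 - α ^ p.2) * (α ^ r.1 - α ^ p.1) ≤
      (α ^ q.1 - α ^ p.1) * (α ^ r.2 - α ^ p.2)) :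
    r = (q.1 + 1, q.2 + 1) ∨ q.1 = p.1 + 1 ∧ r.2 + q.1 = q.2 + r.1 + 1 := by
  have hmono {m n : ℕ} (h : m ≤ n) : α ^ m ≤ α ^ n := pow_le_pow_right₀ (by linarith) h
  have hlt {m n : ℕ} (h : m < n) : α ^ m < α ^ n := pow_lt_pow_right₀ (by linarith) h
  have hpos (n : ℕ) : 0 < α ^ n := pow_pos (by linarith) n
  have hone (n : ℕ) : 1 ≤ α ^ n := one_le_pow₀ (by linarith)
  have hnn (n : ℕ) : 0 ≤ α ^ n - 1 := sub_nonneg.2 (hone n)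
  -- bounds for the ratio of two numbers of the form `α ^ n - 1`
  have hup (j n : ℕ) : (α ^ j - 1) * α ^ n ≤ α ^ (j + n) - 1 := by
    rw [pow_add]; linarith [hone n]
  have hlow (j n : ℕ) : α ^ (j + 1 + n) - 1 < (α ^ (j + 1) - 1) * α ^ (n + 1) := by
    have e1 : 1 * 1 ≤ α ^ j * (α - 1) := mul_le_mul (hone j) (by linarith) zero_le_one (hpos j).le
    have := mul_le_mul_of_nonneg_left e1 (mul_nonneg (hpos n).le (show 0 ≤ α by linarith))
    rw [pow_add, pow_succ α j, pow_succ α n]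
    linarith
  have hscale (a b i j k l : ℕ) : (α ^ (b + j) - α ^ b) * (α ^ (a + k) - α ^ a) ≤
      (α ^ (a + i) - α ^ a) * (α ^ (b + l) - α ^ b) ↔
      (α ^ j - 1) * (α ^ k - 1) ≤ (α ^ i - 1) * (α ^ l - 1) := by
    refine Iff.trans ?_ (mul_le_mul_iff_right₀ (mul_pos (hpos a) (hpos b)))
    simp only [pow_add]
    constructor <;> intro h <;> linarith
  obtain ⟨a, b⟩ := p
  obtain ⟨q1, q2⟩ := q
  obtain ⟨r1, r2⟩ := r
  simp only at h1 h1' h2 h2' hle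
  obtain ⟨i, rfl⟩ : ∃ i, q1 = a + (i + 1) := ⟨q1 - a - 1, by omega⟩
  obtain ⟨m, rfl⟩ : ∃ m, r1 = a + (i + 1 + (m + 1)) := ⟨r1 - (a + (i + 1)) - 1, by omega⟩
  obtain ⟨j, rfl⟩ : ∃ j, q2 = b + (j + 1) := ⟨q2 - b - 1, by omega⟩
  obtain ⟨n, rfl⟩ : ∃ n, r2 = b + (j + 1 + (n + 1)) := ⟨r2 - (b + (j + 1)) - 1, by omega⟩
  rw [hscale] at hle
  have hmn : m ≤ n := by
    by_contra! hnm
    have e1 := (hlow j (n + 1)).trans_le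
      (mul_le_mul_of_nonneg_left (hmono (show n + 1 + 1 ≤ m + 1 by omega)) (hnn (j + 1)))
    have e2 := mul_lt_mul_of_pos_left e1 (sub_pos.2 (one_lt_pow₀ (by linarith) (by omega)) :
      0 < α ^ (i + 1) - 1)
    have e3 := mul_le_mul_of_nonneg_left (hup (i + 1) (m + 1)) (hnn (j + 1))
    linarith
  have hnm : n ≤ m + 1 := by
    by_contra! hmn
    have := h.of_convex (a + (i + 1), b + (j + 2)) fun C hC hp hq hr => by
      refine hC.mem_of_below_line hp hr (hlt (by simp)) (hmono (by simp))
        (hmono (by simp)) hq (hmono (by simp)) ((hscale _ _ _ _ _ _).2 ?_)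
      have e1 := mul_le_mul_of_nonneg_left (hlow i (m + 1)).le (hnn (j + 2))
      have e2 := mul_le_mul_of_nonneg_left (hup (j + 2) n) (hnn (i + 1))
      have e3 := mul_le_mul_of_nonneg_left (hmono (show m + 1 + 1 ≤ n by omega))
        (mul_nonneg (hnn (i + 1)) (hnn (j + 2)))
      rw [show j + 1 + (n + 1) = j + 2 + n by ring]
      linarith
    simp only [Prod.ext_iff] at this
    omega
  obtain rfl | rfl : n = m ∨ n = m + 1 := by omega
  · left
    have := h.of_convex (a + (i + 1) + 1, b + (j + 1) + 1) fun C hC hp hq hr => by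
      obtain ⟨c, hc, hcl⟩ := hC.exists_mem_line hq hr (x := α ^ (a + (i + 1) + 1))
        (hlt (by simp)) (hmono (by simp)) (hmono (by simp))
      convert hc using 1
      ext
      · rfl
      · simp only [latticePoint] at hcl ⊢
        have e : 0 < α ^ (a + (i + 1 + (n + 1))) - α ^ (a + (i + 1)) :=
          sub_pos.2 (hlt (by omega))
        have : (α ^ (b + (j + 1) + 1) - α ^ (b + (j + 1))) *
            (α ^ (a + (i + 1 + (n + 1))) - α ^ (a + (i + 1))) =
            (c - α ^ (b + (j + 1))) * (α ^ (a + (i + 1 + (n + 1))) - α ^ (a + (i + 1))) := by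
          rw [hcl]; ring
        linarith [mul_right_cancel₀ e.ne' this]
    simp only [Prod.ext_iff] at this ⊢
    omega
  · right
    refine ⟨?_, by simp only; omega⟩
    by_contra! hi0
    obtain ⟨i, rfl⟩ : ∃ i', i = i' + 1 := ⟨i - 1, by simp only at hi0; omega⟩
    rcases le_or_gt (i + 1) j with hij | hij
    · have := h.of_convex (a + (i + 1), b + j) fun C hC hp hq hr => by
        obtain ⟨c, hc, hcl⟩ := hC.exists_mem_line hp hq (x := α ^ (a + (i + 1)))
          (hlt h1) (hmono (by simp)) (hmono (by simp))
        refine hC.mem_of_below_line hp hr (hlt (by simp)) (hmono (by simp))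
          (hmono (by simp; omega)) hc ?_ ((hscale _ _ _ _ _ _).2 ?_)
        · have e : 0 < α ^ (a + (i + 1 + 1)) - α ^ a := sub_pos.2 (hlt (by omega))
          have e1 : (c - α ^ b) * (α ^ (a + (i + 1 + 1)) - α ^ a) ≤
              (α ^ (b + j) - α ^ b) * (α ^ (a + (i + 1 + 1)) - α ^ a) := by
            simp only [latticePoint] at hcl
            rw [hcl, mul_comm, mul_comm (α ^ (b + j) - α ^ b)]
            rw [mul_comm, mul_comm (α ^ (a + (i + 1 + 1)) - α ^ a), mul_comm]
            have e2 := mul_nonneg (sub_nonneg.2 (hmono hij)) (show 0 ≤ α - 1 by linarith)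
            have e3 := mul_nonneg (mul_pos (hpos a) (hpos b)).le e2
            simp only [pow_add, pow_one] at e3 ⊢
            linarith
          linarith [le_of_mul_le_mul_right e1 e]
        · have e1 := mul_le_mul_of_nonneg_left (hlow i (m + 2)).le (hnn j)
          have e2 := mul_le_mul_of_nonneg_left (hup j (m + 2 + 1)) (hnn (i + 1))
          rw [show j + 1 + (m + 1 + 1) = j + (m + 2 + 1) by ring,
            show i + 1 + 1 + (m + 1) = i + 1 + (m + 2) by ring]
          linarith
      simp only [Prod.ext_iff] at this
      omega
    · have := h.of_convex (a + (i + 1), b + (j + 1)) fun C hC hp hq hr => by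
        obtain ⟨c, hc, hcl⟩ := hC.exists_mem_line hp hq (x := α ^ (a + (i + 1)))
          (hlt h1) (hmono (by simp)) (hmono (by simp))
        refine hC.mem_of_below_line hp hr (hlt (by simp)) (hmono (by simp))
          (hmono (by simp; omega)) hc ?_ ((hscale _ _ _ _ _ _).2 ?_)
        · have e : 0 < α ^ (a + (i + 1 + 1)) - α ^ a := sub_pos.2 (hlt (by omega))
          have e1 : (c - α ^ b) * (α ^ (a + (i + 1 + 1)) - α ^ a) ≤
              (α ^ (b + (j + 1)) - α ^ b) * (α ^ (a + (i + 1 + 1)) - α ^ a) := by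
            simp only [latticePoint] at hcl
            rw [hcl, mul_comm]
            exact mul_le_mul_of_nonneg_left (sub_le_sub_right (hmono (by omega)) _)
              (sub_nonneg.2 (hmono (by omega)))
          linarith [le_of_mul_le_mul_right e1 e]
        · rw [show i + 1 + 1 + (m + 1) = i + 1 + (m + 2) by ring,
            show j + 1 + (m + 1 + 1) = j + 1 + (m + 2) by ring, pow_add _ (i + 1) (m + 2),
            pow_add _ (j + 1) (m + 2)]
          linarith [mul_nonneg (sub_nonneg.2 (hmono (show j + 1 ≤ i + 1 by omega))) (hnn (m + 2))]
      simp only [Prod.ext_iff] at this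
      omega

theorem of_chain (h : EmptyTriangle α p q r) (hα : 2 ≤ α) (h1 : p.1 < q.1)
    (h1' : q.1 < r.1) (h2 : p.2 < q.2) (h2' : q.2 < r.2) :
    r = (q.1 + 1, q.2 + 1) ∨ q.1 = p.1 + 1 ∧ r.2 + q.1 = q.2 + r.1 + 1 ∨
      q.2 = p.2 + 1 ∧ r.1 + q.2 = q.1 + r.2 + 1 := by
  rcases le_total ((α ^ q.2 - α ^ p.2) * (α ^ r.1 - α ^ p.1))
    ((α ^ q.1 - α ^ p.1) * (α ^ r.2 - α ^ p.2)) with hle | hle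
  · exact (h.of_chain_of_below hα h1 h1' h2 h2' hle).imp_right .inl
  · rcases h.swap.of_chain_of_below hα h2 h2' h1 h1' hle with h | h
    · exact .inl (by simpa [Prod.ext_iff, and_comm] using h)
    · exact .inr (.inr h)

end EmptyTriangle

/-- Every triangle with vertices in `s` is empty. -/
def EmptyTriangles (α : ℝ) (s : Finset (ℕ × ℕ)) : Prop :=
  ∀ p ∈ s, ∀ q ∈ s, ∀ r ∈ s, EmptyTriangle α p q r

/-- The two points differ by a vector with coordinates of the same sign. -/
def StrictlyIncreasingPair (p q : ℕ × ℕ) : Prop :=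
  p.1 < q.1 ∧ p.2 < q.2 ∨ q.1 < p.1 ∧ q.2 < p.2

/-- The two points differ by a vector with coordinates of opposite signs. -/
def StrictlyDecreasingPair (p q : ℕ × ℕ) : Prop :=
  p.1 < q.1 ∧ q.2 < p.2 ∨ q.1 < p.1 ∧ p.2 < q.2

theorem Finset.exists_sorted_of_injOn {β γ : Type*} [LinearOrder γ] {s : Finset β} {n : ℕ}
    (hs : s.card = n) {key : β → γ} (hkey : Set.InjOn key s) :
    ∃ f : Fin n → β, (∀ i, f i ∈ s) ∧ ∀ i j, i < j → key (f i) < key (f j) := by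
  have hcard : (s.image key).card = n := by rw [Finset.card_image_of_injOn hkey, hs]
  have h (i : Fin n) : ∃ x ∈ s, key x = (s.image key).orderEmbOfFin hcard i :=
    Finset.mem_image.1 (Finset.orderEmbOfFin_mem _ hcard i)
  choose f hf hfk using h
  exact ⟨f, hf, fun i j hij => by simpa [hfk] using hij⟩

namespace EmptyTriangles

variable {α : ℝ} {s : Finset (ℕ × ℕ)} {p q r : ℕ × ℕ}

theorem snd_le (h : EmptyTriangles α s) (hα : 2 ≤ α) (hp : p ∈ s) (hq : q ∈ s)
    (h1 : p.1 = q.1) : q.2 ≤ p.2 + 1 :=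
  (h p hp q hq q hq).snd_le_of_fst_eq hα h1

theorem fst_le (h : EmptyTriangles α s) (hα : 2 ≤ α) (hp : p ∈ s) (hq : q ∈ s)
    (h2 : p.2 = q.2) : q.1 ≤ p.1 + 1 :=
  (h p hp q hq q hq).swap.snd_le_of_fst_eq hα h2

theorem not_increasing_decreasing (h : EmptyTriangles α s) (hα : 2 ≤ α) (hp : p ∈ s)
    (hq : q ∈ s) (hr : r ∈ s) (h1 : StrictlyIncreasingPair p q) :
    ¬ StrictlyDecreasingPair q r := by
  intro h2
  have c1 := (h p hp q hq r hr).eq_corner hα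
  have c2 := (h q hq p hp r hr).eq_corner hα
  have c3 := (h r hr q hq p hp).eq_corner hα
  have c4 := (h q hq r hr p hp).eq_corner hα
  simp only [Prod.ext_iff, StrictlyIncreasingPair, StrictlyDecreasingPair] at *
  omega

theorem coord_eq (h : EmptyTriangles α s) (hα : 2 ≤ α) (hp : p ∈ s) (hq : q ∈ s)
    (h1 : StrictlyIncreasingPair p q) {t : ℕ × ℕ} (hr : r ∈ s) (ht : t ∈ s)
    (h2 : StrictlyDecreasingPair r t) : p.1 = r.1 ∨ p.2 = r.2 := by
  have e1 := h.not_increasing_decreasing hα hq hp hr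
  have e2 := h.not_increasing_decreasing hα hp hr ht
  simp only [StrictlyIncreasingPair, StrictlyDecreasingPair] at *
  omega

theorem card_lt_of_increasing_of_decreasing (h : EmptyTriangles α s) (hα : 2 ≤ α)
    (hp : p ∈ s) (hq : q ∈ s) (h1 : StrictlyIncreasingPair p q) {t : ℕ × ℕ} (hr : r ∈ s)
    (ht : t ∈ s) (h2 : StrictlyDecreasingPair r t) : s.card < 5 := by
  suffices s ⊆ {p, q, r, t} from
    Nat.lt_succ_of_le ((Finset.card_le_card this).trans Finset.card_le_four)
  intro v hv
  have h1' : StrictlyIncreasingPair q p := h1.symm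
  have h2' : StrictlyDecreasingPair t r := h2.symm
  have epr := h.coord_eq hα hp hq h1 hr ht h2
  have ept := h.coord_eq hα hp hq h1 ht hr h2'
  have eqr := h.coord_eq hα hq hp h1' hr ht h2
  have eqt := h.coord_eq hα hq hp h1' ht hr h2'
  have hcase : (v.1 = p.1 ∨ v.2 = p.2) ∧ (v.1 = q.1 ∨ v.2 = q.2) ∨
      (v.1 = r.1 ∨ v.2 = r.2) ∧ (v.1 = t.1 ∨ v.2 = t.2) := by
    by_cases hvp : StrictlyIncreasingPair v p
    · exact .inr ⟨h.coord_eq hα hv hp hvp hr ht h2, h.coord_eq hα hv hp hvp ht hr h2'⟩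
    by_cases hvq : StrictlyIncreasingPair v q
    · exact .inr ⟨h.coord_eq hα hv hq hvq hr ht h2, h.coord_eq hα hv hq hvq ht hr h2'⟩
    left
    have e1 := h.not_increasing_decreasing hα hq hp hv h1'
    have e2 := h.not_increasing_decreasing hα hp hq hv h1
    simp only [StrictlyIncreasingPair, StrictlyDecreasingPair] at hvp hvq e1 e2
    omega
  simp only [Finset.mem_insert, Finset.mem_singleton, Prod.ext_iff, StrictlyIncreasingPair,
    StrictlyDecreasingPair] at h1 h2 ⊢
  clear h1' h2' h
  omega

theorem card_ne_six_of_not_increasing (h : EmptyTriangles α s) (hα : 2 ≤ α)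
    (hI : ∀ p ∈ s, ∀ q ∈ s, ¬ StrictlyIncreasingPair p q) : s.card ≠ 6 := by
  intro hs
  obtain ⟨f, hf, hlt⟩ := Finset.exists_sorted_of_injOn hs (key := fun p => (p.1 : ℤ) - p.2) (by
    intro p hp q hq hpq
    have := hI p hp q hq
    simp only [StrictlyIncreasingPair, Prod.ext_iff] at *
    omega)
  have hle (i j : Fin 6) (hij : i < j) : (f i).1 ≤ (f j).1 ∧ (f j).2 ≤ (f i).2 := by
    have e1 := hI _ (hf i) _ (hf j)
    have e2 := hlt i j hij
    simp only [StrictlyIncreasingPair] at *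
    omega
  have hstrict (i j k : Fin 6) (hij : i < j) (hjk : j < k) :
      (f i).1 < (f k).1 ∧ (f k).2 < (f i).2 := by
    have e1 := hle i j hij
    have e2 := hle j k hjk
    have e3 := hlt i j hij
    have e4 := hlt j k hjk
    have e5 := h.snd_le hα (hf k) (hf i)
    have e6 := h.fst_le hα (hf i) (hf k)
    omega
  have hmid (j : Fin 6) (h0 : 0 < j) (h1 : (f 0).1 < (f j).1 ∧ (f j).2 < (f 0).2)
      (h2 : (f j).1 < (f 5).1 ∧ (f 5).2 < (f j).2) :
      (f 0).2 = (f j).2 + 1 ∧ (f 5).1 = (f j).1 + 1 := by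
    have e1 := (h _ (hf 0) _ (hf j) _ (hf 5)).snd_le_of_antitone hα h1.1.le h2.1 h2.2.le
    have e2 := (h _ (hf 5) _ (hf j) _ (hf 0)).swap.snd_le_of_antitone hα h2.2.le h1.2 h1.1.le
    simp only [Prod.snd_swap] at e2
    omega
  have e1 := hmid 2 (by decide) (hstrict 0 1 2 (by decide) (by decide))
    (hstrict 2 3 5 (by decide) (by decide))
  have e2 := hmid 3 (by decide) (hstrict 0 1 3 (by decide) (by decide))
    (hstrict 3 4 5 (by decide) (by decide))
  have := hlt 2 3 (by decide)
  omega

theorem card_ne_six_of_not_decreasing (h : EmptyTriangles α s) (hα : 2 ≤ α)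
    (hD : ∀ p ∈ s, ∀ q ∈ s, ¬ StrictlyDecreasingPair p q) : s.card ≠ 6 := by
  intro hs
  obtain ⟨f, hf, hlt⟩ := Finset.exists_sorted_of_injOn hs (key := fun p => p.1 + p.2) (by
    intro p hp q hq hpq
    have := hD p hp q hq
    simp only [StrictlyDecreasingPair, Prod.ext_iff] at *
    omega)
  have hle (i j : Fin 6) (hij : i < j) : (f i).1 ≤ (f j).1 ∧ (f i).2 ≤ (f j).2 := by
    have e1 := hD _ (hf i) _ (hf j)
    have e2 := hlt i j hij
    simp only [StrictlyDecreasingPair] at *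
    omega
  have hstrict (i j k : Fin 6) (hij : i < j) (hjk : j < k) :
      (f i).1 < (f k).1 ∧ (f i).2 < (f k).2 := by
    have e1 := hle i j hij
    have e2 := hle j k hjk
    have e3 := hlt i j hij
    have e4 := hlt j k hjk
    have e5 := h.snd_le hα (hf i) (hf k)
    have e6 := h.fst_le hα (hf i) (hf k)
    omega
  have hchain (i j k : Fin 6) (hij : (f i).1 < (f j).1 ∧ (f i).2 < (f j).2)
      (hjk : (f j).1 < (f k).1 ∧ (f j).2 < (f k).2) :=
    (h _ (hf i) _ (hf j) _ (hf k)).of_chain hα hij.1 hjk.1 hij.2 hjk.2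
  have s02 := hstrict 0 1 2 (by decide) (by decide)
  have s03 := hstrict 0 1 3 (by decide) (by decide)
  have s24 := hstrict 2 3 4 (by decide) (by decide)
  have s25 := hstrict 2 3 5 (by decide) (by decide)
  have s35 := hstrict 3 4 5 (by decide) (by decide)
  have c024 := hchain 0 2 4 s02 s24
  have c025 := hchain 0 2 5 s02 s25
  have c035 := hchain 0 3 5 s03 s35
  have w1 := (h _ (hf 0) _ (hf 3) _ (hf 4)).add_le_add_of_horizontal hα s03.1 s03.2
  have w2 := (h _ (hf 0) _ (hf 3) _ (hf 4)).swap.add_le_add_of_horizontal hα s03.2 s03.1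
  have l23 := hle 2 3 (by decide)
  have l34 := hle 3 4 (by decide)
  have l45 := hle 4 5 (by decide)
  have k23 := hlt 2 3 (by decide)
  have k34 := hlt 3 4 (by decide)
  have k45 := hlt 4 5 (by decide)
  have a23 := h.snd_le hα (hf 2) (hf 3)
  have b23 := h.fst_le hα (hf 2) (hf 3)
  simp only [Prod.ext_iff, Prod.fst_swap, Prod.snd_swap] at *
  clear hlt hle hstrict hchain
  omega

theorem card_ne_six (h : EmptyTriangles α s) (hα : 2 ≤ α) : s.card ≠ 6 := by
  by_cases hI : ∀ p ∈ s, ∀ q ∈ s, ¬ StrictlyIncreasingPair p q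
  · exact h.card_ne_six_of_not_increasing hα hI
  by_cases hD : ∀ p ∈ s, ∀ q ∈ s, ¬ StrictlyDecreasingPair p q
  · exact h.card_ne_six_of_not_decreasing hα hD
  push Not at hI hD
  obtain ⟨p, hp, q, hq, hpq⟩ := hI
  obtain ⟨r, hr, t, ht, hrt⟩ := hD
  have := h.card_lt_of_increasing_of_decreasing hα hp hq hpq hr ht hrt
  omega

end EmptyTriangles

theorem latticePoint_injective {α : ℝ} (hα : 1 < α) : Function.Injective (latticePoint α) := by
  intro p q h
  simp only [latticePoint, Prod.mk.injEq] at h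
  have hinj := pow_right_injective₀ (by linarith) hα.ne'
  exact Prod.ext (hinj h.1) (hinj h.2)

theorem IsEmptyPolygonIn.emptyTriangle {α : ℝ} {X : Set (ℝ × ℝ)} (hα : 1 < α)
    (hX : IsEmptyPolygonIn (expLattice α) X) {p q r : ℕ × ℕ} (hp : latticePoint α p ∈ X)
    (hq : latticePoint α q ∈ X) (hr : latticePoint α r ∈ X) : EmptyTriangle α p q r := by
  obtain ⟨-, hconv, hempty⟩ := hX
  intro z hz
  have hsub : {latticePoint α p, latticePoint α q, latticePoint α r} ⊆ X := by
    simp [Set.insert_subset_iff, hp, hq, hr]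
  have hzX : latticePoint α z ∈ X := by
    rw [← hempty]
    exact ⟨convexHull_mono hsub hz, z.1, z.2, rfl⟩
  by_contra hne
  refine hconv _ hzX (convexHull_mono (Set.subset_sdiff_singleton hsub ?_) hz)
  simpa [(latticePoint_injective hα).eq_iff] using hne

theorem h_le_five_of_two_le (α : ℝ) (hα : 2 ≤ α)
    (X : Set (ℝ × ℝ)) (hfin : X.Finite)
    (hX : IsEmptyPolygonIn (expLattice α) X) :
    X.ncard ≤ 5 := by
  have hα1 : 1 < α := by linarith
  have hinj := latticePoint_injective hα1
  have himage : Set.image (latticePoint α) (Set.preimage (latticePoint α) X) = X := by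
    refine Set.image_preimage_eq_of_subset fun x hx => ?_
    obtain ⟨m, n, rfl⟩ := hX.1 hx
    exact ⟨(m, n), rfl⟩
  have hfin' := hfin.preimage hinj.injOn
  by_contra! hcard
  rw [← himage, Set.ncard_image_of_injective _ hinj, Set.ncard_eq_toFinset_card _ hfin'] at hcard
  obtain ⟨s, hs, hs6⟩ := Finset.exists_subset_card_eq (show 6 ≤ _ from hcard)
  have hmem {p : ℕ × ℕ} (hp : p ∈ s) : latticePoint α p ∈ X := by simpa using hs hp
  exact EmptyTriangles.card_ne_six
    (fun p hp q hq r hr => hX.emptyTriangle hα1 (hmem hp) (hmem hq) (hmem hr)) hα hs6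
end

section
/- For every real number α with (1+√5)/2 ≤ α < 2, every finite subset X of the exponential lattice L(α) that is in strictly convex position and satisfies conv(X) ∩ L(α) = X has at most 7 elements; that is, h(α) ≤ 7. -/
/-- Some point of the segment `[p, q]` lies vertically below `z` (or equals `z`). -/
def SegBelow (p q z : ℝ × ℝ) : Prop :=
  ∃ w ∈ segment ℝ p q, w.1 = z.1 ∧ w.2 ≤ z.2

/-- Some point of the segment `[p, q]` lies vertically above `z` (or equals `z`). -/
def SegAbove (p q z : ℝ × ℝ) : Prop :=
  ∃ w ∈ segment ℝ p q, w.1 = z.1 ∧ z.2 ≤ w.2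

lemma exists_mem_segment_fst {p q : ℝ × ℝ} {x : ℝ} (h₁ : p.1 ≤ x) (h₂ : x ≤ q.1) :
    ∃ s t : ℝ, 0 ≤ s ∧ 0 ≤ t ∧ s + t = 1 ∧ s * p.1 + t * q.1 = x := by
  have hx : x ∈ segment ℝ p.1 q.1 := by
    rw [segment_eq_Icc (h₁.trans h₂)]
    exact ⟨h₁, h₂⟩
  obtain ⟨s, t, hs, ht, hst, h⟩ := hx
  exact ⟨s, t, hs, ht, hst, by simpa using h⟩

lemma segBelow_of_line {p q z : ℝ × ℝ} (κ l : ℝ) (h₁ : p.1 ≤ z.1) (h₂ : z.1 ≤ q.1)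
    (hp : p.2 ≤ κ * p.1 + l) (hq : q.2 ≤ κ * q.1 + l) (hz : κ * z.1 + l ≤ z.2) :
    SegBelow p q z := by
  obtain ⟨s, t, hs, ht, hst, h⟩ := exists_mem_segment_fst h₁ h₂
  refine ⟨s • p + t • q, ⟨s, t, hs, ht, hst, rfl⟩, by simpa using h, ?_⟩
  have h1 := mul_le_mul_of_nonneg_left hp hs
  have h2 := mul_le_mul_of_nonneg_left hq ht
  have h3 : s * (κ * p.1 + l) + t * (κ * q.1 + l) = κ * z.1 + l := by
    linear_combination κ * h + l * hst
  simp only [Prod.snd_add, Prod.smul_snd, smul_eq_mul]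
  linarith

lemma segAbove_of_line {p q z : ℝ × ℝ} (κ l : ℝ) (h₁ : p.1 ≤ z.1) (h₂ : z.1 ≤ q.1)
    (hp : κ * p.1 + l ≤ p.2) (hq : κ * q.1 + l ≤ q.2) (hz : z.2 ≤ κ * z.1 + l) :
    SegAbove p q z := by
  obtain ⟨s, t, hs, ht, hst, h⟩ := exists_mem_segment_fst h₁ h₂
  refine ⟨s • p + t • q, ⟨s, t, hs, ht, hst, rfl⟩, by simpa using h, ?_⟩
  have h1 := mul_le_mul_of_nonneg_left hp hs
  have h2 := mul_le_mul_of_nonneg_left hq ht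
  have h3 : s * (κ * p.1 + l) + t * (κ * q.1 + l) = κ * z.1 + l := by
    linear_combination κ * h + l * hst
  simp only [Prod.snd_add, Prod.smul_snd, smul_eq_mul]
  linarith

lemma mem_convexHull_of_segBelow_of_segAbove {p q r s z : ℝ × ℝ} {S : Set (ℝ × ℝ)}
    (hp : p ∈ S) (hq : q ∈ S) (hr : r ∈ S) (hs : s ∈ S)
    (hb : SegBelow p q z) (ha : SegAbove r s z) : z ∈ convexHull ℝ S := by
  obtain ⟨w, hw, hw1, hw2⟩ := hb
  obtain ⟨u, hu, hu1, hu2⟩ := ha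
  have hw' := segment_subset_convexHull hp hq hw
  have hu' := segment_subset_convexHull hr hs hu
  have hz : z.2 ∈ segment ℝ w.2 u.2 := by
    rw [segment_eq_Icc (hw2.trans hu2)]
    exact ⟨hw2, hu2⟩
  obtain ⟨a, b, ha, hb, hab, h⟩ := hz
  have : z = a • w + b • u := by
    ext
    · simp only [Prod.fst_add, Prod.smul_fst, smul_eq_mul, hw1, hu1]
      rw [← add_mul, hab, one_mul]
    · simpa using h.symm
  rw [this]
  exact (convex_convexHull ℝ S) hw' hu' ha hb hab

lemma not_segBelow_of_line {p q z : ℝ × ℝ} (κ l : ℝ)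
    (hp : κ * p.1 + l < p.2) (hq : κ * q.1 + l < q.2) (hz : z.2 ≤ κ * z.1 + l) :
    ¬ SegBelow p q z := by
  rintro ⟨_, ⟨s, t, hs, ht, hst, rfl⟩, h1, h2⟩
  simp only [Prod.snd_add, Prod.smul_snd, Prod.fst_add, Prod.smul_fst, smul_eq_mul] at h1 h2
  have h3 : s * (κ * p.1 + l) + t * (κ * q.1 + l) = κ * z.1 + l := by
    linear_combination κ * h1 + l * hst
  rcases hs.eq_or_lt with rfl | hs
  · obtain rfl : t = 1 := by linarith
    linarith
  · have := mul_lt_mul_of_pos_left hp hs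
    have := mul_le_mul_of_nonneg_left hq.le ht
    linarith

lemma segBelow_of_cross {p q z : ℝ × ℝ} (h₁ : p.1 ≤ z.1) (h₂ : z.1 ≤ q.1) (h₃ : p.2 ≤ z.2)
    (h : (q.2 - p.2) * (z.1 - p.1) ≤ (z.2 - p.2) * (q.1 - p.1)) : SegBelow p q z := by
  rcases (h₁.trans h₂).eq_or_lt with he | hlt
  · exact ⟨p, left_mem_segment ℝ p q, le_antisymm h₁ (he ▸ h₂), h₃⟩
  · have hpos : 0 < q.1 - p.1 := sub_pos.2 hlt
    refine segBelow_of_line ((q.2 - p.2) / (q.1 - p.1)) (p.2 - (q.2 - p.2) / (q.1 - p.1) * p.1)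
      h₁ h₂ (by linarith) (le_of_eq ?_) ?_
    · field_simp
      ring
    · have : (q.2 - p.2) / (q.1 - p.1) * (z.1 - p.1) ≤ z.2 - p.2 := by
        rw [div_mul_eq_mul_div, div_le_iff₀ hpos]
        exact h
      linarith

lemma segBelow_or_segBelow_swap {p q z : ℝ × ℝ} (h₁ : p.1 ≤ z.1) (h₂ : z.1 ≤ q.1)
    (h₃ : p.2 ≤ z.2) (h₄ : z.2 ≤ q.2) :
    SegBelow p q z ∨ SegBelow p.swap q.swap z.swap := by
  rcases le_total ((q.2 - p.2) * (z.1 - p.1)) ((z.2 - p.2) * (q.1 - p.1)) with h | h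
  · exact Or.inl (segBelow_of_cross h₁ h₂ h₃ h)
  · refine Or.inr (segBelow_of_cross h₃ h₄ h₁ ?_)
    simp only [Prod.fst_swap, Prod.snd_swap]
    linarith

/-- The point of the exponential lattice with exponents `p`. -/
def latticePt (α : ℝ) (p : ℕ × ℕ) : ℝ × ℝ := (α ^ p.1, α ^ p.2)

/-- A set of exponent pairs such that each lattice point in the convex hull of some of the
corresponding lattice points is one of them. -/
def HullFree (α : ℝ) (E : Set (ℕ × ℕ)) : Prop :=
  ∀ T ⊆ E, ∀ z, latticePt α z ∈ convexHull ℝ (latticePt α '' T) → z ∈ T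

lemma latticePt_injective {α : ℝ} (hα : 1 < α) : Function.Injective (latticePt α) := by
  intro p q h
  simp only [latticePt, Prod.mk.injEq] at h
  have hi := pow_right_injective₀ (zero_lt_one.trans hα) hα.ne'
  exact Prod.ext (hi h.1) (hi h.2)

lemma hullFree_of_isEmptyPolygonIn {α : ℝ} (hα : 1 < α) {X : Set (ℝ × ℝ)}
    (hX : IsEmptyPolygonIn (expLattice α) X) : HullFree α (latticePt α ⁻¹' X) := by
  obtain ⟨-, hconv, hempty⟩ := hX
  intro T hT z hz
  have hTX : latticePt α '' T ⊆ X := Set.image_subset_iff.2 hT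
  have hzX : latticePt α z ∈ X := by
    rw [← hempty]
    exact ⟨convexHull_mono hTX hz, z.1, z.2, rfl⟩
  by_contra hzT
  have hsub : latticePt α '' T ⊆ X \ {latticePt α z} := by
    rintro _ ⟨t, ht, rfl⟩
    refine ⟨hT ht, fun h => hzT ?_⟩
    exact latticePt_injective hα h ▸ ht
  exact hconv _ hzX (convexHull_mono hsub hz)

lemma HullFree.swap {α : ℝ} {E : Set (ℕ × ℕ)} (hE : HullFree α E) :
    HullFree α (Prod.swap '' E) := by
  intro T hT z hz
  have h1 : latticePt α z.swap ∈ convexHull ℝ (latticePt α '' (Prod.swap '' T)) := by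
    have h2 := Set.mem_image_of_mem (LinearEquiv.prodComm ℝ ℝ ℝ).toLinearMap hz
    rw [LinearMap.image_convexHull] at h2
    rw [Set.image_image] at h2 ⊢
    exact h2
  have h3 := hE (Prod.swap '' T) (by
    rintro _ ⟨t, ht, rfl⟩
    obtain ⟨e, he, rfl⟩ := hT ht
    simpa using he) _ h1
  obtain ⟨t, ht, h⟩ := h3
  rwa [← Prod.swap_injective h]

lemma HullFree.eq_of_segBelow_of_segAbove {α : ℝ} {E : Set (ℕ × ℕ)} (hE : HullFree α E)
    {p q r s z : ℕ × ℕ} (hp : p ∈ E) (hq : q ∈ E) (hr : r ∈ E) (hs : s ∈ E)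
    (hb : SegBelow (latticePt α p) (latticePt α q) (latticePt α z))
    (ha : SegAbove (latticePt α r) (latticePt α s) (latticePt α z)) :
    z = p ∨ z = q ∨ z = r ∨ z = s := by
  have h := hE {p, q, r, s} (by
    rintro x (rfl | rfl | rfl | rfl) <;> assumption) z
    (mem_convexHull_of_segBelow_of_segAbove (Set.mem_image_of_mem _ (by simp))
      (Set.mem_image_of_mem _ (by simp)) (Set.mem_image_of_mem _ (by simp))
      (Set.mem_image_of_mem _ (by simp)) hb ha)
  simpa using h

lemma HullFree.exists_functional {α : ℝ} {E : Set (ℕ × ℕ)} (hE : HullFree α E)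
    (hfin : E.Finite) {v : ℕ × ℕ} :
    ∃ u w : ℝ, ∀ x ∈ E, x ≠ v →
      u * α ^ x.1 + w * α ^ x.2 < u * α ^ v.1 + w * α ^ v.2 := by
  have hv : latticePt α v ∉ convexHull ℝ (latticePt α '' (E \ {v})) := fun h =>
    (hE _ Set.sdiff_subset v h).2 rfl
  have hc : IsClosed (convexHull ℝ (latticePt α '' (E \ {v}))) :=
    ((hfin.subset Set.sdiff_subset).image _).isClosed_convexHull ℝ
  obtain ⟨f, c, hf, hfc⟩ := geometric_hahn_banach_closed_point (convex_convexHull ℝ _) hc hv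
  have hf' : ∀ x : ℝ × ℝ, f x = f (1, 0) * x.1 + f (0, 1) * x.2 := by
    intro x
    have : x = x.1 • ((1 : ℝ), (0 : ℝ)) + x.2 • ((0 : ℝ), (1 : ℝ)) := by ext <;> simp
    conv_lhs => rw [this, map_add, map_smul, map_smul, smul_eq_mul, smul_eq_mul]
    ring
  refine ⟨f (1, 0), f (0, 1), fun x hx hxv => ?_⟩
  have h1 := (hf _ (subset_convexHull ℝ _ (Set.mem_image_of_mem _ ⟨hx, hxv⟩))).trans hfc
  rw [hf', hf' (latticePt α v)] at h1
  exact h1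

lemma card_le_of_antichain {S : Finset (ℕ × ℕ)} {k : ℕ}
    (hinj : Set.InjOn Prod.fst (S : Set (ℕ × ℕ)))
    (hmid : ∀ p ∈ S, ∀ q ∈ S, ∀ r ∈ S, p.1 < q.1 → q.1 < r.1 → r.1 ≤ q.1 + k) :
    S.card ≤ k + 2 := by
  rw [← Finset.card_image_of_injOn hinj]
  set T := S.image Prod.fst with hT
  rcases T.eq_empty_or_nonempty with h | h
  · simp [h]
  · have hsub : T ⊆ insert (T.min' h) (Finset.Icc (T.max' h - k) (T.max' h)) := by
      intro x hx
      rw [Finset.mem_insert, Finset.mem_Icc]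
      have h1 := T.min'_le x hx
      have h2 := T.le_max' x hx
      have hm := T.min'_mem h
      have hM := T.max'_mem h
      generalize T.min' h = a at *
      generalize T.max' h = b at *
      rw [hT, Finset.mem_image] at hm hM hx
      obtain ⟨p, hp, rfl⟩ := hm
      obtain ⟨r, hr, rfl⟩ := hM
      obtain ⟨q, hq, rfl⟩ := hx
      have := hmid p hp q hq r hr
      omega
    calc T.card ≤ _ := Finset.card_le_card hsub
      _ ≤ _ := Finset.card_insert_le _ _
      _ ≤ k + 2 := by
        rw [Nat.card_Icc]
        omega

lemma card_le_three_of_upper {α : ℝ} (hα : 1 < α) (hφ : α + 1 ≤ α ^ 2) {S : Finset (ℕ × ℕ)}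
    (hS : ∀ v ∈ S, ∃ u w : ℝ, 0 ≤ u ∧ 0 ≤ w ∧ ∀ x ∈ S, x ≠ v →
      u * α ^ x.1 + w * α ^ x.2 < u * α ^ v.1 + w * α ^ v.2) : S.card ≤ 3 := by
  have hanti : ∀ p ∈ S, ∀ q ∈ S, p ≠ q → p.1 ≤ q.1 → q.2 < p.2 := by
    intro p hp q hq hne h
    by_contra! h'
    obtain ⟨u, w, hu, hw, hlt⟩ := hS p hp
    have h1 := mul_le_mul_of_nonneg_left (pow_le_pow_right₀ hα.le h) hu
    have h2 := mul_le_mul_of_nonneg_left (pow_le_pow_right₀ hα.le h') hw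
    linarith [hlt q hq hne.symm]
  refine card_le_of_antichain (k := 1) ?_ ?_
  · intro p hp q hq h
    by_contra hne
    have := hanti p hp q hq hne h.le
    have := hanti q hq p hp (Ne.symm hne) h.ge
    omega
  · intro p hp q hq r hr hpq hqr
    by_contra! hgap
    have hpq2 := hanti p hp q hq (by rintro rfl; omega) hpq.le
    obtain ⟨u, w, hu, hw, hlt⟩ := hS q hq
    have h1 := hlt p hp (by rintro rfl; omega)
    have h2 := hlt r hr (by rintro rfl; omega)
    have e1 : α ^ 2 * α ^ q.1 ≤ α ^ r.1 := by
      rw [← pow_add]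
      exact pow_le_pow_right₀ hα.le (by omega)
    have e2 : α * α ^ q.2 ≤ α ^ p.2 := by
      rw [← pow_succ']
      exact pow_le_pow_right₀ hα.le (by omega)
    have p1 : 0 < α ^ p.1 := by positivity
    have p2 : 0 < α ^ q.1 := by positivity
    have p3 : 0 < α ^ q.2 := by positivity
    have p4 : 0 < α ^ r.2 := by positivity
    generalize α ^ p.1 = a at *
    generalize α ^ p.2 = b at *
    generalize α ^ q.1 = c at *
    generalize α ^ q.2 = d at *
    generalize α ^ r.1 = e at *
    generalize α ^ r.2 = f at *
    have k1 : w * ((α - 1) * d) ≤ u * c := by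
      have := mul_le_mul_of_nonneg_left (show (α - 1) * d ≤ b - d by linarith) hw
      have := mul_nonneg hu p1.le
      linarith
    have k2 : u * (α * c) < w * d := by
      have := mul_le_mul_of_nonneg_left (show α * c ≤ e - c by nlinarith) hu
      have := mul_nonneg hw p4.le
      linarith
    have k3 : w * d ≤ α * (w * ((α - 1) * d)) := by
      have : 0 ≤ w * d := by positivity
      nlinarith
    nlinarith

lemma HullFree.card_le_four_of_lower {α : ℝ} (hα : 1 < α) (hφ : α + 1 ≤ α ^ 2)
    {E : Set (ℕ × ℕ)} (hE : HullFree α E) {S : Finset (ℕ × ℕ)} (hSE : ∀ v ∈ S, v ∈ E)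
    (hS : ∀ v ∈ S, ∃ u w : ℝ, u ≤ 0 ∧ w ≤ 0 ∧ ∀ x ∈ S, x ≠ v →
      u * α ^ x.1 + w * α ^ x.2 < u * α ^ v.1 + w * α ^ v.2) : S.card ≤ 4 := by
  have hanti : ∀ p ∈ S, ∀ q ∈ S, p ≠ q → p.1 ≤ q.1 → q.2 < p.2 := by
    intro p hp q hq hne h
    by_contra! h'
    obtain ⟨u, w, hu, hw, hlt⟩ := hS q hq
    have h1 := mul_le_mul_of_nonpos_left (pow_le_pow_right₀ hα.le h) hu
    have h2 := mul_le_mul_of_nonpos_left (pow_le_pow_right₀ hα.le h') hw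
    linarith [hlt p hp hne]
  refine card_le_of_antichain (k := 2) ?_ ?_
  · intro p hp q hq h
    by_contra hne
    have := hanti p hp q hq hne h.le
    have := hanti q hq p hp (Ne.symm hne) h.ge
    omega
  · intro p hp q hq r hr hpq hqr
    by_contra! hgap
    have hpq2 := hanti p hp q hq (by rintro rfl; omega) hpq.le
    have hqr2 := hanti q hq r hr (by rintro rfl; omega) hqr.le
    have hR : 0 < α ^ r.1 := by positivity
    have hP : 0 < α ^ p.2 := by positivity
    have hb : SegBelow (latticePt α q) (latticePt α r) (latticePt α (q.1 + 1, q.2)) := by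
      refine segBelow_of_line 0 (α ^ q.2) ?_ ?_ ?_ ?_ ?_ <;> simp only [latticePt]
      · exact pow_le_pow_right₀ hα.le (by omega)
      · exact pow_le_pow_right₀ hα.le (by omega)
      · simp
      · simpa using pow_le_pow_right₀ hα.le hqr2.le
      · simp
    have ha : SegAbove (latticePt α p) (latticePt α r) (latticePt α (q.1 + 1, q.2)) := by
      refine segAbove_of_line (-(α ^ p.2 / α ^ r.1)) (α ^ p.2) ?_ ?_ ?_ ?_ ?_ <;>
        simp only [latticePt]
      · exact pow_le_pow_right₀ hα.le (by omega)
      · exact pow_le_pow_right₀ hα.le (by omega)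
      · have : 0 ≤ α ^ p.2 / α ^ r.1 * α ^ p.1 := by positivity
        linarith
      · have : 0 < α ^ r.2 := by positivity
        rw [neg_mul, div_mul_cancel₀ _ hR.ne']
        linarith
      · have e1 : α ^ 2 * α ^ (q.1 + 1) ≤ α ^ r.1 := by
          rw [← pow_add]
          exact pow_le_pow_right₀ hα.le (by omega)
        have e2 : α * α ^ q.2 ≤ α ^ p.2 := by
          rw [← pow_succ']
          exact pow_le_pow_right₀ hα.le (by omega)
        have e3 : α ^ 2 * (α ^ p.2 / α ^ r.1 * α ^ (q.1 + 1)) ≤ α ^ p.2 := by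
          have : α ^ 2 * (α ^ p.2 / α ^ r.1 * α ^ (q.1 + 1)) =
              α ^ p.2 * (α ^ 2 * α ^ (q.1 + 1)) / α ^ r.1 := by ring
          rw [this, div_le_iff₀ hR]
          exact mul_le_mul_of_nonneg_left e1 hP.le
        have e4 := mul_le_mul_of_nonneg_left e2 (zero_le_one.trans hα.le)
        have e5 := mul_le_mul_of_nonneg_right hφ hP.le
        have h2 : 0 < α ^ 2 := by positivity
        refine le_of_mul_le_mul_left ?_ h2
        linarith
    have := hE.eq_of_segBelow_of_segAbove (hSE q hq) (hSE r hr) (hSE p hp) (hSE r hr) hb ha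
    simp only [Prod.ext_iff] at this
    omega

lemma segBelow_latticePt {α : ℝ} (hα : 1 ≤ α) {p q z : ℕ × ℕ} (h₁ : p.1 ≤ z.1) (h₂ : z.1 ≤ q.1)
    (hp : p.2 ≤ z.2) (hq : q.2 ≤ z.2) :
    SegBelow (latticePt α p) (latticePt α q) (latticePt α z) := by
  refine segBelow_of_line 0 (α ^ z.2) (pow_le_pow_right₀ hα h₁) (pow_le_pow_right₀ hα h₂) ?_ ?_ ?_
  · simpa [latticePt] using pow_le_pow_right₀ hα hp
  · simpa [latticePt] using pow_le_pow_right₀ hα hq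
  · simp [latticePt]

lemma segAbove_latticePt {α : ℝ} (hα : 1 ≤ α) {p q z : ℕ × ℕ} (h₁ : p.1 ≤ z.1) (h₂ : z.1 ≤ q.1)
    (hp : z.2 ≤ p.2) (hq : z.2 ≤ q.2) :
    SegAbove (latticePt α p) (latticePt α q) (latticePt α z) := by
  refine segAbove_of_line 0 (α ^ z.2) (pow_le_pow_right₀ hα h₁) (pow_le_pow_right₀ hα h₂) ?_ ?_ ?_
  · simpa [latticePt] using pow_le_pow_right₀ hα hp
  · simpa [latticePt] using pow_le_pow_right₀ hα hq
  · simp [latticePt]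

lemma HullFree.eq_of_upper_left {α : ℝ} (hα : 1 < α) {E : Set (ℕ × ℕ)} (hE : HullFree α E)
    {r v q s : ℕ × ℕ} (hr : r ∈ E) (hq : q ∈ E) (hs : s ∈ E)
    (hvq : v ≤ q) (hrne : r ≠ v) (hqne : q ≠ v)
    (hb : SegBelow (latticePt α r) (latticePt α q) (latticePt α v))
    (h₁ : s.1 ≤ v.1) (h₂ : v.2 ≤ s.2) : s = v := by
  have := hE.eq_of_segBelow_of_segAbove hr hq hs hq hb (segAbove_latticePt hα.le h₁ hvq.1 h₂ hvq.2)
  grind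

lemma HullFree.exists_least {α : ℝ} (hα : 1 < α) {E : Set (ℕ × ℕ)} (hE : HullFree α E)
    (hfin : E.Finite) {r v q : ℕ × ℕ} (hr : r ∈ E) (hv : v ∈ E) (hq : q ∈ E)
    (hrv : r ≤ v) (hvq : v ≤ q) (hrne : r ≠ v) (hqne : q ≠ v)
    (hb : SegBelow (latticePt α r) (latticePt α q) (latticePt α v)) :
    ∃ m ∈ E, ∀ x ∈ E, m ≤ x := by
  have hul : ∀ s ∈ E, s.1 ≤ v.1 → v.2 ≤ s.2 → s = v := fun s hs =>
    hE.eq_of_upper_left hα hr hq hs hvq hrne hqne hb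
  have hr1 := hrv.1
  have hq1 := hvq.1
  have hq2 := hvq.2
  have hr2 : r.2 < v.2 := by
    by_contra! h
    exact hrne (hul r hr hr1 h)
  have hq1' : v.1 < q.1 := by
    by_contra! h
    have := hul q hq h hq2
    exact hqne this
  obtain ⟨a, ha, hamin⟩ := Set.exists_min_image E (fun x => toLex x) hfin ⟨v, hv⟩
  obtain ⟨b, hb', hbmin⟩ := Set.exists_min_image E (fun x => toLex x.swap) hfin ⟨v, hv⟩
  simp only [Prod.Lex.toLex_le_toLex, Prod.fst_swap, Prod.snd_swap] at hamin hbmin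
  by_cases hab : a.2 ≤ b.2
  · refine ⟨a, ha, fun x hx => ⟨?_, ?_⟩⟩
    · have := hamin x hx
      omega
    · have := hbmin x hx
      omega
  push Not at hab
  exfalso
  have hav := hamin v hv
  have har := hamin r hr
  have hab' := hamin b hb'
  have ha2 : a.2 < v.2 := by
    by_contra! h
    have := hul a ha (by omega) h
    subst this
    omega
  rcases lt_or_ge b.1 v.1 with hbv | hbv
  · have := hE.eq_of_segBelow_of_segAbove (z := (b.1, a.2)) hb' hb' ha hv
      (segBelow_latticePt hα.le le_rfl le_rfl hab.le hab.le)
      (segAbove_latticePt hα.le (by simp only; omega) hbv.le le_rfl ha2.le)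
    simp only [Prod.ext_iff] at this
    omega
  · have := hE.eq_of_segBelow_of_segAbove (z := (v.1, v.2 - 1)) ha hb' hv hv
      (segBelow_latticePt hα.le (by simp only; omega) hbv (by simp only; omega)
        (by simp only; omega))
      (segAbove_latticePt hα.le le_rfl le_rfl (by simp only; omega) (by simp only; omega))
    simp only [Prod.ext_iff] at this
    have := hE.eq_of_segBelow_of_segAbove (z := (v.1 + 1, v.2 - 1)) ha hb' hv hq
      (segBelow_latticePt hα.le (by simp only; omega) (by simp only; omega) (by simp only; omega)
        (by simp only; omega))
      (segAbove_latticePt hα.le (by simp only; omega) (by simp only; omega) (by simp only; omega)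
        (by simp only; omega))
    simp only [Prod.ext_iff] at this
    omega

lemma HullFree.exists_greatest {α : ℝ} (hα : 1 < α) {E : Set (ℕ × ℕ)} (hE : HullFree α E)
    (hfin : E.Finite) {r v q : ℕ × ℕ} (hr : r ∈ E) (hv : v ∈ E) (hq : q ∈ E)
    (hrv : r ≤ v) (hvq : v ≤ q) (hrne : r ≠ v) (hqne : q ≠ v)
    (hb : SegBelow (latticePt α r) (latticePt α q) (latticePt α v)) :
    ∃ m ∈ E, ∀ x ∈ E, x ≤ m := by
  have hul : ∀ s ∈ E, s.1 ≤ v.1 → v.2 ≤ s.2 → s = v := fun s hs =>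
    hE.eq_of_upper_left hα hr hq hs hvq hrne hqne hb
  have hr1 := hrv.1
  have hq1 := hvq.1
  have hq2 := hvq.2
  have hr2 : r.2 < v.2 := by
    by_contra! h
    exact hrne (hul r hr hr1 h)
  have hq1' : v.1 < q.1 := by
    by_contra! h
    have := hul q hq h hq2
    exact hqne this
  obtain ⟨a, ha, hamax⟩ := Set.exists_max_image E (fun x => toLex x) hfin ⟨v, hv⟩
  obtain ⟨b, hb', hbmax⟩ := Set.exists_max_image E (fun x => toLex x.swap) hfin ⟨v, hv⟩
  simp only [Prod.Lex.toLex_le_toLex, Prod.fst_swap, Prod.snd_swap] at hamax hbmax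
  by_cases hab : b.2 ≤ a.2
  · refine ⟨a, ha, fun x hx => ⟨?_, ?_⟩⟩
    · have := hamax x hx
      omega
    · have := hbmax x hx
      omega
  push Not at hab
  exfalso
  have hbv := hbmax v hv
  have hbq := hbmax q hq
  have hab' := hamax b hb'
  have hb1 : v.1 < b.1 := by
    by_contra! h
    have := hul b hb' h (by omega)
    subst this
    omega
  rcases lt_or_ge v.2 b.2 with hvb | hvb
  · have := hE.eq_of_segBelow_of_segAbove (z := (b.1, max a.2 v.2)) hv ha hb' hb'
      (segBelow_latticePt hα.le hb1.le (by simp only; omega) (le_max_right _ _) (le_max_left _ _))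
      (segAbove_latticePt hα.le le_rfl le_rfl (by simp only; omega) (by simp only; omega))
    simp only [Prod.ext_iff] at this
    omega
  · have := hE.eq_of_segBelow_of_segAbove (z := (b.1, v.2 - 1)) hr ha hb' hb'
      (segBelow_latticePt hα.le (by simp only; omega) (by simp only; omega) (by simp only; omega)
        (by simp only; omega))
      (segAbove_latticePt hα.le le_rfl le_rfl (by simp only; omega) (by simp only; omega))
    simp only [Prod.ext_iff] at this
    omega

lemma pow_le_ratio_mul_pow {α : ℝ} (hα : 1 < α) {a b c d : ℕ} (h : b + c ≤ d + a) :
    α ^ b ≤ α ^ d / α ^ c * α ^ a := by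
  have hc : 0 < α ^ c := by positivity
  rw [div_mul_eq_mul_div, le_div_iff₀ hc, ← pow_add, ← pow_add]
  exact pow_le_pow_right₀ hα.le h

lemma ratio_mul_pow_le_pow {α : ℝ} (hα : 1 < α) {a b c d : ℕ} (h : d + a ≤ b + c) :
    α ^ d / α ^ c * α ^ a ≤ α ^ b := by
  have hc : 0 < α ^ c := by positivity
  rw [div_mul_eq_mul_div, div_le_iff₀ hc, ← pow_add, ← pow_add]
  exact pow_le_pow_right₀ hα.le h

/-- A segment whose endpoints lie weakly below the diagonal through `z` passes weakly below `z`. -/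
lemma segBelow_of_diagonal {α : ℝ} (hα : 1 < α) {p q z : ℕ × ℕ} (h₁ : p.1 ≤ z.1) (h₂ : z.1 ≤ q.1)
    (hp : p.2 + z.1 ≤ z.2 + p.1) (hq : q.2 + z.1 ≤ z.2 + q.1) :
    SegBelow (latticePt α p) (latticePt α q) (latticePt α z) := by
  refine segBelow_of_line (α ^ z.2 / α ^ z.1) 0 (pow_le_pow_right₀ hα.le h₁)
    (pow_le_pow_right₀ hα.le h₂) ?_ ?_ ?_ <;> rw [add_zero]
  · exact pow_le_ratio_mul_pow hα hp
  · exact pow_le_ratio_mul_pow hα hq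
  · exact ratio_mul_pow_le_pow hα le_rfl

/-- A segment whose endpoints lie weakly above the diagonal through `z` passes weakly above `z`. -/
lemma segAbove_of_diagonal {α : ℝ} (hα : 1 < α) {p q z : ℕ × ℕ} (h₁ : p.1 ≤ z.1) (h₂ : z.1 ≤ q.1)
    (hp : z.2 + p.1 ≤ p.2 + z.1) (hq : z.2 + q.1 ≤ q.2 + z.1) :
    SegAbove (latticePt α p) (latticePt α q) (latticePt α z) := by
  refine segAbove_of_line (α ^ z.2 / α ^ z.1) 0 (pow_le_pow_right₀ hα.le h₁)
    (pow_le_pow_right₀ hα.le h₂) ?_ ?_ ?_ <;> rw [add_zero]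
  · exact ratio_mul_pow_le_pow hα hp
  · exact ratio_mul_pow_le_pow hα hq
  · exact pow_le_ratio_mul_pow hα le_rfl

lemma HullFree.near_corner {α : ℝ} (hα : 1 < α) (hφ : α + 1 ≤ α ^ 2) {E : Set (ℕ × ℕ)}
    (hE : HullFree α E) {m v M : ℕ × ℕ} (hm : m ∈ E) (hv : v ∈ E) (hM : M ∈ E)
    (hmv : m ≤ v) (hvM : v ≤ M) (hmne : m ≠ v) (hMne : M ≠ v)
    (hb : SegBelow (latticePt α m) (latticePt α M) (latticePt α v)) :
    M = (v.1 + 1, v.2 + 1) ∨ v.1 ≤ m.1 + 1 ∨ v.2 ≤ m.2 + 2 := by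
  have hul : ∀ s ∈ E, s.1 ≤ v.1 → v.2 ≤ s.2 → s = v := fun s hs =>
    hE.eq_of_upper_left hα hm hM hs hvM hmne hMne hb
  have hM1 : v.1 < M.1 := by
    by_contra! h
    exact hMne (hul M hM h hvM.2)
  by_contra! hcon
  obtain ⟨hA, hi, hj⟩ := hcon
  rcases lt_trichotomy (M.2 + v.1) (v.2 + M.1) with h | h | h
  · rcases le_or_gt (m.1 + v.2) (v.1 + m.2) with h' | h'
    · have hz := hE.eq_of_segBelow_of_segAbove (z := (v.1 - 1, v.2 - 1)) hm hM hm hv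
        ?_ (segAbove_of_diagonal hα (by simp only; omega) (by simp only; omega)
          (by simp only; omega) (by simp only; omega))
      · simp only [Prod.ext_iff] at hz
        omega
      · have e1 : α ^ (v.2 - 1) / α ^ v.1 * α ^ (v.1 - 1) ≤ α ^ (v.2 - 2) :=
          ratio_mul_pow_le_pow hα (by omega)
        have e2 : α ^ M.2 ≤ α ^ (v.2 - 1) / α ^ v.1 * α ^ M.1 :=
          pow_le_ratio_mul_pow hα (by omega)
        have e3 : α ^ m.2 ≤ α ^ (v.2 - 3) := pow_le_pow_right₀ hα.le (by omega)
        have e4 : α ^ (v.2 - 2) + α ^ (v.2 - 3) ≤ α ^ (v.2 - 1) := by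
          obtain ⟨n, hn⟩ := Nat.exists_eq_add_of_le' (show 3 ≤ v.2 by omega)
          rw [show v.2 - 1 = n + 2 by omega, show v.2 - 2 = n + 1 by omega,
            show v.2 - 3 = n by omega, pow_succ α n, pow_add α n 2]
          have : 0 < α ^ n := by positivity
          nlinarith
        have e5 : 0 < α ^ (v.2 - 3) := by positivity
        have e6 : 0 ≤ α ^ (v.2 - 1) / α ^ v.1 * α ^ m.1 := by positivity
        refine segBelow_of_line (α ^ (v.2 - 1) / α ^ v.1) (α ^ (v.2 - 3)) ?_ ?_ ?_ ?_ ?_ <;>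
          simp only [latticePt]
        · exact pow_le_pow_right₀ hα.le (by omega)
        · exact pow_le_pow_right₀ hα.le (by omega)
        · linarith
        · linarith
        · linarith
    · have hz := hE.eq_of_segBelow_of_segAbove (z := (v.1, v.2 - 1)) hm hM hv hv
        (segBelow_of_diagonal hα hmv.1 hM1.le (by simp only; omega) (by simp only; omega))
        (segAbove_latticePt hα.le le_rfl le_rfl (by simp only; omega) (by simp only; omega))
      simp only [Prod.ext_iff] at hz
      omega
  · have hz := hE.eq_of_segBelow_of_segAbove (z := (v.1 + 1, v.2 + 1)) hv hM hv hM
      (segBelow_of_diagonal hα (by simp only; omega) (by simp only; omega)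
        (by simp only; omega) (by simp only; omega))
      (segAbove_of_diagonal hα (by simp only; omega) (by simp only; omega)
        (by simp only; omega) (by simp only; omega))
    have : M.1 = v.1 + 1 ∧ M.2 = v.2 + 1 := by
      simp only [Prod.ext_iff] at hz
      omega
    exact hA (Prod.ext this.1 this.2)
  · refine not_segBelow_of_line (α ^ (v.2 + 1) / α ^ v.1) (-α ^ (v.2 - 1)) ?_ ?_ ?_ hb <;>
      simp only [latticePt]
    · have e1 : α ^ (v.2 + 1) / α ^ v.1 * α ^ m.1 ≤ α ^ (v.2 - 1) :=
        ratio_mul_pow_le_pow hα (by omega)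
      have : 0 < α ^ m.2 := by positivity
      linarith
    · have e1 : α ^ (v.2 + 1) / α ^ v.1 * α ^ M.1 ≤ α ^ M.2 :=
        ratio_mul_pow_le_pow hα (by omega)
      have : 0 < α ^ (v.2 - 1) := by positivity
      linarith
    · have e1 : α ^ (v.2 + 1) ≤ α ^ (v.2 + 1) / α ^ v.1 * α ^ v.1 :=
        pow_le_ratio_mul_pow hα le_rfl
      obtain ⟨n, hn⟩ := Nat.exists_eq_add_of_le' (show 1 ≤ v.2 by omega)
      have e2 : α ^ v.2 + α ^ (v.2 - 1) ≤ α ^ (v.2 + 1) := by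
        rw [hn, show n + 1 - 1 = n by omega, show n + 1 + 1 = n + 2 by omega, pow_succ α n,
          pow_add α n 2]
        have : 0 < α ^ n := by positivity
        nlinarith
      linarith

lemma HullFree.card_above_le_two {α : ℝ} (hα : 1 < α) (hφ : α + 1 ≤ α ^ 2) {E : Set (ℕ × ℕ)}
    (hE : HullFree α E) {m M : ℕ × ℕ} (hm : m ∈ E) (hM : M ∈ E) (hmin : ∀ x ∈ E, m ≤ x)
    (hmax : ∀ x ∈ E, x ≤ M) {U : Finset (ℕ × ℕ)}
    (hU : ∀ x ∈ U, x ∈ E ∧ x ≠ m ∧ x ≠ M ∧ M ≠ (x.1 + 1, x.2 + 1) ∧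
      SegBelow (latticePt α m) (latticePt α M) (latticePt α x)) : U.card ≤ 2 := by
  have hchain : ∀ x ∈ U, ∀ y ∈ U, x ≠ y → y.1 ≤ x.1 → y.2 < x.2 := by
    intro x hx y hy hne h
    by_contra! h'
    obtain ⟨hxE, hxm, hxM, -, hxb⟩ := hU x hx
    exact hne (hE.eq_of_upper_left hα hm hM (hU y hy).1 (hmax x hxE) hxm.symm hxM.symm
      hxb h h').symm
  have hlow : ∀ x ∈ U, m.1 ≤ x.1 ∧ m.2 < x.2 ∧ (x.1 ≤ m.1 + 1 ∨ x.2 ≤ m.2 + 2) := by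
    intro x hx
    obtain ⟨hxE, hxm, hxM, hxM', hxb⟩ := hU x hx
    have hmx := hmin x hxE
    refine ⟨hmx.1, ?_, (hE.near_corner hα hφ hm hxE hM hmx (hmax x hxE) hxm.symm hxM.symm
      hxb).resolve_left hxM'⟩
    by_contra! h
    exact hxm (hE.eq_of_upper_left hα hm hM hm (hmax x hxE) hxm.symm hxM.symm hxb hmx.1 h).symm
  by_contra! hcard
  obtain ⟨a, ha, b, hb, c, hc, hab, hac, hbc⟩ := Finset.two_lt_card.1 hcard
  have h1 := hlow a ha
  have h2 := hlow b hb
  have h3 := hlow c hc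
  have h4 := hchain a ha b hb hab
  have h5 := hchain b hb a ha hab.symm
  have h6 := hchain a ha c hc hac
  have h7 := hchain c hc a ha hac.symm
  have h8 := hchain b hb c hc hbc
  have h9 := hchain c hc b hb hbc.symm
  omega

lemma swap_mem_swap_image {E : Set (ℕ × ℕ)} {x : ℕ × ℕ} (hx : x ∈ E) : x.swap ∈ Prod.swap '' E :=
  Set.mem_image_of_mem _ hx

lemma HullFree.card_le_seven_of_bounded {α : ℝ} (hα : 1 < α) (hφ : α + 1 ≤ α ^ 2)
    {E : Finset (ℕ × ℕ)} (hE : HullFree α (E : Set (ℕ × ℕ))) {m M : ℕ × ℕ} (hm : m ∈ E)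
    (hM : M ∈ E) (hmin : ∀ x ∈ E, m ≤ x) (hmax : ∀ x ∈ E, x ≤ M) : E.card ≤ 7 := by
  classical
  set F : Finset (ℕ × ℕ) := {m, M, (M.1 - 1, M.2 - 1)} with hF
  set U := (E \ F).filter fun x => SegBelow (latticePt α m) (latticePt α M) (latticePt α x) with hUdef
  set D := (E \ F).filter fun x => ¬ SegBelow (latticePt α m) (latticePt α M) (latticePt α x)
    with hDdef
  have hmem : ∀ x ∈ E \ F, x ∈ E ∧ x ≠ m ∧ x ≠ M ∧ M ≠ (x.1 + 1, x.2 + 1) := by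
    intro x hx
    simp only [hF, Finset.mem_sdiff, Finset.mem_insert, Finset.mem_singleton, not_or] at hx
    refine ⟨hx.1, hx.2.1, hx.2.2.1, ?_⟩
    rintro rfl
    exact hx.2.2.2 (by simp)
  have hU : U.card ≤ 2 := by
    refine hE.card_above_le_two hα hφ hm hM hmin hmax fun x hx => ?_
    rw [hUdef, Finset.mem_filter] at hx
    obtain ⟨h1, h2, h3, h4⟩ := hmem x hx.1
    exact ⟨h1, h2, h3, h4, hx.2⟩
  have hD : D.card ≤ 2 := by
    rw [← Finset.card_image_of_injective D Prod.swap_injective]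
    refine hE.swap.card_above_le_two hα hφ (swap_mem_swap_image hm) (swap_mem_swap_image hM)
      ?_ ?_ fun x hx => ?_
    · rintro _ ⟨x, hx, rfl⟩
      exact Prod.swap_le_swap.2 (hmin x hx)
    · rintro _ ⟨x, hx, rfl⟩
      exact Prod.swap_le_swap.2 (hmax x hx)
    · obtain ⟨y, hy, rfl⟩ := Finset.mem_image.1 hx
      rw [hDdef, Finset.mem_filter] at hy
      obtain ⟨h1, h2, h3, h4⟩ := hmem y hy.1
      have hy1 := hmin y h1
      have hy2 := hmax y h1
      refine ⟨swap_mem_swap_image h1, Prod.swap_injective.ne h2, Prod.swap_injective.ne h3,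
        Prod.swap_injective.ne h4, ?_⟩
      exact (segBelow_or_segBelow_swap (pow_le_pow_right₀ hα.le hy1.1)
        (pow_le_pow_right₀ hα.le hy2.1) (pow_le_pow_right₀ hα.le hy1.2)
        (pow_le_pow_right₀ hα.le hy2.2)).resolve_left hy.2
  have h1 : U.card + D.card = (E \ F).card := Finset.card_filter_add_card_filter_not _
  have h2 : F.card ≤ 3 := Finset.card_le_three
  have h3 := Finset.card_le_card_sdiff_add_card (s := E) (t := F)
  omega

/-- A point of `E` that is minimal or maximal and is exposed by some linear functional is exposed by
a functional whose two coefficients have the same sign. -/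
lemma exists_functional_nonneg_or_nonpos {α : ℝ} (hα : 1 < α) {E : Set (ℕ × ℕ)} {v : ℕ × ℕ}
    {u w : ℝ} (h : ∀ x ∈ E, x ≠ v → u * α ^ x.1 + w * α ^ x.2 < u * α ^ v.1 + w * α ^ v.2)
    (hv : (∀ x ∈ E, x ≠ v → ¬ x ≤ v) ∨ (∀ x ∈ E, x ≠ v → ¬ v ≤ x)) :
    (∃ u w : ℝ, 0 ≤ u ∧ 0 ≤ w ∧ ∀ x ∈ E, x ≠ v →
      u * α ^ x.1 + w * α ^ x.2 < u * α ^ v.1 + w * α ^ v.2) ∨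
    (∃ u w : ℝ, u ≤ 0 ∧ w ≤ 0 ∧ ∀ x ∈ E, x ≠ v →
      u * α ^ x.1 + w * α ^ x.2 < u * α ^ v.1 + w * α ^ v.2) := by
  have hpow {a b : ℕ} (hab : a ≤ b) : α ^ a ≤ α ^ b := pow_le_pow_right₀ hα.le hab
  rcases le_total 0 u with hu | hu <;> rcases le_total 0 w with hw | hw
  · exact Or.inl ⟨u, w, hu, hw, h⟩
  · have hmix : ∀ x ∈ E, x ≠ v → ¬ (v.1 ≤ x.1 ∧ x.2 ≤ v.2) := fun x hx hne hc => by
      have h1 := mul_le_mul_of_nonneg_left (hpow hc.1) hu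
      have h2 := mul_le_mul_of_nonpos_left (hpow hc.2) hw
      linarith [h x hx hne]
    rcases hv with hv | hv
    · refine Or.inr ⟨0, -1, le_rfl, by norm_num, fun x hx hne => ?_⟩
      have h1 : ¬ (x.1 ≤ v.1 ∧ x.2 ≤ v.2) := hv x hx hne
      have h2 := hmix x hx hne
      linarith [pow_lt_pow_right₀ hα (show v.2 < x.2 by omega)]
    · refine Or.inl ⟨1, 0, by norm_num, le_rfl, fun x hx hne => ?_⟩
      have h1 : ¬ (v.1 ≤ x.1 ∧ v.2 ≤ x.2) := hv x hx hne
      have h2 := hmix x hx hne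
      linarith [pow_lt_pow_right₀ hα (show x.1 < v.1 by omega)]
  · have hmix : ∀ x ∈ E, x ≠ v → ¬ (x.1 ≤ v.1 ∧ v.2 ≤ x.2) := fun x hx hne hc => by
      have h1 := mul_le_mul_of_nonpos_left (hpow hc.1) hu
      have h2 := mul_le_mul_of_nonneg_left (hpow hc.2) hw
      linarith [h x hx hne]
    rcases hv with hv | hv
    · refine Or.inr ⟨-1, 0, by norm_num, le_rfl, fun x hx hne => ?_⟩
      have h1 : ¬ (x.1 ≤ v.1 ∧ x.2 ≤ v.2) := hv x hx hne
      have h2 := hmix x hx hne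
      linarith [pow_lt_pow_right₀ hα (show v.1 < x.1 by omega)]
    · refine Or.inl ⟨0, 1, le_rfl, by norm_num, fun x hx hne => ?_⟩
      have h1 : ¬ (v.1 ≤ x.1 ∧ v.2 ≤ x.2) := hv x hx hne
      have h2 := hmix x hx hne
      linarith [pow_lt_pow_right₀ hα (show x.2 < v.2 by omega)]
  · exact Or.inr ⟨u, w, hu, hw, h⟩

lemma HullFree.card_le_seven {α : ℝ} (hα : 1 < α) (hφ : α + 1 ≤ α ^ 2)
    {E : Finset (ℕ × ℕ)} (hE : HullFree α (E : Set (ℕ × ℕ))) : E.card ≤ 7 := by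
  classical
  by_cases hmid : ∃ r ∈ E, ∃ v ∈ E, ∃ q ∈ E, r ≤ v ∧ v ≤ q ∧ r ≠ v ∧ q ≠ v
  · obtain ⟨r, hr, v, hv, q, hq, hrv, hvq, hrne, hqne⟩ := hmid
    rcases segBelow_or_segBelow_swap (p := latticePt α r) (q := latticePt α q)
      (z := latticePt α v) (pow_le_pow_right₀ hα.le hrv.1) (pow_le_pow_right₀ hα.le hvq.1)
      (pow_le_pow_right₀ hα.le hrv.2) (pow_le_pow_right₀ hα.le hvq.2) with hb | hb
    · obtain ⟨m, hm, hmin⟩ := hE.exists_least hα E.finite_toSet hr hv hq hrv hvq hrne hqne hb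
      obtain ⟨M, hM, hmax⟩ := hE.exists_greatest hα E.finite_toSet hr hv hq hrv hvq hrne hqne hb
      exact hE.card_le_seven_of_bounded hα hφ hm hM hmin hmax
    · obtain ⟨_, ⟨m, hm, rfl⟩, hmin⟩ := hE.swap.exists_least hα (E.finite_toSet.image _)
        (swap_mem_swap_image hr) (swap_mem_swap_image hv) (swap_mem_swap_image hq)
        (Prod.swap_le_swap.2 hrv) (Prod.swap_le_swap.2 hvq) (Prod.swap_injective.ne hrne)
        (Prod.swap_injective.ne hqne) hb
      obtain ⟨_, ⟨M, hM, rfl⟩, hmax⟩ := hE.swap.exists_greatest hα (E.finite_toSet.image _)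
        (swap_mem_swap_image hr) (swap_mem_swap_image hv) (swap_mem_swap_image hq)
        (Prod.swap_le_swap.2 hrv) (Prod.swap_le_swap.2 hvq) (Prod.swap_injective.ne hrne)
        (Prod.swap_injective.ne hqne) hb
      exact hE.card_le_seven_of_bounded hα hφ hm hM
        (fun x hx => Prod.swap_le_swap.1 (hmin _ (swap_mem_swap_image hx)))
        (fun x hx => Prod.swap_le_swap.1 (hmax _ (swap_mem_swap_image hx)))
  · set R := E.filter fun v => ∃ u w : ℝ, 0 ≤ u ∧ 0 ≤ w ∧ ∀ x ∈ E, x ≠ v →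
      u * α ^ x.1 + w * α ^ x.2 < u * α ^ v.1 + w * α ^ v.2 with hR
    set L := E.filter fun v => ∃ u w : ℝ, u ≤ 0 ∧ w ≤ 0 ∧ ∀ x ∈ E, x ≠ v →
      u * α ^ x.1 + w * α ^ x.2 < u * α ^ v.1 + w * α ^ v.2 with hL
    have hRcard : R.card ≤ 3 := by
      refine card_le_three_of_upper hα hφ fun v hv => ?_
      obtain ⟨-, u, w, hu, hw, h⟩ := Finset.mem_filter.1 hv
      exact ⟨u, w, hu, hw, fun x hx => h x (Finset.mem_of_mem_filter x hx)⟩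
    have hLcard : L.card ≤ 4 := by
      refine hE.card_le_four_of_lower hα hφ (fun v hv => Finset.mem_of_mem_filter v hv)
        fun v hv => ?_
      obtain ⟨-, u, w, hu, hw, h⟩ := Finset.mem_filter.1 hv
      exact ⟨u, w, hu, hw, fun x hx => h x (Finset.mem_of_mem_filter x hx)⟩
    have hcover : E ⊆ R ∪ L := by
      intro v hv
      rw [Finset.mem_union, hR, hL, Finset.mem_filter, Finset.mem_filter]
      have hv' : (∀ x ∈ E, x ≠ v → ¬ x ≤ v) ∨ (∀ x ∈ E, x ≠ v → ¬ v ≤ x) := by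
        by_contra! h
        obtain ⟨⟨r, hr, hrne, hrv⟩, q, hq, hqne, hvq⟩ := h
        exact hmid ⟨r, hr, v, hv, q, hq, hrv, hvq, hrne, hqne⟩
      obtain ⟨u, w, h⟩ := hE.exists_functional E.finite_toSet (v := v)
      exact (exists_functional_nonneg_or_nonpos hα h hv').imp (⟨hv, ·⟩) (⟨hv, ·⟩)
    have := Finset.card_le_card hcover
    have := Finset.card_union_le R L
    omega

theorem h_le_seven (α : ℝ) (hα₁ : (1 + Real.sqrt 5) / 2 ≤ α) (hα₂ : α < 2)
    (X : Set (ℝ × ℝ)) (hfin : X.Finite)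
    (hX : IsEmptyPolygonIn (expLattice α) X) :
    X.ncard ≤ 7 := by
  have h5 : Real.sqrt 5 ^ 2 = 5 := Real.sq_sqrt (by norm_num)
  have h5' : 2 < Real.sqrt 5 := Real.lt_sqrt_of_sq_lt (by norm_num)
  have hα : 1 < α := by linarith
  have hφ : α + 1 ≤ α ^ 2 := by nlinarith
  have hinj := latticePt_injective hα
  have hEfin : (latticePt α ⁻¹' X).Finite := hfin.preimage hinj.injOn
  have himg : latticePt α '' (latticePt α ⁻¹' X) = X := by
    refine Set.image_preimage_eq_of_subset fun x hx => ?_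
    obtain ⟨a, b, rfl⟩ := hX.1 hx
    exact ⟨(a, b), rfl⟩
  rw [← himg, Set.ncard_image_of_injective _ hinj, Set.ncard_eq_toFinset_card _ hEfin]
  refine HullFree.card_le_seven hα hφ ?_
  rw [hEfin.coe_toFinset]
  exact hullFree_of_isEmptyPolygonIn hα hX
end

section
/- For every real number α with 1 < α < (1+√5)/2, every finite subset X of the exponential lattice L(α) that is in strictly convex position and satisfies conv(X) ∩ L(α) = X has at most 3·⌈log_α(α/(α−1))⌉ + 3 elements; that is, h(α) ≤ 3⌈log_α(α/(α−1))⌉ + 3. -/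
/-- Integer exponents `(x p, y p)` of points `(α ^ x p, α ^ y p)` such that each point is a vertex,
exposed by a line in general position with respect to the axes and the origin, and no triangle
spanned by the points contains a further point with integer exponents. -/
structure EmptyExponents {ι : Type*} (α : ℝ) (x y : ι → ℤ) : Prop where
  exposed : ∀ p, ∃ a b c : ℝ, a ≠ 0 ∧ b ≠ 0 ∧ c ≠ 0 ∧ a * α ^ x p + b * α ^ y p + c = 0 ∧
    ∀ q, q ≠ p → 0 < a * α ^ x q + b * α ^ y q + c
  empty : ∀ (p q r : ι) (l m n : ℝ), 0 ≤ l → 0 ≤ m → 0 ≤ n → l + m + n = 1 → ∀ i j : ℤ,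
    α ^ i = l * α ^ x p + m * α ^ x q + n * α ^ x r →
    α ^ j = l * α ^ y p + m * α ^ y q + n * α ^ y r →
    (i = x p ∧ j = y p) ∨ (i = x q ∧ j = y q) ∨ (i = x r ∧ j = y r)

/-- Vertices exposed in a direction pointing up and to the right. -/
def northEast {ι : Type*} (α : ℝ) (x y : ι → ℤ) : Set ι :=
  {p | ∃ a b : ℝ, 0 < a ∧ 0 < b ∧
    ∀ q, q ≠ p → a * α ^ x q + b * α ^ y q < a * α ^ x p + b * α ^ y p}

/-- Vertices exposed in a direction pointing down and to the left. -/
def southWest {ι : Type*} (α : ℝ) (x y : ι → ℤ) : Set ι :=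
  {p | ∃ a b : ℝ, 0 < a ∧ 0 < b ∧
    ∀ q, q ≠ p → a * α ^ x p + b * α ^ y p < a * α ^ x q + b * α ^ y q}

/-- Vertices exposed in a direction pointing up and to the left. -/
def northWest {ι : Type*} (α : ℝ) (x y : ι → ℤ) : Set ι :=
  {p | ∃ a b : ℝ, 0 < a ∧ 0 < b ∧
    ∀ q, q ≠ p → a * α ^ x p - b * α ^ y p < a * α ^ x q - b * α ^ y q}

section Exponents

variable {ι : Type*} {α : ℝ} {x y : ι → ℤ}

lemma northEast_lt (hα : 1 < α) {p q : ι} (hp : p ∈ northEast α x y) (hqp : q ≠ p)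
    (hx : x p ≤ x q) : y q < y p := by
  obtain ⟨a, b, ha, hb, h⟩ := hp
  by_contra! hy
  have h1 := mul_le_mul_of_nonneg_left (zpow_le_zpow_right₀ hα.le hx) ha.le
  have h2 := mul_le_mul_of_nonneg_left (zpow_le_zpow_right₀ hα.le hy) hb.le
  linarith [h q hqp]

lemma southWest_lt (hα : 1 < α) {p q : ι} (hp : p ∈ southWest α x y) (hqp : q ≠ p)
    (hx : x q ≤ x p) : y p < y q := by
  obtain ⟨a, b, ha, hb, h⟩ := hp
  by_contra! hy
  have h1 := mul_le_mul_of_nonneg_left (zpow_le_zpow_right₀ hα.le hx) ha.le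
  have h2 := mul_le_mul_of_nonneg_left (zpow_le_zpow_right₀ hα.le hy) hb.le
  linarith [h q hqp]

lemma northWest_lt (hα : 1 < α) {p q : ι} (hp : p ∈ northWest α x y) (hqp : q ≠ p)
    (hx : x q ≤ x p) : y q < y p := by
  obtain ⟨a, b, ha, hb, h⟩ := hp
  by_contra! hy
  have h1 := mul_le_mul_of_nonneg_left (zpow_le_zpow_right₀ hα.le hx) ha.le
  have h2 := mul_le_mul_of_nonneg_left (zpow_le_zpow_right₀ hα.le hy) hb.le
  linarith [h q hqp]

lemma northEast_swap : northEast α y x = northEast α x y := by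
  ext p
  constructor <;> rintro ⟨a, b, ha, hb, h⟩ <;>
    exact ⟨b, a, hb, ha, fun q hq => by linarith [h q hq]⟩

lemma southWest_swap : southWest α y x = southWest α x y := by
  ext p
  constructor <;> rintro ⟨a, b, ha, hb, h⟩ <;>
    exact ⟨b, a, hb, ha, fun q hq => by linarith [h q hq]⟩

namespace EmptyExponents

lemma swap (h : EmptyExponents α x y) : EmptyExponents α y x where
  exposed p := by
    obtain ⟨a, b, c, ha, hb, hc, h0, h1⟩ := h.exposed p
    exact ⟨b, a, c, hb, ha, hc, by linarith, fun q hq => by linarith [h1 q hq]⟩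
  empty p q r l m n hl hm hn hs i j hi hj := by
    have := h.empty p q r l m n hl hm hn hs j i hj hi
    tauto

/-- The projective map `(u, v) ↦ (u / v, 1 / v)` preserves the structure. -/
lemma projective (hα : 1 < α) (h : EmptyExponents α x y) :
    EmptyExponents α (fun p => x p - y p) (fun p => -y p) where
  exposed p := by
    have h0 : α ≠ 0 := by positivity
    obtain ⟨a, b, c, ha, hb, hc, he, hlt⟩ := h.exposed p
    have key : ∀ q, a * α ^ (x q - y q) + c * α ^ (-y q) + b =
        (a * α ^ x q + b * α ^ y q + c) * α ^ (-y q) := by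
      intro q
      rw [zpow_sub₀ h0, zpow_neg]
      have : α ^ y q ≠ 0 := zpow_ne_zero _ h0
      field_simp
      ring
    refine ⟨a, c, b, ha, hc, hb, by rw [key, he, zero_mul], fun q hq => ?_⟩
    rw [key]
    have := hlt q hq
    positivity
  empty p q r l m n hl hm hn hs i j hi hj := by
    have h0 : α ≠ 0 := by positivity
    have hpos : 0 < α := by positivity
    have hp := zpow_ne_zero (y p) h0
    have hq := zpow_ne_zero (y q) h0
    have hr := zpow_ne_zero (y r) h0
    have hj0 := zpow_ne_zero j h0
    simp only [zpow_sub₀ h0, zpow_neg] at hi hj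
    have := h.empty p q r (l * (α ^ y p)⁻¹ * (α ^ j)⁻¹) (m * (α ^ y q)⁻¹ * (α ^ j)⁻¹)
      (n * (α ^ y r)⁻¹ * (α ^ j)⁻¹) (by positivity) (by positivity) (by positivity)
      (by rw [← add_mul, ← add_mul, ← hj]; exact mul_inv_cancel₀ hj0) (i - j) (-j)
      (by
        rw [zpow_sub₀ h0, hi]
        simp only [div_eq_mul_inv]
        ring)
      (by
        rw [zpow_neg]
        calc (α ^ j)⁻¹ = (l + m + n) * (α ^ j)⁻¹ := by rw [hs, one_mul]
          _ = _ := by field_simp)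
    omega

/-- A point on a horizontal chord strictly right of a vertex would be a new lattice point. -/
lemma not_right (hα : 1 < α) (h : EmptyExponents α x y) {p q r : ι} (hpq : y q < y p)
    (hqr : y r < y q)
    (hle : α ^ (x q + 1) * (α ^ y p - α ^ y r) ≤
      α ^ x p * (α ^ y q - α ^ y r) + α ^ x r * (α ^ y p - α ^ y q)) : False := by
  have h1 := zpow_lt_zpow_right₀ hα hpq
  have h2 := zpow_lt_zpow_right₀ hα hqr
  have h3 : α ^ x q < α ^ (x q + 1) := zpow_lt_zpow_right₀ hα (by omega)
  set U := α ^ x p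
  set V := α ^ y p
  set U' := α ^ x r
  set V' := α ^ y r
  set u := α ^ x q
  set v := α ^ y q
  set w := α ^ (x q + 1)
  have hD : 0 < V - V' := by linarith
  have hE : 0 < U * (v - V') + U' * (V - v) - u * (V - V') := by nlinarith
  set E := U * (v - V') + U' * (V - v) - u * (V - V') with hEdef
  have hne : E ≠ 0 := hE.ne'
  have ht : (w - u) * (V - V') / E ≤ 1 := by rw [div_le_one hE]; nlinarith
  have := h.empty p q r ((w - u) * (v - V') / E) (1 - (w - u) * (V - V') / E)
    ((w - u) * (V - v) / E)
    (by apply div_nonneg (mul_nonneg _ _) hE.le <;> linarith) (by linarith)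
    (by apply div_nonneg (mul_nonneg _ _) hE.le <;> linarith)
    (by field_simp; ring) (x q + 1) (y q)
    (by
      change w = _ * U + _ * u + _ * U'
      field_simp
      rw [hEdef]
      ring)
    (by
      change v = _ * V + _ * v + _ * V'
      field_simp
      ring)
  omega

lemma not_left_vertex (hα : 1 < α) (h : EmptyExponents α x y) {a b t : ι} (hxa : x t < x a)
    (hxb : x t < x b) (hya : y a < y t) (hyb : y t < y b) : False := by
  apply h.not_right hα hyb hya
  have h1 : α ^ (x t + 1) ≤ α ^ x a := zpow_le_zpow_right₀ hα.le (by omega)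
  have h2 : α ^ (x t + 1) ≤ α ^ x b := zpow_le_zpow_right₀ hα.le (by omega)
  have h3 := zpow_lt_zpow_right₀ hα hya
  have h4 := zpow_lt_zpow_right₀ hα hyb
  nlinarith

lemma not_top_vertex (hα : 1 < α) (h : EmptyExponents α x y) {a b t : ι} (hxa : x a < x t)
    (hxb : x t < x b) (hya : y a < y t) (hyb : y b < y t) : False := by
  have h1 : α ^ y a ≤ α ^ (y t - 1) := zpow_le_zpow_right₀ hα.le (by omega)
  have h2 : α ^ y b ≤ α ^ (y t - 1) := zpow_le_zpow_right₀ hα.le (by omega)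
  have h3 := zpow_lt_zpow_right₀ hα hxa
  have h4 := zpow_lt_zpow_right₀ hα hxb
  have h5 : α ^ (y t - 1) < α ^ y t := zpow_lt_zpow_right₀ hα (by omega)
  set U := α ^ x a
  set V := α ^ y a
  set U' := α ^ x b
  set V' := α ^ y b
  set u := α ^ x t
  set v := α ^ y t
  set w := α ^ (y t - 1)
  have hE : 0 < v * (U' - U) - V * (U' - u) - V' * (u - U) := by nlinarith
  set E := v * (U' - U) - V * (U' - u) - V' * (u - U) with hEdef
  have hne : E ≠ 0 := hE.ne'
  have ht : (v - w) * (U' - U) / E ≤ 1 := by rw [div_le_one hE]; nlinarith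
  have := h.empty a t b ((v - w) * (U' - u) / E) (1 - (v - w) * (U' - U) / E)
    ((v - w) * (u - U) / E)
    (by apply div_nonneg (mul_nonneg _ _) hE.le <;> linarith) (by linarith)
    (by apply div_nonneg (mul_nonneg _ _) hE.le <;> linarith)
    (by field_simp; ring) (x t) (y t - 1)
    (by
      change u = _ * U + _ * u + _ * U'
      field_simp
      ring)
    (by
      change w = _ * V + _ * v + _ * V'
      field_simp
      rw [hEdef]
      ring)
  omega

lemma northWest_subsingleton_of_northEast [Finite ι] (hα : 1 < α) (h : EmptyExponents α x y)
    (hN : (northEast α x y).Nontrivial) : (northWest α x y).Subsingleton := by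
  by_contra hW
  rw [Set.not_subsingleton_iff] at hW
  obtain ⟨p, hp, p', hp', hpp, hxp⟩ : ∃ p ∈ northWest α x y, ∃ p' ∈ northWest α x y,
      p ≠ p' ∧ x p ≤ x p' := by
    obtain ⟨p, hp, p', hp', hne⟩ := hW
    rcases le_total (x p) (x p') with hx | hx
    · exact ⟨p, hp, p', hp', hne, hx⟩
    · exact ⟨p', hp', p, hp, hne.symm, hx⟩
  obtain ⟨r, hr, r', hr', hrr, hxr⟩ : ∃ r ∈ northEast α x y, ∃ r' ∈ northEast α x y,
      r ≠ r' ∧ x r ≤ x r' := by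
    obtain ⟨p, hp, p', hp', hne⟩ := hN
    rcases le_total (x p) (x p') with hx | hx
    · exact ⟨p, hp, p', hp', hne, hx⟩
    · exact ⟨p', hp', p, hp, hne.symm, hx⟩
  have : Nonempty ι := ⟨p⟩
  obtain ⟨t, ht⟩ := Finite.exists_max y
  have h1 := northWest_lt hα hp' hpp hxp
  have h2 : x p < x p' := by
    by_contra! hx
    have := northWest_lt hα hp hpp.symm hx
    omega
  have h3 := northEast_lt hα hr hrr.symm hxr
  have h4 : x r < x r' := by
    by_contra! hx
    have := northEast_lt hα hr' hrr hx
    omega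
  have h5 : x p' ≤ x t := by
    by_contra! hx
    have := northWest_lt (q := t) hα hp' (by rintro rfl; omega) hx.le
    have := ht p'
    omega
  have h6 : x t ≤ x r := by
    by_contra! hx
    have := northEast_lt (q := t) hα hr (by rintro rfl; omega) hx.le
    have := ht r
    omega
  have := ht p'
  have := ht r
  exact h.not_top_vertex hα (a := p) (b := r') (t := t) (by omega) (by omega) (by omega) (by omega)

lemma northWest_subsingleton_of_southWest [Finite ι] (hα : 1 < α) (h : EmptyExponents α x y)
    (hS : (southWest α x y).Nontrivial) : (northWest α x y).Subsingleton := by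
  by_contra hW
  rw [Set.not_subsingleton_iff] at hW
  obtain ⟨p, hp, p', hp', hpp, hxp⟩ : ∃ p ∈ northWest α x y, ∃ p' ∈ northWest α x y,
      p ≠ p' ∧ x p ≤ x p' := by
    obtain ⟨p, hp, p', hp', hne⟩ := hW
    rcases le_total (x p) (x p') with hx | hx
    · exact ⟨p, hp, p', hp', hne, hx⟩
    · exact ⟨p', hp', p, hp, hne.symm, hx⟩
  obtain ⟨r, hr, r', hr', hrr, hxr⟩ : ∃ r ∈ southWest α x y, ∃ r' ∈ southWest α x y,
      r ≠ r' ∧ x r ≤ x r' := by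
    obtain ⟨p, hp, p', hp', hne⟩ := hS
    rcases le_total (x p) (x p') with hx | hx
    · exact ⟨p, hp, p', hp', hne, hx⟩
    · exact ⟨p', hp', p, hp, hne.symm, hx⟩
  have : Nonempty ι := ⟨p⟩
  obtain ⟨t, ht⟩ := Finite.exists_min x
  have h1 := northWest_lt hα hp' hpp hxp
  have h2 : x p < x p' := by
    by_contra! hx
    have := northWest_lt hα hp hpp.symm hx
    omega
  have h3 := southWest_lt hα hr' hrr hxr
  have h4 : x r < x r' := by
    by_contra! hx
    have := southWest_lt hα hr hrr.symm hx
    omega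
  have h5 : y t ≤ y p := by
    by_contra! hy
    have := northWest_lt (q := t) hα hp (by rintro rfl; omega) (ht p)
    omega
  have h6 : y r ≤ y t := by
    by_contra! hy
    have := southWest_lt (q := t) hα hr (by rintro rfl; omega) (ht r)
    omega
  have := ht p
  have := ht r
  exact h.not_left_vertex hα (a := r') (b := p') (t := t) (by omega) (by omega) (by omega)
    (by omega)

end EmptyExponents

lemma exists_spread_of_card {s : Set ι} (hs : s.Finite) {f : ι → ℤ} (hf : Set.InjOn f s)
    {n : ℤ} (hn : 0 ≤ n) (hc : n + 2 ≤ s.ncard) :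
    ∃ p ∈ s, ∃ q ∈ s, ∃ r ∈ s, f p < f q ∧ f q + n ≤ f r := by
  classical
  have hcard : (hs.toFinset.image f).card = s.ncard := by
    rw [Finset.card_image_of_injOn (by simpa using hf), Set.ncard_eq_toFinset_card s hs]
  set S := hs.toFinset.image f with hS
  have hSne : S.Nonempty := by
    rw [← Finset.card_pos]
    omega
  have hmem : ∀ i ∈ S, ∃ p ∈ s, f p = i := by
    intro i hi
    simpa [hS] using hi
  have hmin := S.min'_mem hSne
  set m := S.min' hSne with hm
  have hc' : ((S.erase m).card : ℤ) ≥ n + 1 := by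
    rw [Finset.card_erase_of_mem hmin]
    omega
  have hne : (S.erase m).Nonempty := by
    rw [← Finset.card_pos]
    omega
  have hmin' := (S.erase m).min'_mem hne
  have hmax' := (S.erase m).max'_mem hne
  have hsub : S.erase m ⊆ Finset.Icc ((S.erase m).min' hne) ((S.erase m).max' hne) := fun i hi =>
    Finset.mem_Icc.2 ⟨Finset.min'_le _ _ hi, Finset.le_max' _ _ hi⟩
  have hle := Finset.card_le_card hsub
  rw [Int.card_Icc] at hle
  obtain ⟨p, hp, hpe⟩ := hmem _ hmin
  obtain ⟨q, hq, hqe⟩ := hmem _ (Finset.mem_of_mem_erase hmin')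
  obtain ⟨r, hr, hre⟩ := hmem _ (Finset.mem_of_mem_erase hmax')
  refine ⟨p, hp, q, hq, r, hr, ?_, by omega⟩
  have h1 : f q ≠ m := hqe ▸ Finset.ne_of_mem_erase hmin'
  have h2 : m ≤ f q := hqe ▸ Finset.min'_le _ _ (Finset.mem_of_mem_erase hmin')
  omega

lemma ncard_northEast_le [Finite ι] (hα : 1 < α) {k : ℤ} (hk0 : 0 ≤ k)
    (hk : α ≤ α ^ k * (α - 1)) : ((northEast α x y).ncard : ℤ) ≤ k + 1 := by
  by_contra! hc
  have hinj : Set.InjOn x (northEast α x y) := by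
    intro p hp q hq hpq
    by_contra hne
    have h1 := northEast_lt hα hp (Ne.symm hne) hpq.le
    have h2 := northEast_lt hα hq hne hpq.ge
    omega
  obtain ⟨p, hp, q, hq, r, hr, hpq, hqr⟩ :=
    exists_spread_of_card (Set.toFinite _) hinj hk0 (by omega)
  have hyp : y q < y p := northEast_lt hα hp (by rintro rfl; omega) hpq.le
  obtain ⟨a, b, ha, hb, h⟩ := hq
  have hp1 := h p (by rintro rfl; omega)
  have hpos : 0 < α := by linarith
  have hr1 : a * α ^ x r + b * α ^ y r ≤ a * α ^ x q + b * α ^ y q := by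
    by_cases hrq : r = q
    · rw [hrq]
    · exact (h r hrq).le
  have e1 : α ^ x q * α ^ k ≤ α ^ x r := by
    rw [← zpow_add₀ hpos.ne']
    exact zpow_le_zpow_right₀ hα.le hqr
  have e2 : α ^ y q * α ≤ α ^ y p := by
    rw [← zpow_add_one₀ hpos.ne']
    exact zpow_le_zpow_right₀ hα.le (by omega)
  have hu : 0 < a * α ^ x q := by positivity
  have hv : 0 < b * α ^ y q := by positivity
  have hu' : 0 < a * α ^ x p := by positivity
  have hv' : 0 < b * α ^ y r := by positivity
  have f1 := mul_le_mul_of_nonneg_left e1 ha.le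
  have f2 := mul_le_mul_of_nonneg_left e2 hb.le
  rw [← mul_assoc] at f1 f2
  have g1 : a * α ^ x q * (α ^ k - 1) < b * α ^ y q := by linarith
  have g2 : b * α ^ y q * (α - 1) < a * α ^ x q := by linarith
  have g3 := mul_lt_mul_of_pos_right g1 (sub_pos.2 hα)
  nlinarith

lemma EmptyExponents.ncard_southWest_le [Finite ι] (hα : 1 < α) (hE : EmptyExponents α x y)
    {k : ℤ} (hk0 : 0 ≤ k) (hk : α ≤ α ^ k * (α - 1)) :
    ((southWest α x y).ncard : ℤ) ≤ k + 2 := by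
  by_contra! hc
  have hinj : Set.InjOn x (southWest α x y) := by
    intro p hp q hq hpq
    by_contra hne
    have h1 := southWest_lt hα hp (Ne.symm hne) hpq.ge
    have h2 := southWest_lt hα hq hne hpq.le
    omega
  obtain ⟨p, hp, q, hq, r, hr, hpq, hqr⟩ :=
    exists_spread_of_card (n := k + 1) (Set.toFinite _) hinj (by omega) (by omega)
  have hyp : y q < y p := southWest_lt hα hq (by rintro rfl; omega) hpq.le
  have hyr : y r < y q := southWest_lt hα hr (by rintro rfl; omega) (by omega)
  apply hE.not_right hα hyp hyr
  have hpos : 0 < α := by linarith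
  have e1 : α ^ (x q + 1) * α ^ k ≤ α ^ x r := by
    rw [← zpow_add₀ hpos.ne']
    exact zpow_le_zpow_right₀ hα.le (by omega)
  have e2 : α ^ y q * α ≤ α ^ y p := by
    rw [← zpow_add_one₀ hpos.ne']
    exact zpow_le_zpow_right₀ hα.le (by omega)
  have e3 := zpow_lt_zpow_right₀ hα hyr
  have hw : 0 < α ^ (x q + 1) := by positivity
  have hP : 0 < α ^ x p := by positivity
  have hS : 0 < α ^ y r := by positivity
  have hq0 : 0 < α ^ y q := by positivity
  have hk1 : 0 < α ^ k := by positivity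
  have hQ : 0 < α ^ y p := by positivity
  have s1 : α ^ y p ≤ α ^ k * (α ^ y p - α ^ y q) := by
    have t1 : α ^ y p * (α - 1) ≤ α * (α ^ y p - α ^ y q) := by nlinarith
    have t2 : α ^ y p * α ≤ α ^ k * (α ^ y p * (α - 1)) := by nlinarith
    have t3 := mul_le_mul_of_nonneg_left t1 hk1.le
    have t4 : α ^ y p * α ≤ α ^ k * (α ^ y p - α ^ y q) * α := by linarith
    exact le_of_mul_le_mul_right t4 hpos
  have s2 := mul_le_mul_of_nonneg_left s1 hw.le
  have s3 : 0 ≤ α ^ y p - α ^ y q := by nlinarith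
  have s4 := mul_le_mul_of_nonneg_right e1 s3
  have s5 : 0 < α ^ x p * (α ^ y q - α ^ y r) := mul_pos hP (by linarith)
  have s6 := mul_pos hw hS
  linarith

lemma EmptyExponents.card_le_of_nontrivial [Finite ι] (hα : 1 < α) (hE : EmptyExponents α x y)
    {k : ℤ} (hk0 : 0 ≤ k) (hk : α ≤ α ^ k * (α - 1))
    (hnt : (northEast α x y).Nontrivial ∨ (southWest α x y).Nontrivial) :
    (Nat.card ι : ℤ) ≤ 2 * k + 5 := by
  have hW : (northWest α x y).Subsingleton := hnt.elim
    (hE.northWest_subsingleton_of_northEast hα) (hE.northWest_subsingleton_of_southWest hα)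
  have hW' : (northWest α y x).Subsingleton := by
    rw [← northEast_swap, ← southWest_swap] at hnt
    exact hnt.elim (hE.swap.northWest_subsingleton_of_northEast hα)
      (hE.swap.northWest_subsingleton_of_southWest hα)
  have hcover : (Set.univ : Set ι) ⊆
      northEast α x y ∪ southWest α x y ∪ (northWest α x y ∪ northWest α y x) := by
    intro p _
    obtain ⟨a, b, c, ha, hb, -, h0, h⟩ := hE.exposed p
    rcases lt_or_gt_of_ne ha with ha | ha <;> rcases lt_or_gt_of_ne hb with hb | hb
    · exact .inl <| .inl ⟨-a, -b, by linarith, by linarith, fun q hq => by linarith [h q hq]⟩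
    · exact .inr <| .inr ⟨b, -a, by linarith, by linarith, fun q hq => by linarith [h q hq]⟩
    · exact .inr <| .inl ⟨a, -b, by linarith, by linarith, fun q hq => by linarith [h q hq]⟩
    · exact .inl <| .inr ⟨a, b, by linarith, by linarith, fun q hq => by linarith [h q hq]⟩
  have h1 := Set.ncard_le_ncard hcover (Set.toFinite _)
  rw [Set.ncard_univ] at h1
  have h2 := Set.ncard_union_le (northEast α x y ∪ southWest α x y)
    (northWest α x y ∪ northWest α y x)
  have h3 := Set.ncard_union_le (northEast α x y) (southWest α x y)
  have h4 := Set.ncard_union_le (northWest α x y) (northWest α y x)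
  have h5 := Set.ncard_le_one_iff_subsingleton.2 hW
  have h6 := Set.ncard_le_one_iff_subsingleton.2 hW'
  have h7 := ncard_northEast_le (x := x) (y := y) hα hk0 hk
  have h8 := hE.ncard_southWest_le hα hk0 hk
  omega

/-- The six sign patterns of an exposing line `a u + b v + c = 0` cover all vertices. -/
lemma EmptyExponents.univ_subset (hα : 1 < α) (hE : EmptyExponents α x y) :
    (Set.univ : Set ι) ⊆ (northEast α x y ∪ southWest α x y) ∪
      (northEast α (fun p => x p - y p) (fun p => -y p) ∪
        southWest α (fun p => x p - y p) (fun p => -y p)) ∪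
      (northEast α (fun p => y p - x p) (fun p => -x p) ∪
        southWest α (fun p => y p - x p) (fun p => -x p)) := by
  intro p _
  have h0 : α ≠ 0 := by positivity
  have key : ∀ {u v : ι → ℤ} {a b c : ℝ}, a * α ^ u p + b * α ^ v p + c = 0 →
      (∀ q, q ≠ p → 0 < a * α ^ u q + b * α ^ v q + c) →
      a * α ^ (u p - v p) + c * α ^ (-v p) + b = 0 ∧
      ∀ q, q ≠ p → 0 < a * α ^ (u q - v q) + c * α ^ (-v q) + b := by
    intro u v a b c he hlt
    have key : ∀ q, a * α ^ (u q - v q) + c * α ^ (-v q) + b =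
        (a * α ^ u q + b * α ^ v q + c) * α ^ (-v q) := by
      intro q
      rw [zpow_sub₀ h0, zpow_neg]
      have : α ^ v q ≠ 0 := zpow_ne_zero _ h0
      field_simp
      ring
    refine ⟨by rw [key, he, zero_mul], fun q hq => ?_⟩
    rw [key]
    have := hlt q hq
    positivity
  obtain ⟨a, b, c, ha, hb, hc, he, h⟩ := hE.exposed p
  obtain ⟨he', h'⟩ := key he h
  obtain ⟨he'', h''⟩ := key (u := y) (v := x) (a := b) (b := a) (c := c) (by linarith)
    (fun q hq => by linarith [h q hq])
  rcases lt_or_gt_of_ne ha with ha | ha <;> rcases lt_or_gt_of_ne hb with hb | hb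
  · exact .inl <| .inl <| .inl
      ⟨-a, -b, by linarith, by linarith, fun q hq => by linarith [h q hq]⟩
  · rcases lt_or_gt_of_ne hc with hc | hc
    · exact .inl <| .inr <| .inl
        ⟨-a, -c, by linarith, by linarith, fun q hq => by linarith [h' q hq]⟩
    · exact .inr <| .inr
        ⟨b, c, by linarith, by linarith, fun q hq => by linarith [h'' q hq]⟩
  · rcases lt_or_gt_of_ne hc with hc | hc
    · exact .inr <| .inl
        ⟨-b, -c, by linarith, by linarith, fun q hq => by linarith [h'' q hq]⟩
    · exact .inl <| .inr <| .inr
        ⟨a, c, by linarith, by linarith, fun q hq => by linarith [h' q hq]⟩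
  · exact .inl <| .inl <| .inr
      ⟨a, b, by linarith, by linarith, fun q hq => by linarith [h q hq]⟩

lemma EmptyExponents.card_le [Finite ι] (hα : 1 < α) (hE : EmptyExponents α x y) {k : ℤ}
    (hk0 : 0 ≤ k) (hk : α ≤ α ^ k * (α - 1)) : (Nat.card ι : ℤ) ≤ max 6 (2 * k + 5) := by
  by_contra! hlt
  rw [max_lt_iff] at hlt
  have aux : ∀ {u v : ι → ℤ}, EmptyExponents α u v →
      (northEast α u v ∪ southWest α u v).ncard ≤ 2 := by
    intro u v huv
    by_contra! h2
    have h3 := Set.ncard_union_le (northEast α u v) (southWest α u v)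
    have hnt : (northEast α u v).Nontrivial ∨ (southWest α u v).Nontrivial := by
      by_contra! h4
      rw [← Set.ncard_le_one_iff_subsingleton, ← Set.ncard_le_one_iff_subsingleton] at h4
      omega
    have := huv.card_le_of_nontrivial hα hk0 hk hnt
    omega
  have h0 := Set.ncard_le_ncard (hE.univ_subset hα) (Set.toFinite _)
  rw [Set.ncard_univ] at h0
  have h1 := aux hE
  have h2 := aux (hE.projective hα)
  have h3 := aux (hE.swap.projective hα)
  have h4 := h0.trans (Set.ncard_union_le _ _)
  have h5 := h4.trans (Nat.add_le_add_right (Set.ncard_union_le _ _) _)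
  omega

end Exponents

lemma exists_exposing_line {X : Set (ℝ × ℝ)} (hfin : X.Finite) (hX : StrictConvexPos X)
    {p : ℝ × ℝ} (hp : p ∈ X) (hp₁ : 0 < p.1) (hp₂ : 0 < p.2) :
    ∃ a b c : ℝ, a ≠ 0 ∧ b ≠ 0 ∧ c ≠ 0 ∧ a * p.1 + b * p.2 + c = 0 ∧
      ∀ q ∈ X, q ≠ p → 0 < a * q.1 + b * q.2 + c := by
  have hfin' : (X \ {p}).Finite := hfin.subset Set.sdiff_subset
  obtain ⟨f, s, hs, hf⟩ := geometric_hahn_banach_point_closed (convex_convexHull ℝ (X \ {p}))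
    (hfin'.isClosed_convexHull ℝ) (hX p hp)
  have hrep : ∀ q : ℝ × ℝ, f q = f (1, 0) * q.1 + f (0, 1) * q.2 := by
    intro q
    have : q = q.1 • ((1 : ℝ), (0 : ℝ)) + q.2 • ((0 : ℝ), (1 : ℝ)) := by ext <;> simp
    conv_lhs => rw [this, map_add, map_smul, map_smul]
    simp [mul_comm]
  set a := f (1, 0)
  set b := f (0, 1)
  have h1 : ∀ᶠ e : ℝ in nhds 0, ∀ q ∈ X \ {p},
      0 < (a + e) * (q.1 - p.1) + (b + e) * (q.2 - p.2) := by
    rw [hfin'.eventually_all]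
    intro q hq
    have hpos : 0 < (a + 0) * (q.1 - p.1) + (b + 0) * (q.2 - p.2) := by
      have := hf q (subset_convexHull ℝ _ hq)
      have h := hs.trans this
      rw [hrep, hrep q] at h
      linarith
    have hcont : Continuous fun e : ℝ => (a + e) * (q.1 - p.1) + (b + e) * (q.2 - p.2) := by
      fun_prop
    exact hcont.continuousAt.eventually (lt_mem_nhds hpos)
  have h2 : ∀ᶠ e : ℝ in nhdsWithin 0 {0}ᶜ,
      e ∉ ({-a, -b, -(a * p.1 + b * p.2) / (p.1 + p.2)} : Set ℝ) :=
    nhdsNE_le_cofinite 0 (Set.toFinite _).compl_mem_cofinite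
  obtain ⟨e, he1, he2⟩ := ((h1.filter_mono nhdsWithin_le_nhds).and h2).exists
  simp only [Set.mem_insert_iff, Set.mem_singleton_iff, not_or] at he2
  obtain ⟨ha, hb, hc⟩ := he2
  refine ⟨a + e, b + e, -((a + e) * p.1 + (b + e) * p.2), fun h => ha (by linarith),
    fun h => hb (by linarith), fun h => hc ?_, by ring, fun q hq hqp => ?_⟩
  · rw [eq_div_iff (by positivity)]
    linarith
  · linarith [he1 q ⟨hq, hqp⟩]

lemma IsEmptyPolygonIn.exists_emptyExponents {α : ℝ} (hα : 1 < α) {X : Set (ℝ × ℝ)}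
    (hfin : X.Finite) (hX : IsEmptyPolygonIn (expLattice α) X) :
    ∃ x y : X → ℤ, EmptyExponents α x y := by
  obtain ⟨hsub, hconv, hempty⟩ := hX
  choose m n hmn using fun p : X => hsub p.2
  have hpos : 0 < α := by linarith
  have hone : ∀ k : ℕ, 1 ≤ α ^ k := fun k => one_le_pow₀ hα.le
  refine ⟨fun p => m p, fun p => n p, ⟨fun p => ?_, ?_⟩⟩
  · obtain ⟨a, b, c, ha, hb, hc, h0, h⟩ := exists_exposing_line hfin hconv p.2
      (by rw [hmn p]; positivity) (by rw [hmn p]; positivity)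
    refine ⟨a, b, c, ha, hb, hc, by rw [hmn p] at h0; simpa using h0, fun q hq => ?_⟩
    have := h q q.2 (fun h => hq (Subtype.ext h))
    rw [hmn q] at this
    simpa using this
  · intro p q r l s t hl hs ht hsum i j hi hj
    simp only [zpow_natCast] at hi hj
    have hi0 : 0 ≤ i := by
      rw [← zpow_le_zpow_iff_right₀ hα, zpow_zero, hi]
      nlinarith [hone (m p), hone (m q), hone (m r)]
    have hj0 : 0 ≤ j := by
      rw [← zpow_le_zpow_iff_right₀ hα, zpow_zero, hj]
      nlinarith [hone (n p), hone (n q), hone (n r)]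
    lift i to ℕ using hi0
    lift j to ℕ using hj0
    rw [zpow_natCast] at hi hj
    have hcomb : ((α ^ i, α ^ j) : ℝ × ℝ) =
        l • (p : ℝ × ℝ) + s • (q : ℝ × ℝ) + t • (r : ℝ × ℝ) := by
      rw [hmn p, hmn q, hmn r]
      ext <;> simp [hi, hj]
    have hmem : ∀ Y : Set (ℝ × ℝ), (p : ℝ × ℝ) ∈ Y → (q : ℝ × ℝ) ∈ Y → (r : ℝ × ℝ) ∈ Y →
        ((α ^ i, α ^ j) : ℝ × ℝ) ∈ convexHull ℝ Y := by
      intro Y hp hq hr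
      rw [hcomb]
      have hY := subset_convexHull ℝ Y
      simpa [Fin.sum_univ_three] using (convex_convexHull ℝ Y).sum_mem (t := Finset.univ)
        (w := ![l, s, t]) (z := ![(p : ℝ × ℝ), q, r]) (by simp [Fin.forall_fin_succ, hl, hs, ht])
        (by simpa [Fin.sum_univ_three] using hsum)
        (by simp [Fin.forall_fin_succ, hY hp, hY hq, hY hr])
    have hgX : ((α ^ i, α ^ j) : ℝ × ℝ) ∈ X := by
      rw [← hempty]
      exact ⟨hmem X p.2 q.2 r.2, i, j, rfl⟩
    have hinj : ∀ w : X, ((α ^ i, α ^ j) : ℝ × ℝ) = w → (i : ℤ) = m w ∧ (j : ℤ) = n w := by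
      intro w hw
      rw [hmn w, Prod.mk.injEq] at hw
      exact ⟨congrArg _ (pow_right_injective₀ hpos hα.ne' hw.1),
        congrArg _ (pow_right_injective₀ hpos hα.ne' hw.2)⟩
    by_contra! hne
    apply hconv _ hgX
    apply hmem
    · exact ⟨p.2, fun h => hne.1 (hinj p h.symm).1 (hinj p h.symm).2⟩
    · exact ⟨q.2, fun h => hne.2.1 (hinj q h.symm).1 (hinj q h.symm).2⟩
    · exact ⟨r.2, fun h => hne.2.2 (hinj r h.symm).1 (hinj r h.symm).2⟩

theorem h_le_log_bound (α : ℝ) (hα₁ : 1 < α) (hα₂ : α < (1 + Real.sqrt 5) / 2)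
    (X : Set (ℝ × ℝ)) (hfin : X.Finite)
    (hX : IsEmptyPolygonIn (expLattice α) X) :
    (X.ncard : ℤ) ≤ 3 * ⌈Real.logb α (α / (α - 1))⌉ + 3 := by
  obtain ⟨x, y, hE⟩ := hX.exists_emptyExponents hα₁ hfin
  have : Finite X := hfin
  have hα0 : 0 < α := by linarith
  have hα' : 0 < α - 1 := by linarith
  have hα3 : α < 2 := by
    have : Real.sqrt 5 < 3 := by
      rw [Real.sqrt_lt' (by norm_num)]
      norm_num
    linarith
  have hd : 0 < α / (α - 1) := by positivity
  set k := ⌈Real.logb α (α / (α - 1))⌉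
  have hk2 : 1 < k := by
    rw [Int.lt_ceil, Int.cast_one, Real.lt_logb_iff_rpow_lt hα₁ hd, Real.rpow_one,
      lt_div_iff₀ hα']
    nlinarith
  have hk : α ≤ α ^ k * (α - 1) := by
    rw [← div_le_iff₀ hα', ← Real.rpow_intCast, ← Real.logb_le_iff_le_rpow hα₁ hd]
    exact Int.le_ceil _
  have := hE.card_le hα₁ (by omega) hk
  rw [Nat.card_coe_set_eq] at this
  omega
end

section
/- For every real number α ≥ 2, the 5-element set X = {(1,α²), (α,α), (α²,1), (α²,α), (α,α²)} ⊆ L(α) is in strictly convex position and satisfies conv(X) ∩ L(α) = X; in particular, h(α) ≥ 5. -/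
/-- A linear inequality valid on a planar set is valid on its convex hull. -/
theorem le_of_mem_convexHull_prod {X : Set (ℝ × ℝ)} (u v c : ℝ)
    (h : ∀ p ∈ X, u * p.1 + v * p.2 ≤ c) {p : ℝ × ℝ} (hp : p ∈ convexHull ℝ X) :
    u * p.1 + v * p.2 ≤ c := by
  have hconv : Convex ℝ {q : ℝ × ℝ | u * q.1 + v * q.2 ≤ c} :=
    convex_halfSpace_le (f := fun q : ℝ × ℝ => u * q.1 + v * q.2)
      ⟨fun x y => by simp only [Prod.fst_add, Prod.snd_add]; ring,
        fun r x => by simp only [Prod.smul_fst, Prod.smul_snd, smul_eq_mul]; ring⟩ c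
  exact convexHull_min h hconv hp

/-- A point strictly separated from the rest of a planar set by a linear functional
is not in the convex hull of the rest. -/
theorem notMem_convexHull_diff_singleton {X : Set (ℝ × ℝ)} {x : ℝ × ℝ} (u v c : ℝ)
    (hx : c < u * x.1 + v * x.2) (h : ∀ p ∈ X, p = x ∨ u * p.1 + v * p.2 ≤ c) :
    x ∉ convexHull ℝ (X \ {x}) := fun hmem =>
  hx.not_ge <| le_of_mem_convexHull_prod u v c
    (fun p hp => (h p hp.1).resolve_left hp.2) hmem

theorem empty_pentagon (α : ℝ) (hα : 2 ≤ α) :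
    IsEmptyPolygonIn (expLattice α)
      ({((1 : ℝ), α ^ 2), (α, α), (α ^ 2, 1), (α ^ 2, α), (α, α ^ 2)} : Set (ℝ × ℝ)) ∧
    ({((1 : ℝ), α ^ 2), (α, α), (α ^ 2, 1), (α ^ 2, α), (α, α ^ 2)} : Set (ℝ × ℝ)).ncard = 5 := by
  have h1 : 1 < α := by linarith
  have h2 : 2 * α ≤ α ^ 2 := by nlinarith
  have hlt : α < α ^ 2 := by linarith
  have hlt1 : 1 < α ^ 2 := by linarith
  have hsub : ({((1 : ℝ), α ^ 2), (α, α), (α ^ 2, 1), (α ^ 2, α), (α, α ^ 2)} : Set (ℝ × ℝ)) ⊆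
      expLattice α := by
    rintro p (rfl | rfl | rfl | rfl | rfl)
    · exact ⟨0, 2, by simp⟩
    · exact ⟨1, 1, by simp⟩
    · exact ⟨2, 0, by simp⟩
    · exact ⟨2, 1, by simp⟩
    · exact ⟨1, 2, by simp⟩
  refine ⟨⟨hsub, ?_, ?_⟩, ?_⟩
  · rintro p (rfl | rfl | rfl | rfl | rfl)
    · refine notMem_convexHull_diff_singleton (-1) 0 (-α) (by linarith) ?_
      rintro q (rfl | rfl | rfl | rfl | rfl) <;> first | exact .inl rfl | (right; linarith)
    · refine notMem_convexHull_diff_singleton (-1) (-1) (-(α ^ 2 + 1)) (by linarith) ?_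
      rintro q (rfl | rfl | rfl | rfl | rfl) <;> first | exact .inl rfl | (right; linarith)
    · refine notMem_convexHull_diff_singleton 0 (-1) (-α) (by linarith) ?_
      rintro q (rfl | rfl | rfl | rfl | rfl) <;> first | exact .inl rfl | (right; linarith)
    · refine notMem_convexHull_diff_singleton 2 1 (2 * α ^ 2 + 1) (by linarith) ?_
      rintro q (rfl | rfl | rfl | rfl | rfl) <;> first | exact .inl rfl | (right; linarith)
    · refine notMem_convexHull_diff_singleton 1 2 (2 * α ^ 2 + 1) (by linarith) ?_
      rintro q (rfl | rfl | rfl | rfl | rfl) <;> first | exact .inl rfl | (right; linarith)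
  · apply Set.Subset.antisymm
    · rintro _ ⟨hp, m, n, rfl⟩
      have hx := le_of_mem_convexHull_prod 1 0 (α ^ 2) (by
        rintro q (rfl | rfl | rfl | rfl | rfl) <;> linarith) hp
      have hy := le_of_mem_convexHull_prod 0 1 (α ^ 2) (by
        rintro q (rfl | rfl | rfl | rfl | rfl) <;> linarith) hp
      have hDE := le_of_mem_convexHull_prod 1 1 (α ^ 2 + α) (by
        rintro q (rfl | rfl | rfl | rfl | rfl) <;> linarith) hp
      have hAB := le_of_mem_convexHull_prod (-α) (-1) (-(α ^ 2 + α)) (by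
        rintro q (rfl | rfl | rfl | rfl | rfl) <;> nlinarith) hp
      have hBC := le_of_mem_convexHull_prod (-1) (-α) (-(α ^ 2 + α)) (by
        rintro q (rfl | rfl | rfl | rfl | rfl) <;> nlinarith) hp
      simp only [one_mul, zero_mul, add_zero, zero_add] at hx hy hDE
      have hm : m ≤ 2 := (pow_le_pow_iff_right₀ h1).1 hx
      have hn : n ≤ 2 := (pow_le_pow_iff_right₀ h1).1 hy
      interval_cases m <;> interval_cases n <;>
        first
        | (exfalso; nlinarith)
        | simp
    · exact Set.subset_inter (subset_convexHull ℝ _) hsub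
  · rw [Set.ncard_insert_of_notMem, Set.ncard_insert_of_notMem, Set.ncard_insert_of_notMem,
      Set.ncard_pair] <;>
    simp [h1.ne, h1.ne', hlt.ne, hlt.ne', hlt1.ne, hlt1.ne']
end

section
/- For every real number α with (1+√5)/2 ≤ α < 2, there exists a positive integer k such that the 7-element set Q(α) = {(1,α^k), (α^{k−2},α^{k−1}), (α^{k−1},α^{k−2}), (α^k,1), (α^k,α), (α^{k−1},α^{k−1}), (α,α^k)} ⊆ L(α) is in strictly convex position and satisfies conv(Q(α)) ∩ L(α) = Q(α); in particular, h(α) ≥ 7. -/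
/-- The seven-point configuration `Q(α)` from the paper. -/
def Qset (α : ℝ) (k : ℕ) : Set (ℝ × ℝ) :=
  {((1 : ℝ), α ^ k), (α ^ (k - 2), α ^ (k - 1)), (α ^ (k - 1), α ^ (k - 2)),
   (α ^ k, 1), (α ^ k, α), (α ^ (k - 1), α ^ (k - 1)), (α, α ^ k)}

open Set

/-- A point at which some linear functional is strictly smaller than on all of `Y` is not in the
convex hull of `Y`. -/
theorem notMem_convexHull_of_forall_lt {Y : Set (ℝ × ℝ)} (x : ℝ × ℝ) (u v : ℝ)
    (h : ∀ p ∈ Y, u * x.1 + v * x.2 < u * p.1 + v * p.2) : x ∉ convexHull ℝ Y := by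
  intro hx
  have hlin : IsLinearMap ℝ (fun p : ℝ × ℝ => u * p.1 + v * p.2) :=
    ⟨fun p q => by simp; ring, fun c p => by simp; ring⟩
  have hmem : x ∈ {p : ℝ × ℝ | u * x.1 + v * x.2 < u * p.1 + v * p.2} :=
    convexHull_min (fun p hp => h p hp) (convex_halfSpace_gt hlin (u * x.1 + v * x.2)) hx
  exact lt_irrefl (u * x.1 + v * x.2) hmem

/-- A closed half-plane containing `Y` contains the convex hull of `Y`. -/
theorem le_of_mem_convexHull {Y : Set (ℝ × ℝ)} {x : ℝ × ℝ} (hx : x ∈ convexHull ℝ Y)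
    (u v c : ℝ) (h : ∀ p ∈ Y, c ≤ u * p.1 + v * p.2) : c ≤ u * x.1 + v * x.2 := by
  have hlin : IsLinearMap ℝ (fun p : ℝ × ℝ => u * p.1 + v * p.2) :=
    ⟨fun p q => by simp; ring, fun c p => by simp; ring⟩
  exact convexHull_min (fun p hp => h p hp) (convex_halfSpace_ge hlin c) hx

/-- The heptagon `Q(α)` with `a = α` and `b = α ^ (k - 2)`. -/
def heptagon (a b : ℝ) : Set (ℝ × ℝ) :=
  {(1, a ^ 2 * b), (b, a * b), (a * b, b), (a ^ 2 * b, 1), (a ^ 2 * b, a), (a * b, a * b),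
    (a, a ^ 2 * b)}

theorem Qset_add_two (α : ℝ) (n : ℕ) : Qset α (n + 2) = heptagon α (α ^ n) := by
  have h1 : n + 2 - 1 = n + 1 := rfl
  have h2 : α ^ (n + 1) = α * α ^ n := by ring
  have h3 : α ^ (n + 2) = α ^ 2 * α ^ n := by ring
  simp only [Qset, heptagon, Nat.add_sub_cancel, h1, h2, h3]

theorem forall_mem_heptagon {a b : ℝ} {P : ℝ × ℝ → Prop} :
    (∀ p ∈ heptagon a b, P p) ↔ P (1, a ^ 2 * b) ∧ P (b, a * b) ∧ P (a * b, b) ∧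
      P (a ^ 2 * b, 1) ∧ P (a ^ 2 * b, a) ∧ P (a * b, a * b) ∧ P (a, a ^ 2 * b) := by
  simp [heptagon]

theorem ncard_heptagon {a b : ℝ} (ha : 1 < a) (hab : a < b) : (heptagon a b).ncard = 7 := by
  have h1 : b < a * b := by nlinarith
  have h2 : a * b < a ^ 2 * b := by nlinarith
  have h3 : a < a * b := by nlinarith
  unfold heptagon
  repeat rw [ncard_insert_of_notMem]
  · simp
  all_goals
    simp only [mem_insert_iff, mem_singleton_iff, Prod.mk.injEq]
    grind

theorem heptagon_strictConvexPos {a b : ℝ} (ha : 1 < a) (ha2 : a < 2) (hφ : a + 1 ≤ a ^ 2)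
    (hab : a < b) (hb : 1 < (2 - a) * b) : StrictConvexPos (heptagon a b) := by
  have h1 : b < a * b := by nlinarith
  have h2 : a * b < a ^ 2 * b := by nlinarith
  have h3 : a < a * b := by nlinarith
  have h4 : a * b + b ≤ a ^ 2 * b := by nlinarith
  have h5 : a ^ 2 * b + a < 2 * (a * b) := by nlinarith
  have key : ∀ x ∈ heptagon a b, ∃ u v : ℝ, ∀ p ∈ heptagon a b, p ≠ x →
      u * x.1 + v * x.2 < u * p.1 + v * p.2 := by
    have e1 : 0 < (b - 1) * (a ^ 2 * b - a * b - b + 1) := by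
      apply mul_pos <;> linarith
    have e2 : 0 < (2 - a) * (a * b - 1) * a := by
      apply mul_pos (mul_pos _ _) <;> nlinarith
    have e3 : 0 < (a - 1) * (a * b - b) := by apply mul_pos <;> linarith
    have e4 : 0 < (a - 1) * (a - 1) := by apply mul_pos <;> linarith
    have e5 : 0 < (b - 1) * (a * b - b) := by apply mul_pos <;> linarith
    have e6 : 0 < (b - 1) * (a - 1) := by apply mul_pos <;> linarith
    simp only [forall_mem_heptagon]
    refine ⟨⟨1, 0, ?_⟩, ⟨2 * b - 1, 2 * (b - 1), ?_⟩, ⟨2 * (b - 1), 2 * b - 1, ?_⟩, ⟨0, 1, ?_⟩,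
      ⟨-1, -(a - 1), ?_⟩, ⟨-1, -1, ?_⟩, ⟨-(a - 1), -1, ?_⟩⟩
    all_goals
      refine ⟨?_, ?_, ?_, ?_, ?_, ?_, ?_⟩ <;> intro hne <;>
        first | exact absurd rfl hne | (clear hne; nlinarith)
  intro x hx
  obtain ⟨u, v, huv⟩ := key x hx
  exact notMem_convexHull_of_forall_lt x u v fun p hp => huv p hp.1 hp.2

/-- The edge inequalities of the heptagon. -/
theorem heptagon_edge_inequalities {a b : ℝ} (ha : 1 < a) (ha2 : a < 2) (hφ : a + 1 ≤ a ^ 2)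
    (hab : a < b) (hb : 1 < (2 - a) * b) {p : ℝ × ℝ} (hp : p ∈ convexHull ℝ (heptagon a b)) :
    p.1 ≤ a ^ 2 * b ∧ p.2 ≤ a ^ 2 * b ∧ a * b + b ≤ p.1 + p.2 ∧
    b * (a - 1) * (p.1 - a) + (b - 1) * (p.2 - a ^ 2 * b) ≤ 0 ∧
    b * (a - 1) * (p.2 - a) + (b - 1) * (p.1 - a ^ 2 * b) ≤ 0 ∧
    0 ≤ a * b * (a - 1) * (p.1 - 1) + (b - 1) * (p.2 - a ^ 2 * b) ∧
    0 ≤ a * b * (a - 1) * (p.2 - 1) + (b - 1) * (p.1 - a ^ 2 * b) := by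
  have aux := le_of_mem_convexHull hp
  simp only [forall_mem_heptagon] at aux
  have h1 : b < a * b := by nlinarith
  have h2 : a * b < a ^ 2 * b := by nlinarith
  have h3 : a < a * b := by nlinarith
  have h4 : a * b + b ≤ a ^ 2 * b := by nlinarith
  have h5 : a ^ 2 * b + a < 2 * (a * b) := by nlinarith
  have i1 := aux (-1) 0 (-(a ^ 2 * b)) (by refine ⟨?_, ?_, ?_, ?_, ?_, ?_, ?_⟩ <;> nlinarith)
  have i2 := aux 0 (-1) (-(a ^ 2 * b)) (by refine ⟨?_, ?_, ?_, ?_, ?_, ?_, ?_⟩ <;> nlinarith)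
  have i3 := aux 1 1 (a * b + b) (by refine ⟨?_, ?_, ?_, ?_, ?_, ?_, ?_⟩ <;> nlinarith)
  have q1 : 0 < b * (a - 1) := by apply mul_pos <;> linarith
  have q2 : 0 < b - 1 := by linarith
  have q3 : 0 < a * b * (a - 1) := by nlinarith
  have q4 : b * (a - 1) ≤ b - 1 := by nlinarith
  have q5 : b - 1 ≤ a * b * (a - 1) := by nlinarith
  have f1 : b * (a - 1) * (a * b) + (b - 1) * (a * b) =
      b * (a - 1) * a + (b - 1) * (a ^ 2 * b) := by ring
  have f2 : a * b * (a - 1) * b + (b - 1) * (a * b) =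
      a * b * (a - 1) + (b - 1) * (a ^ 2 * b) := by ring
  generalize b * (a - 1) = U at *
  generalize a * b * (a - 1) = T at *
  generalize b - 1 = V at *
  have g1 : 0 ≤ U * (a - 1) := by apply mul_nonneg <;> linarith
  have g2 : 0 ≤ U * (a * b - b) := by apply mul_nonneg <;> linarith
  have g3 : 0 ≤ V * (a - 1) := by apply mul_nonneg <;> linarith
  have g4 : 0 ≤ V * (a * b - b) := by apply mul_nonneg <;> linarith
  have g5 : 0 ≤ (V - U) * (a ^ 2 * b - a) := by apply mul_nonneg <;> linarith
  have g6 : 0 ≤ (T - V) * (a * b - b) := by apply mul_nonneg <;> linarith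
  have g7 : 0 ≤ (T - V) * (a ^ 2 * b - 1) := by apply mul_nonneg <;> linarith
  have g8 : 0 ≤ T * (a - 1) := by apply mul_nonneg <;> linarith
  have i4 := aux (-U) (-V) (-(U * a + V * (a ^ 2 * b)))
    (by refine ⟨?_, ?_, ?_, ?_, ?_, ?_, ?_⟩ <;> linarith)
  have i5 := aux (-V) (-U) (-(U * a + V * (a ^ 2 * b)))
    (by refine ⟨?_, ?_, ?_, ?_, ?_, ?_, ?_⟩ <;> linarith)
  have i6 := aux T V (T + V * (a ^ 2 * b))
    (by refine ⟨?_, ?_, ?_, ?_, ?_, ?_, ?_⟩ <;> linarith)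
  have i7 := aux V T (T + V * (a ^ 2 * b))
    (by refine ⟨?_, ?_, ?_, ?_, ?_, ?_, ?_⟩ <;> linarith)
  refine ⟨?_, ?_, ?_, ?_, ?_, ?_, ?_⟩ <;> linarith

theorem mem_heptagon_of_le {a : ℝ} (ha : 1 < a) {N m n : ℕ} (hab : a < a ^ N) (hn : N + 1 ≤ n)
    (hy : a ^ n ≤ a ^ 2 * a ^ N)
    (hx : a ^ m ≤ a ^ 2 * a ^ N)
    (h1 : a ^ N * (a - 1) * (a ^ m - a) + (a ^ N - 1) * (a ^ n - a ^ 2 * a ^ N) ≤ 0)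
    (h2 : a ^ N * (a - 1) * (a ^ n - a) + (a ^ N - 1) * (a ^ m - a ^ 2 * a ^ N) ≤ 0)
    (h3 : 0 ≤ a * a ^ N * (a - 1) * (a ^ m - 1) + (a ^ N - 1) * (a ^ n - a ^ 2 * a ^ N)) :
    (a ^ m, a ^ n) = (1, a ^ 2 * a ^ N) ∨ (a ^ m, a ^ n) = (a, a ^ 2 * a ^ N) ∨
      (a ^ m, a ^ n) = (a ^ N, a * a ^ N) ∨ (a ^ m, a ^ n) = (a * a ^ N, a * a ^ N) := by
  have le_iff (i j : ℕ) : a ^ i ≤ a ^ j ↔ i ≤ j := pow_le_pow_iff_right₀ ha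
  have e1 : a * a ^ N = a ^ (N + 1) := by ring
  have e2 : a ^ 2 * a ^ N = a ^ (N + 2) := by ring
  have hU : 0 < a ^ N * (a - 1) := by apply mul_pos <;> linarith
  have hm2 : m ≤ N + 2 := by rwa [e2, le_iff] at hx
  have hn2 : n ≤ N + 2 := by rwa [e2, le_iff] at hy
  obtain rfl | rfl : n = N + 2 ∨ n = N + 1 := by omega
  · have : a ^ m ≤ a ^ 1 := by
      rw [e2, sub_self, mul_zero, add_zero] at h1
      rw [pow_one]
      by_contra! hlt
      nlinarith [mul_pos hU (sub_pos.2 hlt)]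
    rw [le_iff] at this
    interval_cases m <;> simp [e2]
  · have hNm : N ≤ m := by
      rw [← le_iff]
      have hT : 0 < a * a ^ N * (a - 1) := by nlinarith
      refine le_of_mul_le_mul_left ?_ hT
      rw [← e1] at h3
      linarith
    obtain rfl | rfl | rfl : m = N ∨ m = N + 1 ∨ m = N + 2 := by omega
    · simp [e1]
    · simp [e1]
    · rw [e2, sub_self, mul_zero, add_zero, ← e1] at h2
      have : a < a * a ^ N := by nlinarith
      nlinarith [mul_pos hU (sub_pos.2 this)]

theorem heptagon_inter_expLattice {a : ℝ} (ha : 1 < a) (ha2 : a < 2) (hφ : a + 1 ≤ a ^ 2)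
    {N : ℕ} (hab : a < a ^ N) (hb : 1 < (2 - a) * a ^ N) :
    convexHull ℝ (heptagon a (a ^ N)) ∩ expLattice a ⊆ heptagon a (a ^ N) := by
  rintro _ ⟨hp, m, n, rfl⟩
  obtain ⟨hx, hy, hs, h1, h2, h3, h4⟩ := heptagon_edge_inequalities ha ha2 hφ hab hb hp
  dsimp only at hx hy hs h1 h2 h3 h4
  by_cases hn : N + 1 ≤ n
  · rcases mem_heptagon_of_le ha hab hn hy hx h1 h2 h3 with h | h | h | h <;>
      rw [h] <;> simp [heptagon]
  by_cases hm : N + 1 ≤ m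
  · rcases mem_heptagon_of_le ha hab hm hx hy h2 h1 h4 with h | h | h | h <;>
      rw [Prod.mk.injEq] at h <;> rw [h.1, h.2] <;> simp [heptagon]
  have hm' : a ^ m ≤ a ^ N := pow_le_pow_right₀ ha.le (by omega)
  have hn' : a ^ n ≤ a ^ N := pow_le_pow_right₀ ha.le (by omega)
  nlinarith

theorem heptagon_subset_expLattice (a : ℝ) (N : ℕ) : heptagon a (a ^ N) ⊆ expLattice a := by
  have e1 : a * a ^ N = a ^ (N + 1) := by ring
  have e2 : a ^ 2 * a ^ N = a ^ (N + 2) := by ring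
  have h (m n : ℕ) : (a ^ m, a ^ n) ∈ expLattice a := ⟨m, n, rfl⟩
  have hl (n : ℕ) : (1, a ^ n) ∈ expLattice a := by simpa using h 0 n
  have hr (n : ℕ) : (a ^ n, 1) ∈ expLattice a := by simpa using h n 0
  have hl' (n : ℕ) : (a, a ^ n) ∈ expLattice a := by simpa using h 1 n
  have hr' (n : ℕ) : (a ^ n, a) ∈ expLattice a := by simpa using h n 1
  rw [Set.subset_def, forall_mem_heptagon, e1, e2]
  exact ⟨hl _, h _ _, h _ _, hr _, hr' _, h _ _, hl' _⟩

theorem empty_heptagon (α : ℝ) (hα₁ : (1 + Real.sqrt 5) / 2 ≤ α) (hα₂ : α < 2) :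
    ∃ k : ℕ, 2 ≤ k ∧ IsEmptyPolygonIn (expLattice α) (Qset α k) ∧ (Qset α k).ncard = 7 := by
  have h5 : Real.sqrt 5 ^ 2 = 5 := Real.sq_sqrt (by norm_num)
  have h5' : 1 < Real.sqrt 5 := Real.lt_sqrt_of_sq_lt (by norm_num)
  have ha : 1 < α := by linarith
  have hφ : α + 1 ≤ α ^ 2 := by nlinarith
  obtain ⟨N, hN⟩ := pow_unbounded_of_one_lt (1 / (2 - α)) ha
  have hb : 1 < (2 - α) * α ^ N := by
    rwa [div_lt_iff₀ (by linarith), mul_comm] at hN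
  have hab : α < α ^ N := by
    by_contra! hle
    nlinarith [mul_le_mul_of_nonneg_left hle (sub_nonneg.2 hα₂.le), sq_nonneg (α - 1)]
  refine ⟨N + 2, by omega, ?_⟩
  rw [Qset_add_two]
  have hsub := heptagon_subset_expLattice α N
  exact ⟨⟨hsub, heptagon_strictConvexPos ha hα₂ hφ hab hb,
    (heptagon_inter_expLattice ha hα₂ hφ hab hb).antisymm
      (subset_inter (subset_convexHull ℝ _) hsub)⟩, ncard_heptagon ha hab⟩
end

section
/- For every real number α > 1 and every positive integer k with k ≤ √(1/(α−1)), the k-element set P(k) = {(α^i, α^{k−i}) : 1 ≤ i ≤ k} ⊆ L(α) is in strictly convex position and satisfies conv(P(k)) ∩ L(α) = P(k); in particular, h(α) ≥ ⌊√(1/(α−1))⌋. -/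
/-- The configuration `P(k)` lying on a hyperbola. -/
def Pset (α : ℝ) (k : ℕ) : Set (ℝ × ℝ) :=
  {p | ∃ i : ℕ, 1 ≤ i ∧ i ≤ k ∧ p = (α ^ i, α ^ (k - i))}

/-- A point of the open positive quadrant is not in the convex hull of other points lying on or
above the hyperbola through it. -/
theorem notMem_convexHull_of_mul_le {S : Set (ℝ × ℝ)} {a b : ℝ} (ha : 0 < a) (hb : 0 < b)
    (hS : ∀ p ∈ S, 0 < p.1 ∧ 0 < p.2 ∧ a * b ≤ p.1 * p.2 ∧ p ≠ (a, b)) :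
    (a, b) ∉ convexHull ℝ S := by
  intro h
  have hlin : IsLinearMap ℝ fun p : ℝ × ℝ => b * p.1 + a * p.2 :=
    ⟨fun p q => by simp only [Prod.fst_add, Prod.snd_add]; ring,
      fun c p => by simp only [Prod.smul_fst, Prod.smul_snd, smul_eq_mul]; ring⟩
  have hsub : S ⊆ {p : ℝ × ℝ | 2 * (a * b) < b * p.1 + a * p.2} := by
    rintro ⟨x, y⟩ hp
    obtain ⟨hx, hy, hxy, hne⟩ := hS _ hp
    simp only [Set.mem_ofPred_eq] at *
    by_contra! hle
    have hab : 0 < a * b := mul_pos ha hb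
    have hsq : (b * x + a * y) ^ 2 ≤ (2 * (a * b)) ^ 2 := by
      have : 0 ≤ b * x + a * y := by positivity
      gcongr
    have hmul : a * b * (a * b) ≤ a * b * (x * y) := by gcongr
    have hzero : b * x - a * y = 0 := by
      apply pow_eq_zero_iff two_ne_zero |>.mp
      nlinarith [sq_nonneg (b * x - a * y)]
    have hx' : x ≤ a := le_of_mul_le_mul_left (by linarith : b * x ≤ b * a) hb
    have hy' : y ≤ b := le_of_mul_le_mul_left (by linarith : a * y ≤ a * b) ha
    have hxa : x = a := by
      refine hx'.antisymm (le_of_mul_le_mul_right (hxy.trans ?_) hb)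
      gcongr
    have hyb : y = b := by
      refine hy'.antisymm (le_of_mul_le_mul_left (hxy.trans ?_) ha)
      gcongr
    exact hne (by rw [hxa, hyb])
  have := convexHull_min hsub (convex_halfSpace_gt hlin _) h
  simp only [Set.mem_ofPred_eq] at this
  linarith [mul_comm a b]

theorem pow_sub_one_le_mul_pow {α : ℝ} (hα : 1 ≤ α) (n : ℕ) :
    α ^ n - 1 ≤ n * (α - 1) * α ^ n := by
  induction n with
  | zero => simp
  | succ n ih =>
    have h1 : α ^ n ≤ α ^ (n + 1) := pow_le_pow_right₀ hα n.le_succ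
    have h2 : ((n : ℝ) + 1) * (α - 1) * α ^ n ≤ (n + 1) * (α - 1) * α ^ (n + 1) := by
      have : 0 ≤ α - 1 := by linarith
      gcongr
    push_cast
    rw [pow_succ] at h2 ⊢
    linarith

theorem sq_pow_add_one_lt {α : ℝ} (hα : 1 < α) {n : ℕ}
    (hn : ((n : ℝ) + 1) ^ 2 * (α - 1) ≤ 1) : (α ^ n + 1) ^ 2 < 4 * (α * α ^ n) := by
  have hε : 0 < α - 1 := by linarith
  have hu : 1 ≤ α ^ n := one_le_pow₀ hα.le
  have h1 := pow_sub_one_le_mul_pow hα.le n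
  have hn0 : (0 : ℝ) ≤ n := n.cast_nonneg
  have hnε : n * (α - 1) ≤ 1 / 4 := by nlinarith [mul_nonneg (sq_nonneg ((n : ℝ) - 1)) hε.le]
  have hu' : α ^ n ≤ 4 / 3 := by nlinarith
  have hn2 : (n : ℝ) ^ 2 * (α - 1) ≤ 1 := by nlinarith
  have hsq : (α ^ n - 1) ^ 2 ≤ (n * (α - 1) * α ^ n) ^ 2 := by
    have : 0 ≤ α ^ n - 1 := by linarith
    gcongr
  have hfac : (n * (α - 1) * α ^ n) ^ 2 = (n ^ 2 * (α - 1)) * ((α - 1) * α ^ n * α ^ n) := by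
    ring
  have hpos : 0 < (α - 1) * α ^ n := by positivity
  have hbound : (n ^ 2 * (α - 1)) * ((α - 1) * α ^ n * α ^ n) ≤
      1 * ((α - 1) * α ^ n * (4 / 3)) := by
    gcongr
  nlinarith

/-- The points of `Pset α k` lie on or below the line through its two extreme points. -/
theorem convexHull_Pset_subset {α : ℝ} (hα : 1 < α) (k : ℕ) :
    convexHull ℝ (Pset α k) ⊆ {p : ℝ × ℝ | p.1 + α * p.2 ≤ α ^ k + α} := by
  have hlin : IsLinearMap ℝ fun p : ℝ × ℝ => p.1 + α * p.2 :=
    ⟨fun p q => by simp only [Prod.fst_add, Prod.snd_add]; ring,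
      fun c p => by simp only [Prod.smul_fst, Prod.smul_snd, smul_eq_mul]; ring⟩
  refine convexHull_min ?_ (convex_halfSpace_le hlin _)
  rintro _ ⟨i, hi, hik, rfl⟩
  obtain ⟨a, rfl⟩ := Nat.exists_eq_add_of_le hi
  obtain ⟨b, rfl⟩ := Nat.exists_eq_add_of_le hik
  have ha : 0 ≤ α ^ a - 1 := sub_nonneg.2 (one_le_pow₀ hα.le)
  have hb : 0 ≤ α ^ b - 1 := sub_nonneg.2 (one_le_pow₀ hα.le)
  have h : 0 ≤ α * ((α ^ a - 1) * (α ^ b - 1)) := by positivity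
  simp only [Set.mem_ofPred_eq, Nat.add_sub_cancel_left, pow_add, pow_one]
  linarith

theorem Pset_eq_image (α : ℝ) (k : ℕ) :
    Pset α k = (fun i : ℕ => (α ^ i, α ^ (k - i))) '' (Finset.Icc 1 k : Finset ℕ) := by
  ext p
  simp only [Pset, Set.mem_ofPred_eq, Set.mem_image, Finset.coe_Icc, Set.mem_Icc, and_assoc,
    eq_comm]

theorem ncard_Pset {α : ℝ} (hα : 1 < α) (k : ℕ) : (Pset α k).ncard = k := by
  rw [Pset_eq_image, Set.ncard_image_of_injective, Set.ncard_coe_finset, Nat.card_Icc,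
    Nat.add_sub_cancel]
  intro i j hij
  exact pow_right_injective₀ (by linarith) hα.ne' (Prod.ext_iff.1 hij).1

theorem Pset_pos_and_mul_eq {α : ℝ} (hα : 0 < α) {k : ℕ} {p : ℝ × ℝ} (hp : p ∈ Pset α k) :
    0 < p.1 ∧ 0 < p.2 ∧ p.1 * p.2 = α ^ k := by
  obtain ⟨i, -, hik, rfl⟩ := hp
  exact ⟨by positivity, by positivity, by rw [← pow_add, Nat.add_sub_cancel' hik]⟩

theorem strictConvexPos_Pset {α : ℝ} (hα : 0 < α) (k : ℕ) : StrictConvexPos (Pset α k) := by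
  rintro ⟨a, b⟩ hx
  obtain ⟨ha, hb, hab⟩ := Pset_pos_and_mul_eq hα hx
  refine notMem_convexHull_of_mul_le ha hb fun p hp => ?_
  obtain ⟨h1, h2, h3⟩ := Pset_pos_and_mul_eq hα hp.1
  exact ⟨h1, h2, (hab.trans h3.symm).le, hp.2⟩

theorem empty_polygon_on_hyperbola (α : ℝ) (hα : 1 < α) (k : ℕ) (hk : 0 < k)
    (hk' : (k : ℝ) ≤ Real.sqrt (1 / (α - 1))) :
    IsEmptyPolygonIn (expLattice α) (Pset α k) ∧ (Pset α k).ncard = k := by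
  have hα0 : 0 < α := by linarith
  have hsub : Pset α k ⊆ expLattice α := by
    rintro _ ⟨i, -, -, rfl⟩
    exact ⟨i, k - i, rfl⟩
  refine ⟨⟨hsub, strictConvexPos_Pset hα0 k, ?_⟩, ncard_Pset hα k⟩
  refine Set.Subset.antisymm ?_ (Set.subset_inter (subset_convexHull ℝ _) hsub)
  rintro _ ⟨hp, m, n, rfl⟩
  by_contra hnot
  rcases le_or_gt (m + n) k with hmn | hmn
  · refine notMem_convexHull_of_mul_le (by positivity) (by positivity) (fun p hp' => ?_) hp
    obtain ⟨h1, h2, h3⟩ := Pset_pos_and_mul_eq hα0 hp'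
    refine ⟨h1, h2, ?_, fun h => hnot (h ▸ hp')⟩
    rw [h3, ← pow_add]
    exact pow_le_pow_right₀ hα.le hmn
  · have hline : α ^ m + α * α ^ n ≤ α ^ k + α := convexHull_Pset_subset hα k hp
    obtain ⟨l, rfl⟩ := Nat.exists_eq_add_of_lt hk
    rw [zero_add] at hline hk' hmn
    have hε : 0 < α - 1 := by linarith
    have hl : ((l : ℝ) + 1) ^ 2 * (α - 1) ≤ 1 := by
      rw [← le_div_iff₀ hε]
      exact Real.le_sqrt' (by positivity) |>.1 (by exact_mod_cast hk')
    have hlt := mul_lt_mul_of_pos_left (sq_pow_add_one_lt hα hl) (pow_pos hα0 2)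
    have hsq : (α ^ m + α * α ^ n) ^ 2 ≤ (α ^ (l + 1) + α) ^ 2 := by gcongr
    have hpow : α ^ (l + 2) ≤ α ^ (m + n) := pow_le_pow_right₀ hα.le hmn
    have hpow' := mul_le_mul_of_nonneg_left hpow hα0.le
    rw [pow_add, pow_add] at hpow'
    rw [pow_succ α l] at hsq
    nlinarith [sq_nonneg (α ^ m - α * α ^ n)]
end

section
/- For every real number α ≥ 2, h(α) = 5: there exists a 5-element subset X of L(α) in strictly convex position with conv(X) ∩ L(α) = X, and every finite subset of L(α) in strictly convex position whose convex hull meets L(α) only in that subset has at most 5 elements. -/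
namespace ExpLattice

/-- The point of the exponential lattice with a given pair of exponents. -/
def expPoint (α : ℝ) (p : ℕ × ℕ) : ℝ × ℝ := (α ^ p.1, α ^ p.2)

/-- Twice the signed area of the triangle `uvw`. -/
def orient (u v w : ℝ × ℝ) : ℝ :=
  (v.1 - u.1) * (w.2 - u.2) - (v.2 - u.2) * (w.1 - u.1)

/-- A set of exponent pairs such that no triangle spanned by the corresponding lattice points
contains a lattice point other than its vertices. -/
def EmptyTriangles (α : ℝ) (E : Set (ℕ × ℕ)) : Prop :=
  ∀ p ∈ E, ∀ q ∈ E, ∀ r ∈ E, ∀ w : ℕ × ℕ,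
    expPoint α w ∈ convexHull ℝ {expPoint α p, expPoint α q, expPoint α r} →
      w = p ∨ w = q ∨ w = r

lemma expPoint_injective {α : ℝ} (hα : 1 < α) : Function.Injective (expPoint α) := by
  intro p q h
  have h1 : α ^ p.1 = α ^ q.1 := congrArg Prod.fst h
  have h2 : α ^ p.2 = α ^ q.2 := congrArg Prod.snd h
  exact Prod.ext (pow_right_injective₀ (by linarith) hα.ne' h1)
    (pow_right_injective₀ (by linarith) hα.ne' h2)

lemma mem_convexHull_triple {u v w x : ℝ × ℝ} (a b c : ℝ) (ha : 0 ≤ a) (hb : 0 ≤ b)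
    (hc : 0 ≤ c) (habc : a + b + c = 1) (h : a • u + b • v + c • w = x) :
    x ∈ convexHull ℝ {u, v, w} := by
  have hconv := convex_convexHull ℝ ({u, v, w} : Set (ℝ × ℝ))
  have hsub := subset_convexHull ℝ ({u, v, w} : Set (ℝ × ℝ))
  have hu : u ∈ convexHull ℝ ({u, v, w} : Set (ℝ × ℝ)) := hsub (by simp)
  have hv : v ∈ convexHull ℝ ({u, v, w} : Set (ℝ × ℝ)) := hsub (by simp)
  have hw : w ∈ convexHull ℝ ({u, v, w} : Set (ℝ × ℝ)) := hsub (by simp)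
  have key := hconv.sum_mem (t := Finset.univ) (w := ![a, b, c]) (z := ![u, v, w])
    (by intro i _; fin_cases i <;> simpa) (by simpa [Fin.sum_univ_three] using habc)
    (by intro i _; fin_cases i <;> simpa)
  rw [← h]
  simpa [Fin.sum_univ_three] using key

lemma mem_convexHull_of_orient {u v w x : ℝ × ℝ} (h1 : 0 ≤ orient u v x)
    (h2 : 0 ≤ orient v w x) (h3 : 0 ≤ orient w u x)
    (hpos : 0 < orient u v x + orient v w x + orient w u x) :
    x ∈ convexHull ℝ {u, v, w} := by
  set S := orient u v x + orient v w x + orient w u x with hS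
  refine mem_convexHull_triple (orient v w x / S) (orient w u x / S) (orient u v x / S)
    (by positivity) (by positivity) (by positivity) ?_ ?_
  · field_simp
    rw [hS]; ring
  · ext
    · simp only [Prod.fst_add, Prod.smul_fst, smul_eq_mul]
      field_simp
      simp only [hS, orient]; ring
    · simp only [Prod.snd_add, Prod.smul_snd, smul_eq_mul]
      field_simp
      simp only [hS, orient]; ring

/-- A point of the cone at `u` spanned by `v` and `w` lies in the triangle `uvw` if it is
lower than both `v` and `w`. -/
lemma mem_convexHull_of_cone {u v w x : ℝ × ℝ} (h1 : 0 < orient u v x)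
    (h2 : 0 < orient w u x) (hx : u.2 < x.2) (hv : x.2 ≤ v.2) (hw : x.2 ≤ w.2) :
    x ∈ convexHull ℝ {u, v, w} := by
  have hid : (x.2 - u.2) * orient v w x
      = orient u v x * (w.2 - x.2) + orient w u x * (v.2 - x.2) := by
    simp only [orient]; ring
  have h3 : 0 ≤ orient v w x := by
    have : 0 ≤ (x.2 - u.2) * orient v w x := by
      rw [hid]
      exact add_nonneg (mul_nonneg h1.le (by linarith)) (mul_nonneg h2.le (by linarith))
    exact nonneg_of_mul_nonneg_right this (by linarith)
  exact mem_convexHull_of_orient h1.le h3 h2.le (by linarith)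

lemma mem_convexHull_of_between {u v x : ℝ × ℝ} (hcol : orient u v x = 0)
    (h1 : u.1 ≤ x.1) (h2 : x.1 ≤ v.1) (h : u.1 < v.1) :
    x ∈ convexHull ℝ {u, v, v} := by
  have hne : 0 < v.1 - u.1 := by linarith
  refine mem_convexHull_triple ((v.1 - x.1) / (v.1 - u.1)) ((x.1 - u.1) / (v.1 - u.1)) 0
    (div_nonneg (by linarith) hne.le) (div_nonneg (by linarith) hne.le) le_rfl ?_ ?_
  · field_simp
    ring
  · simp only [orient] at hcol
    ext
    · simp only [Prod.fst_add, Prod.smul_fst, smul_eq_mul]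
      field_simp
      ring
    · simp only [Prod.snd_add, Prod.smul_snd, smul_eq_mul]
      field_simp
      linarith

lemma EmptyTriangles.swap {α : ℝ} {E : Set (ℕ × ℕ)} (hE : EmptyTriangles α E) :
    EmptyTriangles α (Prod.swap ⁻¹' E) := by
  intro p hp q hq r hr w hw
  have := hE p.swap hp q.swap hq r.swap hr w.swap (by
    have himg := (LinearMap.isLinear (LinearEquiv.prodComm ℝ ℝ ℝ).toLinearMap).image_convexHull
      ({expPoint α p, expPoint α q, expPoint α r} : Set (ℝ × ℝ))
    have h := Set.mem_image_of_mem (LinearEquiv.prodComm ℝ ℝ ℝ).toLinearMap hw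
    rw [himg] at h
    simpa [Set.image_insert_eq, expPoint] using h)
  simpa [Prod.swap_inj] using this

section Orientation

variable {α : ℝ} {a b c d x y : ℕ}

lemma orient_expPoint_swap :
    orient (expPoint α (b, a)) (expPoint α (d, c)) (expPoint α (y, x))
      = -orient (expPoint α (a, b)) (expPoint α (c, d)) (expPoint α (x, y)) := by
  simp only [orient, expPoint]
  ring

/-- A segment of logarithmic slope less than one passes above the lattice points on or below the
diagonal through its upper end. -/
lemma orient_neg_of_diag_le (hα : 2 ≤ α) (hflat : a + d < c + b) (hy : b ≤ y) (hyd : y < d)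
    (hx : c + y ≤ x + d) :
    orient (expPoint α (a, b)) (expPoint α (c, d)) (expPoint α (x, y)) < 0 := by
  obtain ⟨t, rfl⟩ := Nat.exists_eq_add_of_lt hyd
  have hα1 : (1 : ℝ) < α := by linarith
  have hT : 1 < α ^ (t + 1) := one_lt_pow₀ hα1 (by omega)
  have hX : α ^ c ≤ α ^ x * α ^ (t + 1) := by
    rw [← pow_add]
    exact pow_le_pow_right₀ hα1.le (by omega)
  have hBC : α ^ a * (α ^ y * α ^ (t + 1)) < α ^ c * α ^ b := by
    rw [← pow_add, ← pow_add, ← pow_add]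
    exact pow_lt_pow_right₀ hα1 (by omega)
  have hB : α ^ b ≤ α ^ y := pow_le_pow_right₀ hα1.le hy
  have hD : α ^ y ≤ α ^ y * α ^ (t + 1) := le_mul_of_one_le_right (by positivity) hT.le
  simp only [orient, expPoint, add_assoc, pow_add α y]
  generalize α ^ (t + 1) = T at *
  generalize α ^ a = A at *
  generalize α ^ b = B at *
  generalize α ^ c = C at *
  generalize α ^ y = Y at *
  generalize α ^ x = X at *
  have h1 := mul_nonneg (sub_nonneg.2 (hB.trans hD)) (sub_nonneg.2 hX)
  have h2 := mul_pos (sub_pos.2 hT) (sub_pos.2 hBC)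
  have : T * ((C - A) * (Y - B) - (Y * T - B) * (X - A)) < 0 := by nlinarith
  exact neg_of_mul_neg_right this (by linarith)

/-- A segment of logarithmic slope less than one passes below the lattice points above the
diagonal through its upper end. -/
lemma orient_pos_of_lt_diag (hα : 2 ≤ α) (hy : b < y) (hyd : y < d) (hx : x + d < c + y) :
    0 < orient (expPoint α (a, b)) (expPoint α (c, d)) (expPoint α (x, y)) := by
  obtain ⟨t, rfl⟩ := Nat.exists_eq_add_of_lt hyd
  have hα1 : (1 : ℝ) < α := by linarith
  have hT : 1 < α ^ (t + 1) := one_lt_pow₀ hα1 (by omega)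
  have hX : α * (α ^ x * α ^ (t + 1)) ≤ α ^ c := by
    rw [← pow_add, ← pow_succ']
    exact pow_le_pow_right₀ hα1.le (by omega)
  have hB : α * α ^ b ≤ α ^ y := by
    rw [← pow_succ']
    exact pow_le_pow_right₀ hα1.le (by omega)
  have hA0 : 0 < α ^ a := by positivity
  have hB0 : 0 < α ^ b := by positivity
  have hC0 : 0 < α ^ c := by positivity
  have hY0 : 0 < α ^ y := by positivity
  simp only [orient, expPoint, add_assoc, pow_add α y]
  generalize α ^ (t + 1) = T at *
  generalize α ^ a = A at *
  generalize α ^ b = B at *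
  generalize α ^ c = C at *
  generalize α ^ y = Y at *
  generalize α ^ x = X at *
  have hBT : α * B * T ≤ Y * T := mul_le_mul_of_nonneg_right hB (by linarith)
  have hYT : Y ≤ Y * T := le_mul_of_one_le_right hY0.le hT.le
  have hBY : B ≤ Y * T := by nlinarith
  have h1 := mul_nonneg (sub_nonneg.2 hBY) (sub_nonneg.2 hX)
  have h2 := mul_nonneg hC0.le (sub_nonneg.2 hBT)
  have h3 : 0 < α * A * (Y * T) * (T - 1) := by
    have : 0 < T - 1 := by linarith
    positivity
  have h4 : 0 ≤ (α - 2) * (C * (Y * T)) := mul_nonneg (by linarith) (by positivity)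
  have h5 : 0 < B * C := by positivity
  have : 0 < α * T * ((C - A) * (Y - B) - (Y * T - B) * (X - A)) := by
    nlinarith only [h1, h2, h3, h4, h5]
  exact pos_of_mul_pos_right this (by positivity)

end Orientation

section EmptyTriangles

variable {α : ℝ} {E : Set (ℕ × ℕ)} {a b c d e f x y : ℕ}

lemma EmptyTriangles.row (hα : 2 ≤ α) (hE : EmptyTriangles α E) (hp : (a, b) ∈ E)
    (hq : (c, b) ∈ E) (hac : a < c) : c = a + 1 := by
  have hα1 : (1 : ℝ) < α := by linarith
  have := hE _ hp _ hq _ hq (a + 1, b) (mem_convexHull_of_between (by simp [orient, expPoint])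
    (pow_le_pow_right₀ hα1.le (by simp)) (pow_le_pow_right₀ hα1.le hac)
    (pow_lt_pow_right₀ hα1 hac))
  simp only [Prod.mk.injEq] at this
  omega

lemma EmptyTriangles.col (hα : 2 ≤ α) (hE : EmptyTriangles α E) (hp : (a, b) ∈ E)
    (hq : (a, d) ∈ E) (hbd : b < d) : d = b + 1 :=
  hE.swap.row hα (a := b) (b := a) (c := d) hp hq hbd

lemma EmptyTriangles.diag (hα : 2 ≤ α) (hE : EmptyTriangles α E) (hp : (a, b) ∈ E)
    (hq : (c, d) ∈ E) (hac : a < c) (h : a + d = c + b) : c = a + 1 := by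
  have hα1 : (1 : ℝ) < α := by linarith
  obtain ⟨k, rfl⟩ := Nat.exists_eq_add_of_lt hac
  obtain rfl : d = b + k + 1 := by omega
  have := hE _ hp _ hq _ hq (a + 1, b + 1) (mem_convexHull_of_between
    (by simp only [orient, expPoint]; ring)
    (pow_le_pow_right₀ hα1.le (by simp)) (pow_le_pow_right₀ hα1.le hac)
    (pow_lt_pow_right₀ hα1 hac))
  simp only [Prod.mk.injEq] at this
  omega

lemma EmptyTriangles.antitone (hα : 2 ≤ α) (hE : EmptyTriangles α E) (hp : (a, b) ∈ E)
    (hq : (c, d) ∈ E) (hr : (e, f) ∈ E) (hac : a < c) (hdb : d < b) (hec : e < c)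
    (hfb : f < b) : e + 1 = c ∧ f + 1 = b := by
  have hα1 : (1 : ℝ) < α := by linarith
  obtain ⟨c, rfl⟩ : ∃ k, c = k + 1 := ⟨c - 1, by omega⟩
  obtain ⟨b, rfl⟩ : ∃ k, b = k + 1 := ⟨b - 1, by omega⟩
  have hmem : expPoint α (c, b) ∈ convexHull ℝ
      {expPoint α (e, f), expPoint α (c + 1, d), expPoint α (a, b + 1)} := by
    have hA : α ^ a ≤ α ^ c := pow_le_pow_right₀ hα1.le (by omega)
    have hE : α ^ e ≤ α ^ c := pow_le_pow_right₀ hα1.le (by omega)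
    have hD : α ^ d ≤ α ^ b := pow_le_pow_right₀ hα1.le (by omega)
    have hF : α ^ f ≤ α ^ b := pow_le_pow_right₀ hα1.le (by omega)
    have hC : 2 * α ^ c ≤ α ^ (c + 1) := by
      rw [pow_succ']
      exact mul_le_mul_of_nonneg_right hα (by positivity)
    have hB : 2 * α ^ b ≤ α ^ (b + 1) := by
      rw [pow_succ']
      exact mul_le_mul_of_nonneg_right hα (by positivity)
    have hA0 : 0 < α ^ a := by positivity
    have hB0 : 0 < α ^ b := by positivity
    have hC0 : 0 < α ^ c := by positivity
    have hD0 : 0 < α ^ d := by positivity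
    have h1 : 0 ≤ orient (expPoint α (e, f)) (expPoint α (c + 1, d)) (expPoint α (c, b)) := by
      simp only [orient, expPoint]
      nlinarith [mul_nonneg (sub_nonneg.2 hE) (sub_nonneg.2 hD),
        mul_nonneg (sub_nonneg.2 hF) (sub_nonneg.2 hC), mul_nonneg (sub_nonneg.2 hF) hC0.le]
    have h2 : 0 < orient (expPoint α (c + 1, d)) (expPoint α (a, b + 1)) (expPoint α (c, b)) := by
      simp only [orient, expPoint]
      nlinarith [mul_nonneg (sub_nonneg.2 hC) (sub_nonneg.2 hB), mul_pos hB0 hA0, mul_pos hC0 hD0,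
        mul_nonneg (sub_nonneg.2 hC) hB0.le, mul_nonneg hC0.le (sub_nonneg.2 hB),
        mul_nonneg (sub_nonneg.2 hA) hD0.le]
    have h3 : 0 ≤ orient (expPoint α (a, b + 1)) (expPoint α (e, f)) (expPoint α (c, b)) := by
      simp only [orient, expPoint]
      nlinarith [mul_nonneg (sub_nonneg.2 hA) (sub_nonneg.2 hF),
        mul_nonneg (sub_nonneg.2 hE) (sub_nonneg.2 hB), mul_nonneg (sub_nonneg.2 hE) hB0.le]
    exact mem_convexHull_of_orient h1 h2.le h3 (by linarith)
  have := hE _ hr _ hq _ hp _ hmem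
  simp only [Prod.mk.injEq] at this
  omega

lemma EmptyTriangles.not_flat_and_steep (hα : 2 ≤ α) (hE : EmptyTriangles α E)
    (hp : (a, b) ∈ E) (hq : (e, f) ∈ E) (hr : (c, d) ∈ E) (hbd : b < d) (hec : e < c)
    (hflat : a + d < c + b) (hsteep : c + f < e + d) : False := by
  have hα1 : (1 : ℝ) < α := by linarith
  obtain ⟨c, rfl⟩ : ∃ k, c = k + 1 := ⟨c - 1, by omega⟩
  obtain ⟨d, rfl⟩ : ∃ k, d = k + 1 := ⟨d - 1, by omega⟩
  have h1 : 0 ≤ orient (expPoint α (a, b)) (expPoint α (e, f)) (expPoint α (c, d)) := by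
    by_cases hfb : b < f
    · have := orient_neg_of_diag_le (a := a) (b := b) (c := c) (d := d) (x := e) (y := f) hα
        (by omega) (by omega) (by omega) (by omega)
      simp only [orient] at this ⊢
      linarith
    by_cases hea : e < a
    · have := orient_neg_of_diag_le (a := f) (b := e) (c := d) (d := c) (x := b) (y := a) hα
        (by omega) (by omega) (by omega) (by omega)
      rw [orient_expPoint_swap] at this
      simp only [orient] at this ⊢
      linarith
    · have hA : α ^ a ≤ α ^ e := pow_le_pow_right₀ hα1.le (by omega)
      have hF : α ^ f ≤ α ^ b := pow_le_pow_right₀ hα1.le (by omega)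
      have hB : α ^ b ≤ α ^ d := pow_le_pow_right₀ hα1.le (by omega)
      have hC : α ^ a ≤ α ^ c := pow_le_pow_right₀ hα1.le (by omega)
      simp only [orient, expPoint]
      nlinarith [mul_nonneg (sub_nonneg.2 hA) (sub_nonneg.2 hB),
        mul_nonneg (sub_nonneg.2 hF) (sub_nonneg.2 hC)]
  have h2 : 0 < orient (expPoint α (e, f)) (expPoint α (c + 1, d + 1)) (expPoint α (c, d)) := by
    have := orient_neg_of_diag_le (a := f) (b := e) (c := d + 1) (d := c + 1) (x := d) (y := c) hα
      (by omega) (by omega) (by omega) (by omega)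
    rw [orient_expPoint_swap] at this
    linarith
  have h3 : 0 < orient (expPoint α (c + 1, d + 1)) (expPoint α (a, b)) (expPoint α (c, d)) := by
    have := orient_neg_of_diag_le (a := a) (b := b) (c := c + 1) (d := d + 1) (x := c) (y := d) hα
      (by omega) (by omega) (by omega) (by omega)
    simp only [orient] at this ⊢
    linarith
  have := hE _ hp _ hq _ hr _ (mem_convexHull_of_orient h1 h2.le h3.le (by linarith))
  simp only [Prod.mk.injEq] at this
  omega

lemma EmptyTriangles.flat_row (hα : 2 ≤ α) (hE : EmptyTriangles α E)
    (hp : (a, b) ∈ E) (hq : (x, y) ∈ E) (hr : (c, d) ∈ E)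
    (hby : b < y) (hyd : y < d) (hx : x + d < c + y) :
    x + d + 1 = c + y := by
  have hα1 : (1 : ℝ) < α := by linarith
  by_contra hne
  obtain ⟨k, hk⟩ : ∃ k, k + d + 1 = c + y := ⟨c + y - d - 1, by omega⟩
  have hXK : α ^ x ≤ α ^ k := pow_le_pow_right₀ hα1.le (by omega)
  have hBY : α ^ b ≤ α ^ y := pow_le_pow_right₀ hα1.le (by omega)
  have hYD : α ^ y ≤ α ^ d := pow_le_pow_right₀ hα1.le (by omega)
  have h1 : 0 ≤ orient (expPoint α (x, y)) (expPoint α (a, b)) (expPoint α (k, y)) := by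
    simp only [orient, expPoint]
    nlinarith [mul_nonneg (sub_nonneg.2 hXK) (sub_nonneg.2 hBY)]
  have h2 : 0 < orient (expPoint α (a, b)) (expPoint α (c, d)) (expPoint α (k, y)) :=
    orient_pos_of_lt_diag hα hby hyd (by omega)
  have h3 : 0 ≤ orient (expPoint α (c, d)) (expPoint α (x, y)) (expPoint α (k, y)) := by
    simp only [orient, expPoint]
    nlinarith [mul_nonneg (sub_nonneg.2 hXK) (sub_nonneg.2 hYD)]
  have := hE _ hq _ hp _ hr _ (mem_convexHull_of_orient h1 h2.le h3 (by linarith))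
  simp only [Prod.mk.injEq] at this
  omega

lemma EmptyTriangles.flat_pair (hα : 2 ≤ α) (hE : EmptyTriangles α E)
    (hp : (a, b) ∈ E) (hq : (x, y) ∈ E) (hr : (c, d) ∈ E)
    (hd : b + 2 ≤ d) (hy : b + 2 ≤ y) (hflat : a + y < x + b) (h : x + d < c + y) : False := by
  have hα1 : (1 : ℝ) < α := by linarith
  obtain ⟨k, hk⟩ : ∃ k, k + d = c + b := ⟨c + b - d, by omega⟩
  have h1 : 0 < orient (expPoint α (a, b)) (expPoint α (c, d)) (expPoint α (k, b + 1)) :=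
    orient_pos_of_lt_diag hα (by omega) (by omega) (by omega)
  have h2 : 0 < orient (expPoint α (x, y)) (expPoint α (a, b)) (expPoint α (k, b + 1)) := by
    have := orient_neg_of_diag_le (a := a) (b := b) (c := x) (d := y) (x := k) (y := b + 1) hα
      (by omega) (by omega) (by omega) (by omega)
    simp only [orient] at this ⊢
    linarith
  have := hE _ hp _ hr _ hq _ (mem_convexHull_of_cone h1 h2 (pow_lt_pow_right₀ hα1 (by simp))
    (pow_le_pow_right₀ hα1.le (by simp; omega)) (pow_le_pow_right₀ hα1.le (by simp; omega)))
  simp only [Prod.mk.injEq] at this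
  omega

end EmptyTriangles

section Counting

variable {α : ℝ} {E : Finset (ℕ × ℕ)} {c d : ℕ}

/-- If the top right corner of the bounding box belongs to the set and no point sees it along a
segment of logarithmic slope greater than one, then the set has at most five points. -/
lemma card_le_five_of_flat_corner (hα : 2 ≤ α) (hE : EmptyTriangles α E) (hr : (c, d) ∈ E)
    (hc : ∀ x y, (x, y) ∈ E → x ≤ c) (hd : ∀ x y, (x, y) ∈ E → y ≤ d)
    (hflat : ∀ x y, (x, y) ∈ E → x < c → y < d → x + d ≤ c + y) : E.card ≤ 5 := by
  have hdiag : ∀ x y, (x, y) ∈ E → x < c → x + d = c + y → x + 1 = c :=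
    fun x y h hx he => (hE.diag hα h hr hx he).symm
  have hside : ∀ z ∈ E, z = (c, d) ∨ z = (c - 1, d) ∨ z = (c, d - 1) ∨ z = (c - 1, d - 1) ∨
      (z.2 < d ∧ z.1 + d < c + z.2) := by
    rintro ⟨x, y⟩ h
    rcases (hc x y h).eq_or_lt with rfl | hx <;> rcases (hd x y h).eq_or_lt with rfl | hy
    · simp
    · have := hE.col hα h hr hy
      simp [this]
    · have := hE.row hα h hr hx
      simp [this]
    · have h1 := hflat x y h hx hy
      have h2 := hdiag x y h hx
      simp only [Prod.mk.injEq]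
      omega
  by_cases hF : ∃ p ∈ E, p.2 < d ∧ p.1 + d < c + p.2
  swap
  · have hsub : E ⊆ {(c, d), (c - 1, d), (c, d - 1), (c - 1, d - 1)} := by
      intro z h
      rcases hside z h with rfl | rfl | rfl | rfl | h'
      iterate 4 simp
      exact (hF ⟨z, h, h'⟩).elim
    exact (Finset.card_le_card hsub).trans (Finset.card_le_four.trans (by norm_num))
  obtain ⟨p, hp, hmin⟩ := (E.filter fun p => p.2 < d ∧ p.1 + d < c + p.2).exists_min_image
    (fun p => toLex (p.2, p.1)) (by obtain ⟨p, h⟩ := hF; exact ⟨p, Finset.mem_filter.2 h⟩)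
  clear hF
  obtain ⟨a, b⟩ := p
  obtain ⟨hp, hbd, hab⟩ := Finset.mem_filter.1 hp
  replace hmin : ∀ x y, (x, y) ∈ E → y < d → x + d < c + y → b < y ∨ b = y ∧ a ≤ x := by
    intro x y h hy hx
    have := hmin (x, y) (Finset.mem_filter.2 ⟨h, hy, hx⟩)
    simpa [Prod.Lex.toLex_le_toLex] using this
  dsimp only at hbd hab
  have hcorner : (c - 1, d) ∈ E → (c, d - 1) ∉ E := by
    intro h1 h2
    have := hE.antitone hα h1 h2 hp (by omega) (by omega) (by omega) hbd
    omega
  have hbase : ∀ x, (x, b) ∈ E → x = a ∨ x = a + 1 := by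
    intro x h
    have h1 := hE.row hα hp h
    have h2 := hmin x b h hbd
    omega
  have hall : ∀ z ∈ E, z = (c, d) ∨ z = (c - 1, d) ∨ z = (c, d - 1) ∨ z = (c - 1, d - 1) ∨
      z = (a, b) ∨ z = (a + 1, b) ∨ z = (c + b - d, b + 1) := by
    rintro ⟨x, y⟩ h
    rcases hside _ h with h' | h' | h' | h' | ⟨hy, hx⟩
    iterate 4 simp [h']
    dsimp only at hy hx
    rcases (show b ≤ y by have := hmin x y h hy hx; omega).eq_or_lt with rfl | hby
    · rcases hbase x h with rfl | rfl <;> simp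
    have h1 := hE.flat_row hα hp h hr hby hy hx
    have h2 := hE.diag hα hp h
    have h3 : y < b + 2 ∨ x + b ≤ a + y := by
      by_contra! h3
      exact hE.flat_pair hα hp h hr (by omega) h3.1 h3.2 hx
    obtain rfl : y = b + 1 := by omega
    obtain rfl : x = c + b - d := by omega
    simp
  clear hside
  by_cases hbd' : d = b + 1
  · subst hbd'
    have hsub : E ⊆ {(c, b + 1), (c - 1, b + 1), (c, b), (a, b), (a + 1, b)} := by
      intro z h
      rcases hall z h with rfl | rfl | rfl | rfl | rfl | rfl | rfl
      iterate 3 simp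
      · rcases hbase _ h with h | h <;> simp [h]
      iterate 2 simp
      simp [show c + b - (b + 1) = c - 1 by omega]
    exact (Finset.card_le_card hsub).trans Finset.card_le_five
  by_cases hp' : (a + 1, b) ∈ E
  · have hab' : a + 1 + d < c + b := by
      have h1 := hdiag (a + 1) b hp'
      omega
    have hl : (c - 1, d) ∉ E := fun h =>
      hE.flat_pair hα hp h hr (by omega) (by omega) (by omega) (by omega)
    by_cases hr' : (c, d - 1) ∈ E
    · obtain rfl : d = b + 2 := by
        by_contra hne
        exact hE.flat_pair hα hp hr hr' (by omega) (by omega) (by omega) (by omega)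
      have hq : (c + b - (b + 2), b + 1) ∉ E := fun h => by
        have := hE.row hα h hr' (by omega)
        omega
      have hsub : E ⊆ {(c, b + 2), (c, b + 1), (c - 1, b + 1), (a, b), (a + 1, b)} := by
        intro z h
        rcases hall z h with rfl | rfl | rfl | rfl | rfl | rfl | rfl <;>
          first
            | exact absurd h ‹_›
            | simp
      exact (Finset.card_le_card hsub).trans Finset.card_le_five
    · have hsub : E ⊆ {(c, d), (c - 1, d - 1), (a, b), (a + 1, b), (c + b - d, b + 1)} := by
        intro z h
        rcases hall z h with rfl | rfl | rfl | rfl | rfl | rfl | rfl <;>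
          first
            | exact absurd h ‹_›
            | simp
      exact (Finset.card_le_card hsub).trans Finset.card_le_five
  · have hsub : ∃ s, E ⊆ {s, (c, d), (c - 1, d - 1), (a, b), (c + b - d, b + 1)} := by
      by_cases hl : (c - 1, d) ∈ E
      · have hr' := hcorner hl
        refine ⟨(c - 1, d), fun z h => ?_⟩
        rcases hall z h with rfl | rfl | rfl | rfl | rfl | rfl | rfl <;>
          first
            | exact absurd h ‹_›
            | simp
      · refine ⟨(c, d - 1), fun z h => ?_⟩
        rcases hall z h with rfl | rfl | rfl | rfl | rfl | rfl | rfl <;>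
          first
            | exact absurd h ‹_›
            | simp
    obtain ⟨s, hsub⟩ := hsub
    exact (Finset.card_le_card hsub).trans Finset.card_le_five

lemma card_le_five (hα : 2 ≤ α) (hE : EmptyTriangles α E) : E.card ≤ 5 := by
  rcases E.eq_empty_or_nonempty with rfl | hne
  · simp
  obtain ⟨⟨c, f⟩, hq, hc⟩ := E.exists_max_image Prod.fst hne
  obtain ⟨⟨a, d⟩, hp, hd⟩ := E.exists_max_image Prod.snd hne
  replace hc : ∀ x y, (x, y) ∈ E → x ≤ c := fun x y h => hc _ h
  replace hd : ∀ x y, (x, y) ∈ E → y ≤ d := fun x y h => hd _ h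
  by_cases hr : (c, d) ∈ E
  · by_cases hflat : ∀ x y, (x, y) ∈ E → x < c → y < d → x + d ≤ c + y
    · exact card_le_five_of_flat_corner hα hE hr hc hd hflat
    · push Not at hflat
      obtain ⟨e, f, hs, hec, hfd, hst⟩ := hflat
      have hmem : ∀ x y, (x, y) ∈ E.map (Equiv.prodComm ℕ ℕ).toEmbedding ↔ (y, x) ∈ E := by
        intro x y
        simp
      rw [← Finset.card_map (Equiv.prodComm ℕ ℕ).toEmbedding]
      refine card_le_five_of_flat_corner (c := d) (d := c) hα ?_ ((hmem _ _).2 hr)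
        (fun x y h => hd y x ((hmem _ _).1 h)) (fun x y h => hc y x ((hmem _ _).1 h)) ?_
      · convert hE.swap using 1
        ext ⟨x, y⟩
        simp
      · intro x y h hx hy
        by_contra hlt
        exact hE.not_flat_and_steep hα ((hmem _ _).1 h) hs hr hx hec (by omega) hst
  · have hrow : ∃ m, ∀ x, (x, d) ∈ E → x = m ∨ x = m + 1 := by
      by_cases h : ∃ x, (x, d) ∈ E ∧ x < a
      · obtain ⟨m, hm, hma⟩ := h
        refine ⟨m, fun x hx => ?_⟩
        have h1 := hE.row hα hm hp hma
        have h2 := hE.row hα hm hx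
        have h3 := hE.row hα hx hm
        have h4 := hE.row hα hx hp
        omega
      · push Not at h
        refine ⟨a, fun x hx => ?_⟩
        have h1 := h x hx
        have h2 := hE.row hα hp hx
        omega
    have hcol : ∃ m, ∀ y, (c, y) ∈ E → y = m ∨ y = m + 1 := by
      by_cases h : ∃ y, (c, y) ∈ E ∧ y < f
      · obtain ⟨m, hm, hmf⟩ := h
        refine ⟨m, fun y hy => ?_⟩
        have h1 := hE.col hα hm hq hmf
        have h2 := hE.col hα hm hy
        have h3 := hE.col hα hy hm
        have h4 := hE.col hα hy hq
        omega
      · push Not at h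
        refine ⟨f, fun y hy => ?_⟩
        have h1 := h y hy
        have h2 := hE.col hα hq hy
        omega
    obtain ⟨m, hm⟩ := hrow
    obtain ⟨n, hn⟩ := hcol
    have hac : a < c := lt_of_le_of_ne (hc _ _ hp) (by rintro rfl; exact hr hp)
    have hfd : f < d := lt_of_le_of_ne (hd _ _ hq) (by rintro rfl; exact hr hq)
    have hsub : E ⊆ {(m, d), (m + 1, d), (c, n), (c, n + 1), (c - 1, d - 1)} := by
      rintro ⟨x, y⟩ h
      have h1 := hc x y h
      have h2 := hd x y h
      have h3 : y = d → x = m ∨ x = m + 1 := by rintro rfl; exact hm x h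
      have h4 : x = c → y = n ∨ y = n + 1 := by rintro rfl; exact hn y h
      have h5 := hE.antitone hα hp hq h hac hfd
      simp only [Finset.mem_insert, Finset.mem_singleton, Prod.mk.injEq]
      omega
    exact (Finset.card_le_card hsub).trans Finset.card_le_five

end Counting

section Polygon

variable {α : ℝ}

lemma expLattice_eq_range : expLattice α = Set.range (expPoint α) := by
  ext z
  constructor
  · rintro ⟨m, n, rfl⟩
    exact ⟨(m, n), rfl⟩
  · rintro ⟨p, rfl⟩
    exact ⟨p.1, p.2, rfl⟩

lemma emptyTriangles_preimage {X : Set (ℝ × ℝ)} (hX : IsEmptyPolygonIn (expLattice α) X)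
    (hα : 1 < α) : EmptyTriangles α (expPoint α ⁻¹' X) := by
  obtain ⟨-, hconv, hempty⟩ := hX
  intro p hp q hq r hr w hw
  have hsub : ({expPoint α p, expPoint α q, expPoint α r} : Set (ℝ × ℝ)) ⊆ X := by
    rintro z (rfl | rfl | rfl) <;> assumption
  have hwX : expPoint α w ∈ X := by
    rw [← hempty]
    exact ⟨convexHull_mono hsub hw, w.1, w.2, rfl⟩
  by_contra hne
  refine hconv _ hwX (convexHull_mono (fun z hz => Set.mem_sdiff_singleton.2 ⟨hsub hz, ?_⟩) hw)
  rintro rfl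
  refine hne ?_
  rcases hz with h | h | h
  · exact Or.inl (expPoint_injective hα h)
  · exact Or.inr (Or.inl (expPoint_injective hα h))
  · exact Or.inr (Or.inr (expPoint_injective hα h))

lemma ncard_le_five (hα : 2 ≤ α) {X : Set (ℝ × ℝ)} (hfin : X.Finite)
    (hX : IsEmptyPolygonIn (expLattice α) X) : X.ncard ≤ 5 := by
  have hα1 : 1 < α := by linarith
  have hinj := expPoint_injective hα1
  have hfin' : (expPoint α ⁻¹' X).Finite := hfin.preimage hinj.injOn
  have hcard := card_le_five (E := hfin'.toFinset) hα
    (by simpa using emptyTriangles_preimage hX hα1)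
  rwa [← Set.ncard_eq_toFinset_card _ hfin', Set.ncard_preimage_of_injective_subset_range hinj
    (expLattice_eq_range ▸ hX.1)] at hcard

lemma le_of_mem_convexHull {X : Set (ℝ × ℝ)} {z : ℝ × ℝ} (s t k : ℝ)
    (h : ∀ x ∈ X, s * x.1 + t * x.2 ≤ k) (hz : z ∈ convexHull ℝ X) :
    s * z.1 + t * z.2 ≤ k := by
  have hlin : IsLinearMap ℝ fun x : ℝ × ℝ => s * x.1 + t * x.2 :=
    ⟨fun x y => by simp only [Prod.fst_add, Prod.snd_add]; ring,
      fun c x => by simp only [Prod.smul_fst, Prod.smul_snd, smul_eq_mul]; ring⟩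
  exact convexHull_min h (convex_halfSpace_le hlin k) hz

/-- The exponents of the vertices of an empty convex pentagon. -/
def pentagon : Finset (ℕ × ℕ) := {(0, 2), (1, 1), (1, 2), (2, 0), (2, 1)}

lemma forall_mem_image_pentagon {P : ℝ × ℝ → Prop} :
    (∀ x ∈ expPoint α '' pentagon, P x) ↔ P (1, α ^ 2) ∧ P (α, α) ∧ P (α, α ^ 2) ∧
      P (α ^ 2, 1) ∧ P (α ^ 2, α) := by
  rw [Set.forall_mem_image]
  simp [pentagon, expPoint]

lemma isEmptyPolygonIn_pentagon (hα : 2 ≤ α) :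
    IsEmptyPolygonIn (expLattice α) (expPoint α '' pentagon) := by
  have hα1 : 1 < α := by linarith
  refine ⟨?_, ?_, ?_⟩
  · rw [expLattice_eq_range]
    exact Set.image_subset_range _ _
  · have separate : ∀ v : ℝ × ℝ, ∀ s t k : ℝ, k < s * v.1 + t * v.2 →
        (∀ x ∈ expPoint α '' pentagon, x ≠ v → s * x.1 + t * x.2 ≤ k) →
        v ∉ convexHull ℝ (expPoint α '' pentagon \ {v}) := by
      intro v s t k hv h hmem
      exact absurd (le_of_mem_convexHull s t k (fun x hx => h x hx.1 hx.2) hmem) (not_le.2 hv)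
    rw [StrictConvexPos, forall_mem_image_pentagon]
    refine ⟨separate _ (-1) 0 (-α) ?_ ?_, separate _ (-1) (-1) (-1 - α ^ 2) ?_ ?_,
      separate _ 1 2 (1 + 2 * α ^ 2) ?_ ?_, separate _ 0 (-1) (-α) ?_ ?_,
      separate _ 2 1 (1 + 2 * α ^ 2) ?_ ?_⟩
    all_goals first
      | nlinarith
      | rw [forall_mem_image_pentagon]
        refine ⟨fun h => ?_, fun h => ?_, fun h => ?_, fun h => ?_, fun h => ?_⟩ <;>
        first
          | exact absurd rfl h
          | nlinarith
  · refine Set.Subset.antisymm ?_ ?_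
    · rintro z ⟨hz, hzL⟩
      rw [expLattice_eq_range] at hzL
      obtain ⟨⟨m, n⟩, rfl⟩ := hzL
      have bound := fun s t k h => le_of_mem_convexHull s t k h hz
      simp only [forall_mem_image_pentagon] at bound
      have h1 := bound 1 0 (α ^ 2) (by refine ⟨?_, ?_, ?_, ?_, ?_⟩ <;> nlinarith)
      have h2 := bound 0 1 (α ^ 2) (by refine ⟨?_, ?_, ?_, ?_, ?_⟩ <;> nlinarith)
      have h3 := bound 1 1 (α ^ 2 + α) (by refine ⟨?_, ?_, ?_, ?_, ?_⟩ <;> nlinarith)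
      have h4 := bound (-α) (-1) (-(α + α ^ 2)) (by refine ⟨?_, ?_, ?_, ?_, ?_⟩ <;> nlinarith)
      have h5 := bound (-1) (-α) (-(α + α ^ 2)) (by refine ⟨?_, ?_, ?_, ?_, ?_⟩ <;> nlinarith)
      simp only [expPoint] at h1 h2 h3 h4 h5
      have hm : m ≤ 2 := (pow_le_pow_iff_right₀ hα1).1 (by linarith)
      have hn : n ≤ 2 := (pow_le_pow_iff_right₀ hα1).1 (by linarith)
      refine Set.mem_image_of_mem _ ?_
      interval_cases m <;> interval_cases n <;>
        first
          | (simp [pentagon]; done)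
          | (exfalso; (try simp only [pow_zero, pow_one] at h1 h2 h3 h4 h5); nlinarith)
    · refine Set.subset_inter (subset_convexHull ℝ _) ?_
      rw [expLattice_eq_range]
      exact Set.image_subset_range _ _

end Polygon

end ExpLattice

theorem h_eq_five (α : ℝ) (hα : 2 ≤ α) :
    (∃ X : Set (ℝ × ℝ), X.Finite ∧ IsEmptyPolygonIn (expLattice α) X ∧ X.ncard = 5) ∧
    (∀ X : Set (ℝ × ℝ), X.Finite → IsEmptyPolygonIn (expLattice α) X → X.ncard ≤ 5) := by
  refine ⟨⟨ExpLattice.expPoint α '' ExpLattice.pentagon, Set.toFinite _,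
    ExpLattice.isEmptyPolygonIn_pentagon hα, ?_⟩,
    fun X hfin hX => ExpLattice.ncard_le_five hα hfin hX⟩
  rw [Set.ncard_image_of_injective _ (ExpLattice.expPoint_injective (by linarith)),
    Set.ncard_coe_finset]
  rfl
end
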